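/- Let (C_n) and (C'_n) be sequences where C_n and C'_n are conjugacy classes of the symmetric group S_n, with cycle counts c_j(n) and c'_j(n) respectively. Assume that c_1(n) = o(n^{2/3}), c'_1(n) = o(n^{2/3}), that (c_1(n) + c_2(n)^{1/2})(c'_1(n) + c'_2(n)^{1/2}) = O(n), and that limsup_{n→∞} (c_2(n) + c'_2(n))/n < 1. Then liminf_{n→∞} P_n > 0, where P_n is the probability that two independent uniformly random elements π ∈ C_n and π' ∈ C'_n generate a subgroup containing A_n. -/

import Mathlib

open Filter Asymptotics

/-- The number of `j`-cycles in the cycle decomposition of `π` (fixed points are `1`-cycles). -/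
noncomputable def cycleCount {n : ℕ} (π : Equiv.Perm (Fin n)) (j : ℕ) : ℕ :=
  if j = 1 then Nat.card (Function.fixedPoints ⇑π) else Multiset.count j π.cycleType

/-- The probability that, for `π₁` uniform in the conjugacy class of `π` and `π₂` uniform and
independent in the conjugacy class of `π'`, the subgroup `⟨π₁, π₂⟩` contains `A_n`. -/
noncomputable def genProb (n : ℕ) (π π' : Equiv.Perm (Fin n)) : ℝ :=
  (Nat.card {p : Equiv.Perm (Fin n) × Equiv.Perm (Fin n) //
      IsConj π p.1 ∧ IsConj π' p.2 ∧
      alternatingGroup (Fin n) ≤ Subgroup.closure {p.1, p.2}} : ℝ) /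
  ((Nat.card {σ : Equiv.Perm (Fin n) // IsConj π σ} : ℝ) *
   (Nat.card {σ : Equiv.Perm (Fin n) // IsConj π' σ} : ℝ))

set_option linter.unusedSectionVars false

namespace RandGen
open Finset Equiv Equiv.Perm

variable {α : Type*} [Fintype α] [DecidableEq α]

/-- The orbit of `x` under the permutation `w`. -/
def orb (w : Perm α) (x : α) : Finset α := univ.filter (fun y => w.SameCycle x y)

/-- The length of the cycle of `w` through `x`. -/
def per (w : Perm α) (x : α) : ℕ := (orb w x).card

lemma mem_orb {w : Perm α} {x y : α} : y ∈ orb w x ↔ w.SameCycle x y := by simp [orb]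

lemma self_mem_orb (w : Perm α) (x : α) : x ∈ orb w x := mem_orb.2 (SameCycle.refl _ _)

lemma per_pos (w : Perm α) (x : α) : 0 < per w x := card_pos.2 ⟨x, self_mem_orb w x⟩

lemma orb_eq_of_mem {w : Perm α} {x y : α} (h : y ∈ orb w x) : orb w y = orb w x := by
  rw [mem_orb] at h
  ext z; rw [mem_orb, mem_orb]; exact ⟨h.trans, h.symm.trans⟩

lemma per_eq_of_mem {w : Perm α} {x y : α} (h : y ∈ orb w x) : per w y = per w x := by
  rw [per, orb_eq_of_mem h, per]

lemma mem_orb_comm {w : Perm α} {x y : α} : y ∈ orb w x ↔ x ∈ orb w y := by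
  rw [mem_orb, mem_orb, sameCycle_comm]

lemma pow_mem_orb (w : Perm α) (x : α) (i : ℕ) : (w ^ i) x ∈ orb w x := by
  rw [mem_orb, sameCycle_pow_right]

lemma apply_mem_orb {w : Perm α} {x y : α} : w y ∈ orb w x ↔ y ∈ orb w x := by
  rw [mem_orb, mem_orb, sameCycle_apply_right]

lemma isCycleOn_orb (w : Perm α) (x : α) : w.IsCycleOn (orb w x : Set α) := by
  refine ⟨⟨fun y hy => ?_, w.injective.injOn, fun y hy => ⟨w⁻¹ y, ?_, by simp⟩⟩, fun y hy z hz => ?_⟩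
  · exact mem_coe.2 (apply_mem_orb.2 (mem_coe.1 hy))
  · rw [mem_coe, ← apply_mem_orb]; simpa using hy
  · rw [mem_coe, mem_orb] at *; exact hy.symm.trans hz

lemma pow_per (w : Perm α) (x : α) : (w ^ per w x) x = x :=
  (isCycleOn_orb w x).pow_card_apply (self_mem_orb w x)

lemma pow_eq_iff (w : Perm α) (x : α) (i : ℕ) : (w ^ i) x = x ↔ per w x ∣ i :=
  (isCycleOn_orb w x).pow_apply_eq (self_mem_orb w x)

lemma exists_pow_of_mem_orb {w : Perm α} {x y : α} (h : y ∈ orb w x) :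
    ∃ i < per w x, (w ^ i) x = y :=
  (isCycleOn_orb w x).exists_pow_eq (self_mem_orb w x) h

lemma pow_inj {w : Perm α} {x : α} {i j : ℕ} (hi : i < per w x) (hj : j < per w x)
    (h : (w ^ i) x = (w ^ j) x) : i = j := by
  have := ((isCycleOn_orb w x).pow_apply_eq_pow_apply (self_mem_orb w x)).1 h
  exact Nat.ModEq.eq_of_lt_of_lt this hi hj

lemma orb_eq_image {w : Perm α} {x : α} {m : ℕ} (hm : 0 < m) (h : (w ^ m) x = x) :
    orb w x = (range m).image (fun i => (w ^ i) x) := by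
  ext y
  rw [mem_image]
  constructor
  · intro hy
    obtain ⟨i, -, hi⟩ := exists_pow_of_mem_orb hy
    refine ⟨i % m, mem_range.2 (Nat.mod_lt _ hm), ?_⟩
    rw [← hi]
    have : (w ^ (m * (i / m))) x = x := by
      rw [pow_eq_iff]; exact Dvd.dvd.mul_right ((pow_eq_iff _ _ _).1 h) _
    conv_rhs => rw [← Nat.mod_add_div i m, pow_add, Perm.mul_apply, this]
  · rintro ⟨i, -, rfl⟩; exact pow_mem_orb _ _ _

lemma per_eq_of_pow {w : Perm α} {x : α} {m : ℕ} (hm : 0 < m) (h : (w ^ m) x = x)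
    (hne : ∀ i, 0 < i → i < m → (w ^ i) x ≠ x) : per w x = m := by
  have h1 : per w x ∣ m := (pow_eq_iff _ _ _).1 h
  rcases (Nat.le_of_dvd hm h1).lt_or_eq with h2 | h2
  · exact absurd (pow_per w x) (hne _ (per_pos _ _) h2)
  · exact h2

/-- Conjugation by a transposition. -/
def sw (a b : α) (ρ : Perm α) : Perm α := swap a b * ρ * swap a b

lemma sw_sw (a b : α) (ρ : Perm α) : sw a b (sw a b ρ) = ρ := by
  have : swap a b * swap a b = 1 := swap_mul_self a b
  calc sw a b (sw a b ρ) = (swap a b * swap a b) * ρ * (swap a b * swap a b) := by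
        simp only [sw, mul_assoc]
    _ = ρ := by simp [this]

/-- A set of permutations closed under conjugation. -/
def ConjClosed (C : Finset (Perm α)) : Prop := ∀ ρ ∈ C, ∀ τ : Perm α, τ * ρ * τ⁻¹ ∈ C

lemma ConjClosed.sw_mem {C : Finset (Perm α)} (hC : ConjClosed C) {ρ : Perm α} (h : ρ ∈ C)
    (a b : α) : sw a b ρ ∈ C := by
  have := hC ρ h (swap a b)
  rwa [swap_inv] at this

lemma switch_sum {T : Type*} [Fintype T] {C : Finset (Perm α)} (hC : ConjClosed C)
    (A B : T → α) (Src : Perm α → T → Prop) [∀ ρ, DecidablePred (Src ρ)] :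
    ∑ ρ ∈ C, (univ.filter (fun t => Src ρ t)).card =
      ∑ ρ ∈ C, (univ.filter (fun t => Src (sw (A t) (B t) ρ) t)).card := by
  simp only [card_filter]
  rw [sum_comm, sum_comm (s := C)]
  refine sum_congr rfl fun t _ => ?_
  refine sum_nbij' (sw (A t) (B t)) (sw (A t) (B t)) ?_ ?_ ?_ ?_ ?_
  · intro ρ h; exact hC.sw_mem h _ _
  · intro ρ h; exact hC.sw_mem h _ _
  · intro ρ h; exact sw_sw _ _ _
  · intro ρ h; exact sw_sw _ _ _
  · intro ρ h; rw [sw_sw]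

/-- The switching principle. -/
lemma switch_le {T : Type*} [Fintype T] {C : Finset (Perm α)} (hC : ConjClosed C)
    (A B : T → α) (Src : Perm α → T → Prop) [∀ ρ, DecidablePred (Src ρ)] (X R : Perm α → ℕ)
    (hX : ∀ ρ ∈ C, X ρ ≤ (univ.filter (fun t => Src ρ t)).card)
    (hR : ∀ ρ ∈ C, (univ.filter (fun t => Src (sw (A t) (B t) ρ) t)).card ≤ R ρ) :
    ∑ ρ ∈ C, X ρ ≤ ∑ ρ ∈ C, R ρ :=
  (sum_le_sum hX).trans ((switch_sum hC A B Src).le.trans (sum_le_sum hR))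

lemma sw_apply (a b : α) (ρ : Perm α) (x : α) :
    sw a b ρ x = swap a b (ρ (swap a b x)) := rfl

/-- Following a path of `ρ * q` after switching. -/
lemma path_switch {a b : α} {ρ q : Perm α} {x : α} {m : ℕ}
    (h1 : ∀ j < m, q (((ρ * q) ^ j) x) ≠ a ∧ q (((ρ * q) ^ j) x) ≠ b)
    (h2 : ∀ j, 0 < j → j < m → ((ρ * q) ^ j) x ≠ a ∧ ((ρ * q) ^ j) x ≠ b) :
    (∀ j < m, ((sw a b ρ * q) ^ j) x = ((ρ * q) ^ j) x) ∧
      (0 < m → ((sw a b ρ * q) ^ m) x = swap a b (((ρ * q) ^ m) x)) := by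
  have key : ∀ j < m, ((sw a b ρ * q) ^ j) x = ((ρ * q) ^ j) x →
      ((sw a b ρ * q) ^ (j + 1)) x = swap a b (((ρ * q) ^ (j + 1)) x) := by
    intro j hj hh
    rw [pow_succ', Perm.mul_apply, hh, pow_succ', Perm.mul_apply, Perm.mul_apply, sw_apply,
      swap_apply_of_ne_of_ne (h1 j hj).1 (h1 j hj).2, Perm.mul_apply]
  have hA : ∀ j < m, ((sw a b ρ * q) ^ j) x = ((ρ * q) ^ j) x := by
    intro j
    induction j with
    | zero => intro _; simp
    | succ j ih =>
      intro hj
      rw [key j (by omega) (ih (by omega)),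
        swap_apply_of_ne_of_ne (h2 _ (by omega) hj).1 (h2 _ (by omega) hj).2]
  refine ⟨hA, fun hm => ?_⟩
  obtain ⟨k, rfl⟩ : ∃ k, m = k + 1 := ⟨m - 1, by omega⟩
  exact key k (by omega) (hA k (by omega))

/-- The points touched by the cycle of `ρ * q` through `x`: the cycle and its image under `q`. -/
def nbr (ρ q : Perm α) (x : α) : Finset α :=
  orb (ρ * q) x ∪ (orb (ρ * q) x).image q

lemma card_nbr_le (ρ q : Perm α) (x : α) : (nbr ρ q x).card ≤ 2 * per (ρ * q) x := by
  refine (card_union_le _ _).trans ?_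
  rw [card_image_of_injective _ q.injective, per]; omega

lemma not_mem_nbr {ρ q : Perm α} {x b : α} :
    b ∉ nbr ρ q x ↔ b ∉ orb (ρ * q) x ∧ q⁻¹ b ∉ orb (ρ * q) x := by
  rw [nbr, mem_union, not_or, mem_image]
  constructor
  · rintro ⟨h1, h2⟩; exact ⟨h1, fun h => h2 ⟨_, h, by simp⟩⟩
  · rintro ⟨h1, h2⟩; refine ⟨h1, ?_⟩; rintro ⟨y, hy, rfl⟩; exact h2 (by simpa using hy)

/-- A cycle that avoids `a` and `b` is preserved by switching. -/
lemma orb_switch_of_not_mem {a b : α} {ρ q : Perm α} {x : α}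
    (ha : a ∉ nbr ρ q x) (hb : b ∉ nbr ρ q x) :
    orb (sw a b ρ * q) x = orb (ρ * q) x := by
  rw [not_mem_nbr] at ha hb
  have hne : ∀ j, (q (((ρ * q) ^ j) x) ≠ a ∧ q (((ρ * q) ^ j) x) ≠ b) ∧
      ((ρ * q) ^ j) x ≠ a ∧ ((ρ * q) ^ j) x ≠ b := by
    intro j
    have := pow_mem_orb (ρ * q) x j
    refine ⟨⟨?_, ?_⟩, ?_, ?_⟩
    · rintro rfl; exact ha.2 (by simpa using this)
    · rintro rfl; exact hb.2 (by simpa using this)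
    · rintro rfl; exact ha.1 this
    · rintro rfl; exact hb.1 this
  obtain ⟨h1, -⟩ := path_switch (m := per (ρ * q) x + 1) (fun j _ => (hne j).1)
    (fun j _ _ => (hne j).2)
  have hL := per_pos (ρ * q) x
  rw [orb_eq_image hL (by rw [h1 _ (by omega)]; exact pow_per _ _),
    orb_eq_image hL (pow_per (ρ * q) x)]
  refine image_congr fun i hi => ?_
  have := mem_range.1 (mem_coe.1 hi)
  exact h1 i (by omega)

/-- A cycle with an exposed point `a` is opened by switching `a` with a distant `b`. -/
lemma pow_switch_of_exposed {a b : α} {ρ q : Perm α}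
    (ha : q⁻¹ a ∉ orb (ρ * q) a) (hb : b ∉ nbr ρ q a) :
    ((sw a b ρ * q) ^ per (ρ * q) a) a = b ∧
      ∀ j < per (ρ * q) a, ((sw a b ρ * q) ^ j) a = ((ρ * q) ^ j) a := by
  rw [not_mem_nbr] at hb
  have hL := per_pos (ρ * q) a
  have e1 : ∀ j < per (ρ * q) a, q (((ρ * q) ^ j) a) ≠ a ∧ q (((ρ * q) ^ j) a) ≠ b := by
    intro j _
    have := pow_mem_orb (ρ * q) a j
    refine ⟨?_, ?_⟩
    · intro h; apply ha; rwa [Perm.inv_eq_iff_eq.2 h.symm]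
    · intro h; apply hb.2; rwa [Perm.inv_eq_iff_eq.2 h.symm]
  have e2 : ∀ j, 0 < j → j < per (ρ * q) a →
      ((ρ * q) ^ j) a ≠ a ∧ ((ρ * q) ^ j) a ≠ b := by
    intro j hj hj'
    refine ⟨?_, ?_⟩
    · intro h; exact absurd (pow_inj (i := j) (j := 0) hj' hL (by simpa using h)) (by omega)
    · rintro rfl; exact hb.1 (pow_mem_orb _ _ _)
  obtain ⟨h1, h2⟩ := path_switch e1 e2
  refine ⟨?_, h1⟩
  rw [h2 hL, pow_per, swap_apply_left]

/-- Points on `ℓ`-cycles of `ρ * q` that are exposed: their `q`-preimage is on another cycle. -/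
def expo (ρ q : Perm α) (ℓ : ℕ) : Finset α :=
  univ.filter (fun a => per (ρ * q) a = ℓ ∧ q⁻¹ a ∉ orb (ρ * q) a)

lemma mem_expo {ρ q : Perm α} {ℓ : ℕ} {a : α} :
    a ∈ expo ρ q ℓ ↔ per (ρ * q) a = ℓ ∧ q⁻¹ a ∉ orb (ρ * q) a := by simp [expo]

lemma card_compl_ge {s : Finset α} {k : ℕ} (h : s.card ≤ k) :
    Fintype.card α - k ≤ (univ.filter (fun b => b ∉ s)).card := by
  have : (univ.filter (fun b => b ∉ s)) = sᶜ := by ext; simp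
  rw [this, card_compl]; omega

/-- The switching principle, for marks `t` with a switching partner `b` outside `N ρ t`. -/
lemma switch_pairs {β κ : Type*} [Fintype β] {C : Finset (Perm α)} (hC : ConjClosed C)
    (A : β → α) (S : Perm α → Finset β) (N : Perm α → β → Finset α) (k : ℕ)
    (hN : ∀ ρ, ∀ t ∈ S ρ, (N ρ t).card ≤ k) (K : Perm α → Finset κ) (f : Perm α → β → α → κ)
    (hf : ∀ ρ t b, t ∈ S (sw (A t) b ρ) → b ∉ N (sw (A t) b ρ) t → f ρ t b ∈ K ρ)
    (hinj : ∀ ρ t b t' b', t ∈ S (sw (A t) b ρ) → b ∉ N (sw (A t) b ρ) t →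
      t' ∈ S (sw (A t') b' ρ) → b' ∉ N (sw (A t') b' ρ) t' → f ρ t b = f ρ t' b' →
      t = t' ∧ b = b') :
    (Fintype.card α - k) * ∑ ρ ∈ C, (S ρ).card ≤ ∑ ρ ∈ C, (K ρ).card := by
  classical
  rw [mul_sum]
  refine switch_le hC (T := β × α) (fun t => A t.1) (fun t => t.2)
    (fun ρ t => t.1 ∈ S ρ ∧ t.2 ∉ N ρ t.1) _ _ (fun ρ _ => ?_) (fun ρ _ => ?_)
  · rw [card_filter, ← univ_product_univ, sum_product, mul_comm, ← smul_eq_mul, ← sum_const,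
      ← sum_subset (subset_univ (S ρ))]
    · refine sum_le_sum fun t ht => ?_
      simpa [ht, card_filter] using card_compl_ge (hN ρ t ht)
    · intro t _ ht
      simp [ht]
  · refine card_le_card_of_injOn (fun t => f ρ t.1 t.2) (fun t ht => ?_) ?_
    · have := (mem_filter.1 (mem_coe.1 ht)).2
      exact mem_coe.2 (hf ρ _ _ this.1 this.2)
    · rintro ⟨t, b⟩ h ⟨t', b'⟩ h' heq
      have h1 := (mem_filter.1 (mem_coe.1 h)).2
      have h2 := (mem_filter.1 (mem_coe.1 h')).2
      have := hinj ρ t b t' b' h1.1 h1.2 h2.1 h2.2 heq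
      rw [this.1, this.2]

lemma expo_moment {C : Finset (Perm α)} (hC : ConjClosed C) (q : Perm α) (ℓ : ℕ) :
    (Fintype.card α - 2 * ℓ) * ∑ ρ ∈ C, (expo ρ q ℓ).card ≤ Fintype.card α * C.card := by
  have key : ∀ ρ a b, a ∈ expo (sw a b ρ) q ℓ → b ∉ nbr (sw a b ρ) q a →
      ((ρ * q) ^ ℓ) a = b := by
    intro ρ a b h h'
    rw [mem_expo] at h
    have e := (pow_switch_of_exposed h.2 h').1
    rwa [sw_sw, h.1] at e
  have := switch_pairs hC (A := fun a => a) (fun ρ => expo ρ q ℓ) (fun ρ a => nbr ρ q a) (2 * ℓ)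
    (fun ρ a ha => by rw [← (mem_expo.1 ha).1]; exact card_nbr_le _ _ _)
    (fun _ => univ) (fun _ a _ => a) (fun _ _ _ _ _ => mem_univ _)
    (by
      rintro ρ a b a' b' h1 h2 h3 h4 rfl
      exact ⟨rfl, (key _ _ _ h1 h2).symm.trans (key _ _ _ h3 h4)⟩)
  simpa [mul_comm] using this

/-- Pairs of points `a`, `c` on different cycles, of lengths `ℓ₁` and `ℓ₂`, with `a` exposed with
respect to both cycles. -/
def expoPair (ρ q : Perm α) (ℓ₁ ℓ₂ : ℕ) : Finset (α × α) :=
  univ.filter (fun t => per (ρ * q) t.1 = ℓ₁ ∧ per (ρ * q) t.2 = ℓ₂ ∧ t.2 ∉ orb (ρ * q) t.1 ∧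
    q⁻¹ t.1 ∉ orb (ρ * q) t.1 ∧ q⁻¹ t.1 ∉ orb (ρ * q) t.2)

lemma mem_expoPair {ρ q : Perm α} {ℓ₁ ℓ₂ : ℕ} {a c : α} : (a, c) ∈ expoPair ρ q ℓ₁ ℓ₂ ↔
    per (ρ * q) a = ℓ₁ ∧ per (ρ * q) c = ℓ₂ ∧ c ∉ orb (ρ * q) a ∧
    q⁻¹ a ∉ orb (ρ * q) a ∧ q⁻¹ a ∉ orb (ρ * q) c := by simp [expoPair]

/-- Switching at a doubly exposed point opens the first cycle and preserves the second. -/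
lemma expoPair_switch {ρ q : Perm α} {ℓ₁ ℓ₂ : ℕ} {a b c : α}
    (h : (a, c) ∈ expoPair (sw a b ρ) q ℓ₁ ℓ₂)
    (hb : b ∉ nbr (sw a b ρ) q a ∪ nbr (sw a b ρ) q c) :
    orb (ρ * q) c = orb (sw a b ρ * q) c ∧ ((ρ * q) ^ ℓ₁) a = b ∧
      ∀ j < ℓ₁, ((ρ * q) ^ j) a = ((sw a b ρ * q) ^ j) a := by
  obtain ⟨h1, h2, h3, h4, h5⟩ := mem_expoPair.1 h
  rw [mem_union, not_or] at hb
  have e1 := orb_switch_of_not_mem (a := a) (b := b) (x := c) (ρ := sw a b ρ) (q := q)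
    (not_mem_nbr.2 ⟨fun h => h3 (mem_orb_comm.1 h), h5⟩) hb.2
  have e2 := pow_switch_of_exposed h4 hb.1
  rw [sw_sw] at e1
  rw [sw_sw, h1] at e2
  exact ⟨e1, e2⟩

lemma card_nbr_union_le {ρ q : Perm α} {ℓ₁ ℓ₂ : ℕ} {a c : α} (h : (a, c) ∈ expoPair ρ q ℓ₁ ℓ₂) :
    (nbr ρ q a ∪ nbr ρ q c).card ≤ 2 * ℓ₁ + 2 * ℓ₂ := by
  have h1 := card_nbr_le ρ q a
  have h2 := card_nbr_le ρ q c
  rw [(mem_expoPair.1 h).1] at h1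
  rw [(mem_expoPair.1 h).2.1] at h2
  exact (card_union_le _ _).trans (by omega)

/-- Points on `ℓ`-cycles of `ρ * q` on which a proportion at least `ε` of points is exposed. -/
noncomputable def richPt (ε : ℝ) (ρ q : Perm α) (ℓ : ℕ) : Finset α :=
  open Classical in univ.filter (fun a => per (ρ * q) a = ℓ ∧
    ε * ℓ ≤ ((orb (ρ * q) a).filter (fun z => q⁻¹ z ∉ orb (ρ * q) a)).card)

lemma mem_richPt {ε : ℝ} {ρ q : Perm α} {ℓ : ℕ} {a : α} : a ∈ richPt ε ρ q ℓ ↔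
    per (ρ * q) a = ℓ ∧
    ε * ℓ ≤ ((orb (ρ * q) a).filter (fun z => q⁻¹ z ∉ orb (ρ * q) a)).card := by
  simp [richPt]

lemma mul_card_richPt_le (ε : ℝ) (ρ q : Perm α) {ℓ : ℕ} (hℓ : 0 < ℓ) :
    ε * (richPt ε ρ q ℓ).card ≤ (expo ρ q ℓ).card := by
  classical
  have h1 : ε * ℓ * (richPt ε ρ q ℓ).card ≤
      (((richPt ε ρ q ℓ) ×ˢ (expo ρ q ℓ)).filter (fun t => t.2 ∈ orb (ρ * q) t.1)).card := by
    rw [card_filter, sum_product, mul_comm, ← nsmul_eq_mul, ← sum_const]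
    push_cast
    refine sum_le_sum fun a ha => ?_
    obtain ⟨h1, h2⟩ := mem_richPt.1 ha
    refine h2.trans ?_
    have : (∑ x ∈ expo ρ q ℓ, if x ∈ orb (ρ * q) a then (1 : ℝ) else 0) =
        ((expo ρ q ℓ).filter (fun x => x ∈ orb (ρ * q) a)).card := by
      rw [card_filter]; push_cast; rfl
    rw [this]
    norm_cast
    refine card_le_card fun z hz => ?_
    rw [mem_filter] at hz ⊢
    refine ⟨mem_expo.2 ⟨?_, ?_⟩, hz.1⟩
    · rw [per_eq_of_mem hz.1, h1]
    · rw [orb_eq_of_mem hz.1]; exact hz.2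
  have h2 : (((richPt ε ρ q ℓ) ×ˢ (expo ρ q ℓ)).filter (fun t => t.2 ∈ orb (ρ * q) t.1)).card ≤
      ℓ * (expo ρ q ℓ).card := by
    rw [card_filter, sum_product_right, mul_comm, ← smul_eq_mul (#_)]
    refine sum_le_card_nsmul _ _ _ fun c hc => ?_
    rw [← card_filter, ← (mem_expo.1 hc).1]
    refine card_le_card fun z hz => ?_
    exact mem_orb_comm.1 (mem_filter.1 hz).2
  have h3 : ε * ℓ * (richPt ε ρ q ℓ).card ≤ ℓ * (expo ρ q ℓ).card :=
    h1.trans (by exact_mod_cast h2)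
  have hℓ' : (0 : ℝ) < ℓ := by exact_mod_cast hℓ
  nlinarith

/-- Every invariant set of `ρ * q` of at most half the size is expanded by `q`. -/
def Expanding (ε : ℝ) (ρ q : Perm α) : Prop :=
  ∀ W : Finset α, W.Nonempty → (∀ x ∈ W, (ρ * q) x ∈ W) → 2 * W.card ≤ Fintype.card α →
    ε * W.card ≤ (W.filter (fun z => q⁻¹ z ∉ W)).card

lemma Expanding.mem_richPt {ε : ℝ} {ρ q : Perm α} (h : Expanding ε ρ q) {x : α}
    (hx : 2 * per (ρ * q) x ≤ Fintype.card α) : x ∈ richPt ε ρ q (per (ρ * q) x) := by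
  rw [RandGen.mem_richPt]
  exact ⟨rfl, h (orb (ρ * q) x) ⟨x, self_mem_orb _ _⟩ (fun y hy => apply_mem_orb.2 hy) hx⟩

lemma disjoint_orb {w : Perm α} {x y : α} (h : y ∉ orb w x) : Disjoint (orb w x) (orb w y) := by
  rw [disjoint_left]
  intro z hz hz'
  exact h (by rw [← orb_eq_of_mem hz, orb_eq_of_mem hz']; exact self_mem_orb _ _)

/-- The points of the cycle of `a` whose `q`-preimages are neither on it nor on that of `c`. -/
def outer (ρ q : Perm α) (a c : α) : Finset α :=
  (orb (ρ * q) a).filter (fun z => q⁻¹ z ∉ orb (ρ * q) a ∧ q⁻¹ z ∉ orb (ρ * q) c)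

lemma outer_eq_of_mem {ρ q : Perm α} {a c a' c' : α} (ha : a' ∈ orb (ρ * q) a)
    (hc : c' ∈ orb (ρ * q) c) : outer ρ q a' c' = outer ρ q a c := by
  rw [outer, outer, orb_eq_of_mem ha, orb_eq_of_mem hc]

lemma mem_expoPair_of_outer {ρ q : Perm α} {x c a : α} (hc : c ∉ orb (ρ * q) x)
    (ha : a ∈ outer ρ q x c) :
    (a, c) ∈ expoPair ρ q (per (ρ * q) x) (per (ρ * q) c) := by
  rw [outer, mem_filter] at ha
  rw [mem_expoPair, per_eq_of_mem ha.1, orb_eq_of_mem ha.1]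
  exact ⟨rfl, rfl, hc, ha.2⟩

lemma Expanding.outer {ε : ℝ} {ρ q : Perm α} (h : Expanding ε ρ q) {x c : α}
    (hc : c ∉ orb (ρ * q) x)
    (hs : 2 * (per (ρ * q) x + per (ρ * q) c) ≤ Fintype.card α) :
    ε * (per (ρ * q) x + per (ρ * q) c) ≤ (outer ρ q x c).card + (outer ρ q c x).card := by
  have hcard : (orb (ρ * q) x ∪ orb (ρ * q) c).card = per (ρ * q) x + per (ρ * q) c :=
    card_union_of_disjoint (disjoint_orb hc)
  have := h (orb (ρ * q) x ∪ orb (ρ * q) c) ⟨x, mem_union_left _ (self_mem_orb _ _)⟩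
    (fun y hy => by
      rw [mem_union, apply_mem_orb, apply_mem_orb, ← mem_union]; exact hy)
    (by rw [hcard]; exact hs)
  rw [hcard] at this
  push_cast at this
  refine this.trans ?_
  norm_cast
  refine (card_le_card ?_).trans (card_union_le _ _)
  intro z hz
  simp only [RandGen.outer, mem_filter, mem_union, not_or] at hz ⊢
  tauto

lemma mul_le_of_sub_mul_le {m k s t : ℕ} (h : (m - k) * s ≤ t) (hk : 3 * k ≤ 2 * m) :
    m * s ≤ 3 * t := by
  have h3 : m ≤ 3 * (m - k) := by omega
  calc m * s ≤ 3 * (m - k) * s := Nat.mul_le_mul_right _ h3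
    _ = 3 * ((m - k) * s) := by ring
    _ ≤ _ := Nat.mul_le_mul_left _ h

lemma richPt_moment {C : Finset (Perm α)} (hC : ConjClosed C) (q : Perm α) {ε : ℝ} {ℓ : ℕ}
    (hℓ : 0 < ℓ) (hn : 3 * ℓ ≤ Fintype.card α) :
    ε * ∑ ρ ∈ C, ((richPt ε ρ q ℓ).card : ℝ) ≤ 3 * C.card := by
  have h1 : (Fintype.card α - 2 * ℓ) * ∑ ρ ∈ C, (expo ρ q ℓ).card ≤ Fintype.card α * C.card :=
    expo_moment hC q ℓ
  have h2 : ∑ ρ ∈ C, (expo ρ q ℓ).card ≤ 3 * C.card := by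
    have := mul_le_of_sub_mul_le h1 (by omega)
    rw [mul_left_comm] at this
    exact Nat.le_of_mul_le_mul_left this (by omega)
  rw [mul_sum]
  calc _ ≤ ∑ ρ ∈ C, ((expo ρ q ℓ).card : ℝ) := sum_le_sum fun ρ _ => mul_card_richPt_le _ _ _ hℓ
    _ ≤ _ := by exact_mod_cast h2

/-- Doubly exposed pairs whose second cycle is rich. -/
noncomputable def richPair (ε : ℝ) (ρ q : Perm α) (ℓ₁ ℓ₂ : ℕ) : Finset (α × α) :=
  (expoPair ρ q ℓ₁ ℓ₂).filter (fun t => t.2 ∈ richPt ε ρ q ℓ₂)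

lemma mem_richPt_congr {ε : ℝ} {ρ ρ' q : Perm α} {ℓ : ℕ} {c : α}
    (h : orb (ρ * q) c = orb (ρ' * q) c) : c ∈ richPt ε ρ q ℓ ↔ c ∈ richPt ε ρ' q ℓ := by
  rw [mem_richPt, mem_richPt, per, h, per]

lemma richPair_moment {C : Finset (Perm α)} (hC : ConjClosed C) (q : Perm α) {ε : ℝ}
    {ℓ₁ ℓ₂ : ℕ} (h₁ : 0 < ℓ₁) (h₂ : 0 < ℓ₂) (hε : 0 < ε)
    (hn : 3 * (ℓ₁ + ℓ₂) ≤ Fintype.card α) :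
    ε * ∑ ρ ∈ C, ((richPair ε ρ q ℓ₁ ℓ₂).card : ℝ) ≤ 9 * C.card := by
  have main := switch_pairs hC (A := fun t : α × α => t.1) (fun ρ => richPair ε ρ q ℓ₁ ℓ₂)
    (fun ρ t => nbr ρ q t.1 ∪ nbr ρ q t.2) (2 * ℓ₁ + 2 * ℓ₂)
    (fun ρ t ht => card_nbr_union_le (mem_filter.1 ht).1)
    (fun ρ => univ ×ˢ richPt ε ρ q ℓ₂) (fun _ t _ => t)
    (by
      rintro ρ ⟨a, c⟩ b h1 h2
      rw [richPair, mem_filter] at h1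
      rw [mem_product]
      exact ⟨mem_univ _, (mem_richPt_congr (expoPair_switch h1.1 h2).1).2 h1.2⟩)
    (by
      rintro ρ ⟨a, c⟩ b ⟨a', c'⟩ b' h1 h2 h3 h4 heq
      rw [Prod.mk.injEq] at heq
      obtain ⟨rfl, rfl⟩ := heq
      exact ⟨rfl, (expoPair_switch (mem_filter.1 h1).1 h2).2.1.symm.trans
        (expoPair_switch (mem_filter.1 h3).1 h4).2.1⟩)
  simp only [card_product, card_univ, ← mul_sum] at main
  have main' := mul_le_of_sub_mul_le main (by omega)
  rify at main'
  have hnpos : (0 : ℝ) < Fintype.card α := by norm_cast; omega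
  have hr := richPt_moment hC q (ε := ε) h₂ (by omega)
  have : ∑ ρ ∈ C, ((richPair ε ρ q ℓ₁ ℓ₂).card : ℝ) ≤
      3 * ∑ ρ ∈ C, ((richPt ε ρ q ℓ₂).card : ℝ) := by nlinarith
  nlinarith

/-- Doubly exposed pairs `(a, e)` with rich second cycle such that `φ e` is on the cycle of `a`. -/
noncomputable def linkPair (ε : ℝ) (ρ q φ : Perm α) (ℓ₁ ℓ₂ : ℕ) : Finset (α × α) :=
  (richPair ε ρ q ℓ₁ ℓ₂).filter (fun t => φ t.2 ∈ orb (ρ * q) t.1)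

open Classical in
lemma linkPair_moment {C : Finset (Perm α)} (hC : ConjClosed C) (q φ : Perm α) {ε : ℝ}
    {ℓ₁ ℓ₂ : ℕ} (h₂ : 0 < ℓ₂) (hε : 0 < ε)
    (hn : 3 * (ℓ₁ + ℓ₂) ≤ Fintype.card α) :
    Fintype.card α * ε * ∑ ρ ∈ C, ((linkPair ε ρ q φ ℓ₁ ℓ₂).card : ℝ) ≤ 9 * ℓ₁ * C.card := by
  have key : ∀ ρ a e b, (a, e) ∈ linkPair ε (sw a b ρ) q φ ℓ₁ ℓ₂ →
      b ∉ nbr (sw a b ρ) q a ∪ nbr (sw a b ρ) q e → ∃ j < ℓ₁, ((ρ * q) ^ j) a = φ e := by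
    intro ρ a e b h1 h2
    rw [linkPair, mem_filter, richPair, mem_filter] at h1
    obtain ⟨i, hi, hi'⟩ := exists_pow_of_mem_orb h1.2
    dsimp only at hi hi'
    rw [(mem_expoPair.1 h1.1.1).1] at hi
    exact ⟨i, hi, by rw [← hi']; exact (expoPair_switch h1.1.1 h2).2.2 i hi⟩
  have main := switch_pairs hC (A := fun t : α × α => t.1) (fun ρ => linkPair ε ρ q φ ℓ₁ ℓ₂)
    (fun ρ t => nbr ρ q t.1 ∪ nbr ρ q t.2) (2 * ℓ₁ + 2 * ℓ₂)
    (fun ρ t ht => card_nbr_union_le (mem_filter.1 (mem_filter.1 ht).1).1)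
    (fun ρ => range ℓ₁ ×ˢ richPt ε ρ q ℓ₂)
    (fun ρ t _ => (if h : ∃ j < ℓ₁, ((ρ * q) ^ j) t.1 = φ t.2 then h.choose else 0, t.2))
    (by
      rintro ρ ⟨a, e⟩ b h1 h2
      have hk := key _ _ _ _ h1 h2
      rw [linkPair, mem_filter, richPair, mem_filter] at h1
      rw [mem_product]
      refine ⟨?_, (mem_richPt_congr (expoPair_switch h1.1.1 h2).1).2 h1.1.2⟩
      simp only [dif_pos hk]
      exact mem_range.2 hk.choose_spec.1)
    (by
      rintro ρ ⟨a, e⟩ b ⟨a', e'⟩ b' h1 h2 h3 h4 heq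
      have hk := key _ _ _ _ h1 h2
      have hk' := key _ _ _ _ h3 h4
      simp only [dif_pos hk, dif_pos hk'] at heq
      obtain ⟨hj, he⟩ := Prod.mk.inj heq
      subst he
      have e1 := hk.choose_spec.2
      have e2 := hk'.choose_spec.2
      rw [hj] at e1
      have := ((ρ * q) ^ _).injective (e1.trans e2.symm)
      subst this
      rw [linkPair, mem_filter, richPair, mem_filter] at h1 h3
      exact ⟨rfl, (expoPair_switch h1.1.1 h2).2.1.symm.trans
        (expoPair_switch h3.1.1 h4).2.1⟩)
  simp only [card_product, card_range, ← mul_sum] at main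
  have main' := mul_le_of_sub_mul_le main (by omega)
  rify at main'
  have hr := richPt_moment hC q (ε := ε) h₂ (by omega)
  have hl : (0 : ℝ) ≤ ℓ₁ := by positivity
  calc _ = ε * (Fintype.card α * ∑ ρ ∈ C, ((linkPair ε ρ q φ ℓ₁ ℓ₂).card : ℝ)) := by ring
    _ ≤ ε * (3 * (ℓ₁ * ∑ ρ ∈ C, ((richPt ε ρ q ℓ₂).card : ℝ))) :=
        mul_le_mul_of_nonneg_left main' hε.le
    _ = 3 * ℓ₁ * (ε * ∑ ρ ∈ C, ((richPt ε ρ q ℓ₂).card : ℝ)) := by ring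
    _ ≤ 3 * ℓ₁ * (3 * C.card) := mul_le_mul_of_nonneg_left hr (by positivity)
    _ = _ := by ring

lemma outer_mul_le_card_richPair {ε : ℝ} {ρ q : Perm α} (h : Expanding ε ρ q) {x c : α}
    (hc : c ∉ orb (ρ * q) x) (hs : 2 * per (ρ * q) c ≤ Fintype.card α) :
    (outer ρ q x c).card * per (ρ * q) c ≤
      (richPair ε ρ q (per (ρ * q) x) (per (ρ * q) c)).card := by
  rw [per, ← card_product]
  refine card_le_card fun t ht => ?_
  obtain ⟨a, c'⟩ := t
  rw [mem_product] at ht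
  have hp : per (ρ * q) c' = per (ρ * q) c := per_eq_of_mem ht.2
  have h1 : c' ∉ orb (ρ * q) x := fun h => hc (by
    rw [← orb_eq_of_mem h, orb_eq_of_mem ht.2]; exact self_mem_orb _ _)
  have h2 : a ∈ outer ρ q x c' := by
    rw [outer_eq_of_mem (self_mem_orb _ _) ht.2]; exact ht.1
  rw [richPair, mem_filter]
  refine ⟨?_, ?_⟩
  · have := mem_expoPair_of_outer h1 h2
    rwa [hp] at this
  · have := h.mem_richPt (x := c') (by omega)
    rwa [hp] at this

open Classical in
/-- Two different cycles of given moderate lengths are unlikely to coexist. -/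
lemma two_cycles_bound {C : Finset (Perm α)} (hC : ConjClosed C) (q : Perm α) {ε : ℝ}
    {p ℓ : ℕ} (hp : 0 < p) (hpl : p ≤ ℓ) (hε : 0 < ε) (hn : 3 * (p + ℓ) ≤ Fintype.card α) :
    ε ^ 2 * p * ℓ * (C.filter (fun ρ => Expanding ε ρ q ∧ ∃ x c, per (ρ * q) x = p ∧
      per (ρ * q) c = ℓ ∧ c ∉ orb (ρ * q) x)).card ≤ 36 * C.card := by
  set B := C.filter (fun ρ => Expanding ε ρ q ∧ ∃ x c, per (ρ * q) x = p ∧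
      per (ρ * q) c = ℓ ∧ c ∉ orb (ρ * q) x) with hB
  have h1 := richPair_moment hC q hp (hp.trans_le hpl) hε hn
  have h2 := richPair_moment hC q (ℓ₁ := ℓ) (ℓ₂ := p) (hp.trans_le hpl) hp hε (by omega)
  have key : ∀ ρ ∈ B, ε * p * ℓ / 2 ≤
      (richPair ε ρ q p ℓ).card + (richPair ε ρ q ℓ p).card := by
    intro ρ hρ
    obtain ⟨-, he, x, c, hx, hc, hxc⟩ := mem_filter.1 hρ
    have e0 := he.outer hxc (by omega)
    have e1 := outer_mul_le_card_richPair he hxc (by omega)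
    have e2 := outer_mul_le_card_richPair he (x := c) (c := x)
      (fun h => hxc (mem_orb_comm.1 h)) (by omega)
    rw [hx, hc] at e0 e1 e2
    rify at e1 e2
    have hp' : (0 : ℝ) < p := by exact_mod_cast hp
    have hpl' : (p : ℝ) ≤ ℓ := by exact_mod_cast hpl
    have o1 : (0 : ℝ) ≤ (outer ρ q x c).card := by positivity
    have o2 : (0 : ℝ) ≤ (outer ρ q c x).card := by positivity
    have e3 : ((outer ρ q x c).card : ℝ) * p ≤ (outer ρ q x c).card * ℓ :=
      mul_le_mul_of_nonneg_left hpl' o1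
    have e4 : ε * (p + ℓ) * p ≤ ((outer ρ q x c).card + (outer ρ q c x).card) * p :=
      mul_le_mul_of_nonneg_right e0 hp'.le
    have e5 : 0 ≤ ε * p * p := by positivity
    have e6 : 0 ≤ ε * p * ℓ := by positivity
    nlinarith
  have h3 : (B.card : ℝ) * (ε * p * ℓ / 2) ≤ ∑ ρ ∈ C,
      (((richPair ε ρ q p ℓ).card : ℝ) + (richPair ε ρ q ℓ p).card) := by
    rw [← nsmul_eq_mul, ← sum_const]
    exact (sum_le_sum key).trans (sum_le_sum_of_subset_of_nonneg (filter_subset _ _)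
      (fun _ _ _ => by positivity))
  rw [sum_add_distrib] at h3
  nlinarith

/-- Points of `ℓ₁`-cycles whose `q`-preimages are on other, `ℓ₂`-cycles. -/
def contact (ρ q : Perm α) (ℓ₁ ℓ₂ : ℕ) : Finset α :=
  univ.filter (fun z => per (ρ * q) z = ℓ₁ ∧ per (ρ * q) (q⁻¹ z) = ℓ₂ ∧ q⁻¹ z ∉ orb (ρ * q) z)

lemma contact_le {ε : ℝ} {ρ q : Perm α} (h : Expanding ε ρ q) {ℓ₁ ℓ₂ : ℕ} (h₁ : 0 < ℓ₁)
    (h₂ : 0 < ℓ₂) (hs : 2 * (ℓ₁ + ℓ₂) ≤ Fintype.card α) :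
    ε * (contact ρ q ℓ₁ ℓ₂).card ≤ ((linkPair ε ρ q q ℓ₁ ℓ₂).card : ℝ) / ℓ₁ +
      ((linkPair ε ρ q q⁻¹ ℓ₂ ℓ₁).card : ℝ) / ℓ₂ := by
  have A : ∑ z ∈ contact ρ q ℓ₁ ℓ₂, (outer ρ q z (q⁻¹ z)).card ≤
      (linkPair ε ρ q q ℓ₁ ℓ₂).card := by
    rw [← card_sigma]
    refine card_le_card_of_injOn (fun t => (t.2, q⁻¹ t.1)) ?_ ?_
    · rintro ⟨z, a⟩ ht
      rw [mem_coe, mem_sigma, contact, mem_filter] at ht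
      obtain ⟨⟨-, hz1, hz2, hz3⟩, ha⟩ := ht
      dsimp only at hz1 hz2 hz3 ha
      have m1 := mem_expoPair_of_outer hz3 ha
      have m2 := h.mem_richPt (x := q⁻¹ z) (by omega)
      rw [hz1, hz2] at m1
      rw [hz2] at m2
      rw [mem_coe, linkPair, mem_filter, richPair, mem_filter]
      refine ⟨⟨m1, m2⟩, ?_⟩
      have := (mem_filter.1 ha).1
      simpa using mem_orb_comm.1 this
    · rintro ⟨z, a⟩ _ ⟨z', a'⟩ _ heq
      simp only [Prod.mk.injEq, EmbeddingLike.apply_eq_iff_eq] at heq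
      obtain ⟨rfl, rfl⟩ := heq
      rfl
  have B : ∑ z ∈ contact ρ q ℓ₁ ℓ₂, (outer ρ q (q⁻¹ z) z).card ≤
      (linkPair ε ρ q q⁻¹ ℓ₂ ℓ₁).card := by
    rw [← card_sigma]
    refine card_le_card_of_injOn (fun t => (t.2, t.1)) ?_ ?_
    · rintro ⟨z, a⟩ ht
      rw [mem_coe, mem_sigma, contact, mem_filter] at ht
      obtain ⟨⟨-, hz1, hz2, hz3⟩, ha⟩ := ht
      dsimp only at hz1 hz2 hz3 ha
      have m1 := mem_expoPair_of_outer (fun h => hz3 (mem_orb_comm.1 h)) ha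
      have m2 := h.mem_richPt (x := z) (by omega)
      rw [hz1, hz2] at m1
      rw [hz1] at m2
      rw [mem_coe, linkPair, mem_filter, richPair, mem_filter]
      exact ⟨⟨m1, m2⟩, mem_orb_comm.1 (mem_filter.1 ha).1⟩
    · rintro ⟨z, a⟩ _ ⟨z', a'⟩ _ heq
      simp only [Prod.mk.injEq] at heq
      obtain ⟨rfl, rfl⟩ := heq
      rfl
  have h₁' : (0 : ℝ) < ℓ₁ := by exact_mod_cast h₁
  have h₂' : (0 : ℝ) < ℓ₂ := by exact_mod_cast h₂
  have key : ∀ z ∈ contact ρ q ℓ₁ ℓ₂, ε ≤ ((outer ρ q z (q⁻¹ z)).card : ℝ) / ℓ₁ +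
      ((outer ρ q (q⁻¹ z) z).card : ℝ) / ℓ₂ := by
    intro z hz
    rw [contact, mem_filter] at hz
    obtain ⟨-, hz1, hz2, hz3⟩ := hz
    have e0 := h.outer hz3 (by omega)
    rw [hz1, hz2] at e0
    by_contra! hlt
    have o1 : (0 : ℝ) ≤ ((outer ρ q z (q⁻¹ z)).card : ℝ) / ℓ₁ := by positivity
    have o2 : (0 : ℝ) ≤ ((outer ρ q (q⁻¹ z) z).card : ℝ) / ℓ₂ := by positivity
    have e1 : ((outer ρ q z (q⁻¹ z)).card : ℝ) < ε * ℓ₁ := by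
      rw [← div_lt_iff₀ h₁']; linarith
    have e2 : ((outer ρ q (q⁻¹ z) z).card : ℝ) < ε * ℓ₂ := by
      rw [← div_lt_iff₀ h₂']; linarith
    nlinarith
  calc ε * (contact ρ q ℓ₁ ℓ₂).card = ∑ z ∈ contact ρ q ℓ₁ ℓ₂, ε := by
        rw [sum_const, nsmul_eq_mul, mul_comm]
    _ ≤ _ := sum_le_sum key
    _ = ((∑ z ∈ contact ρ q ℓ₁ ℓ₂, (outer ρ q z (q⁻¹ z)).card : ℕ) : ℝ) / ℓ₁ +
        ((∑ z ∈ contact ρ q ℓ₁ ℓ₂, (outer ρ q (q⁻¹ z) z).card : ℕ) : ℝ) / ℓ₂ := by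
        rw [sum_add_distrib, ← sum_div, ← sum_div]; push_cast; rfl
    _ ≤ _ := by gcongr

open Classical in
lemma contact_moment {C : Finset (Perm α)} (hC : ConjClosed C) (q : Perm α) {ε : ℝ}
    {ℓ₁ ℓ₂ : ℕ} (h₁ : 0 < ℓ₁) (h₂ : 0 < ℓ₂) (hε : 0 < ε)
    (hn : 3 * (ℓ₁ + ℓ₂) ≤ Fintype.card α) :
    Fintype.card α * ε ^ 2 * ∑ ρ ∈ C.filter (fun ρ => Expanding ε ρ q),
      ((contact ρ q ℓ₁ ℓ₂).card : ℝ) ≤ 18 * C.card := by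
  have e1 := linkPair_moment hC q q (ε := ε) (ℓ₁ := ℓ₁) h₂ hε hn
  have e2 := linkPair_moment hC q q⁻¹ (ε := ε) (ℓ₁ := ℓ₂) h₁ hε (by omega)
  have h₁' : (0 : ℝ) < ℓ₁ := by exact_mod_cast h₁
  have h₂' : (0 : ℝ) < ℓ₂ := by exact_mod_cast h₂
  have h3 : ε * ∑ ρ ∈ C.filter (fun ρ => Expanding ε ρ q), ((contact ρ q ℓ₁ ℓ₂).card : ℝ) ≤
      (∑ ρ ∈ C, ((linkPair ε ρ q q ℓ₁ ℓ₂).card : ℝ)) / ℓ₁ +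
      (∑ ρ ∈ C, ((linkPair ε ρ q q⁻¹ ℓ₂ ℓ₁).card : ℝ)) / ℓ₂ := by
    rw [sum_div, sum_div, ← sum_add_distrib, mul_sum]
    refine (sum_le_sum fun ρ hρ => contact_le (mem_filter.1 hρ).2 h₁ h₂ (by omega)).trans ?_
    exact sum_le_sum_of_subset_of_nonneg (filter_subset _ _) (fun _ _ _ => by positivity)
  have e1' : Fintype.card α * ε * ((∑ ρ ∈ C, ((linkPair ε ρ q q ℓ₁ ℓ₂).card : ℝ)) / ℓ₁) ≤
      9 * C.card := by
    rw [← mul_div_assoc, div_le_iff₀ h₁']; linarith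
  have e2' : Fintype.card α * ε * ((∑ ρ ∈ C, ((linkPair ε ρ q q⁻¹ ℓ₂ ℓ₁).card : ℝ)) / ℓ₂) ≤
      9 * C.card := by
    rw [← mul_div_assoc, div_le_iff₀ h₂']; linarith
  calc _ = Fintype.card α * ε * (ε * ∑ ρ ∈ C.filter (fun ρ => Expanding ε ρ q),
        ((contact ρ q ℓ₁ ℓ₂).card : ℝ)) := by ring
    _ ≤ Fintype.card α * ε * ((∑ ρ ∈ C, ((linkPair ε ρ q q ℓ₁ ℓ₂).card : ℝ)) / ℓ₁ +
      (∑ ρ ∈ C, ((linkPair ε ρ q q⁻¹ ℓ₂ ℓ₁).card : ℝ)) / ℓ₂) :=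
        mul_le_mul_of_nonneg_left h3 (by positivity)
    _ ≤ _ := by rw [mul_add]; linarith

/-- The first `m` steps of the path of `x` under `ρ * q`, including the intermediate points, do
not cross themselves. -/
def SimplePath (m : ℕ) (ρ q : Perm α) (x : α) : Prop :=
  m < per (ρ * q) x ∧ ∀ i < m, ∀ j ≤ m, q (((ρ * q) ^ i) x) ≠ ((ρ * q) ^ j) x

lemma SimplePath.pow_ne {m : ℕ} {ρ q : Perm α} {x : α} (h : SimplePath m ρ q x) {i j : ℕ}
    (hi : i ≤ m) (hj : j ≤ m) (hij : i ≠ j) : ((ρ * q) ^ i) x ≠ ((ρ * q) ^ j) x :=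
  fun heq => hij (pow_inj (hi.trans_lt h.1) (hj.trans_lt h.1) heq)

/-- The points on the first `m` steps of the path of `x`. -/
def pathPts (m : ℕ) (ρ q : Perm α) (x : α) : Finset α :=
  (range (m + 1)).image (fun i => ((ρ * q) ^ i) x) ∪
    (range (m + 1)).image (fun i => q (((ρ * q) ^ i) x))

lemma card_pathPts_le (m : ℕ) (ρ q : Perm α) (x : α) : (pathPts m ρ q x).card ≤ 2 * (m + 1) := by
  refine (card_union_le _ _).trans ?_
  have h1 := card_image_le (s := range (m + 1)) (f := fun i => ((ρ * q) ^ i) x)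
  have h2 := card_image_le (s := range (m + 1)) (f := fun i => q (((ρ * q) ^ i) x))
  rw [card_range] at h1 h2
  omega

lemma not_mem_pathPts {m : ℕ} {ρ q : Perm α} {x b : α} (h : b ∉ pathPts m ρ q x) {i : ℕ}
    (hi : i ≤ m) : ((ρ * q) ^ i) x ≠ b ∧ q (((ρ * q) ^ i) x) ≠ b := by
  rw [pathPts, mem_union, not_or] at h
  refine ⟨fun h' => h.1 ?_, fun h' => h.2 ?_⟩ <;>
  exact mem_image.2 ⟨i, mem_range.2 (by omega), h'⟩

lemma SimplePath.switch {m : ℕ} {ρ q : Perm α} {x b : α} (hm : 0 < m) (h : SimplePath m ρ q x)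
    (hb : b ∉ pathPts m ρ q x) :
    (∀ j < m, ((sw (((ρ * q) ^ m) x) b ρ * q) ^ j) x = ((ρ * q) ^ j) x) ∧
      ((sw (((ρ * q) ^ m) x) b ρ * q) ^ m) x = b := by
  obtain ⟨h1, h2⟩ := path_switch (a := ((ρ * q) ^ m) x) (b := b) (ρ := ρ) (q := q) (x := x)
    (m := m) (fun j hj => ⟨h.2 j hj m le_rfl, (not_mem_pathPts hb hj.le).2⟩)
    (fun j _ hj => ⟨h.pow_ne hj.le le_rfl hj.ne, (not_mem_pathPts hb hj.le).1⟩)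
  exact ⟨h1, by rw [h2 hm, swap_apply_left]⟩

open Classical in
lemma crossing_moment {C : Finset (Perm α)} (hC : ConjClosed C) (q : Perm α) {m : ℕ}
    (hm : 0 < m) (hn : 3 * (m + 1) ≤ Fintype.card α) (P : Perm α → α → Prop)
    (G : Perm α → α → α)
    (hG : ∀ ρ x b, SimplePath m ρ q x → P ρ x → b ∉ pathPts m ρ q x →
      G (sw (((ρ * q) ^ m) x) b ρ) x = ((ρ * q) ^ m) x) :
    ∑ ρ ∈ C, (univ.filter (fun x => SimplePath m ρ q x ∧ P ρ x)).card ≤ 3 * C.card := by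
  have main := switch_pairs hC (A := fun t : α × α => t.2)
    (fun ρ => (univ.filter (fun x => SimplePath m ρ q x ∧ P ρ x)).image
      (fun x => (x, ((ρ * q) ^ m) x)))
    (fun ρ t => pathPts m ρ q t.1) (2 * (m + 1)) (fun ρ t _ => card_pathPts_le _ _ _ _)
    (fun _ => univ) (fun _ t _ => t.1) (fun _ _ _ _ _ => mem_univ _)
    (by
      have key : ∀ ρ (t : α × α) b, t ∈ (univ.filter (fun x => SimplePath m (sw t.2 b ρ) q x ∧
          P (sw t.2 b ρ) x)).image (fun x => (x, ((sw t.2 b ρ * q) ^ m) x)) →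
          b ∉ pathPts m (sw t.2 b ρ) q t.1 → t.2 = G ρ t.1 ∧ b = ((ρ * q) ^ m) t.1 := by
        rintro ρ ⟨x, a⟩ b h1 h2
        obtain ⟨y, hy, heq⟩ := mem_image.1 h1
        rw [Prod.mk.injEq] at heq
        obtain ⟨rfl, ha⟩ := heq
        dsimp only at *
        obtain ⟨-, h3, h4⟩ := mem_filter.1 hy
        have e1 := hG _ _ _ h3 h4 h2
        have e2 := (h3.switch hm h2).2
        rw [ha, sw_sw] at e1 e2
        exact ⟨e1.symm, e2.symm⟩
      rintro ρ ⟨x, a⟩ b ⟨x', a'⟩ b' h1 h2 h3 h4 (rfl : x = x')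
      have e1 := key _ _ _ h1 h2
      have e2 := key _ _ _ h3 h4
      dsimp only at e1 e2
      rw [e1.1, e1.2, e2.1, e2.2]
      exact ⟨rfl, rfl⟩)
  have main' := mul_le_of_sub_mul_le main (by omega)
  simp only [card_univ, sum_const, smul_eq_mul] at main'
  rw [mul_comm C.card, mul_left_comm] at main'
  have h5 := Nat.le_of_mul_le_mul_left main' (by omega)
  refine le_trans (le_of_eq ?_) h5
  refine sum_congr rfl fun ρ _ => ?_
  rw [card_image_of_injective]
  intro x y h
  exact (Prod.mk.inj h).1

open Classical in
lemma crossing_left_moment {C : Finset (Perm α)} (hC : ConjClosed C) (q : Perm α) {m i : ℕ}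
    (hi : i < m) (hn : 3 * (m + 1) ≤ Fintype.card α) :
    ∑ ρ ∈ C, (univ.filter (fun x => SimplePath m ρ q x ∧
      q (((ρ * q) ^ m) x) = ((ρ * q) ^ i) x)).card ≤ 3 * C.card := by
  convert crossing_moment hC q (by omega) hn
    (fun ρ x => q (((ρ * q) ^ m) x) = ((ρ * q) ^ i) x)
    (fun ρ x => q⁻¹ (((ρ * q) ^ i) x)) (fun ρ x b h1 h2 h3 => ?_)
  rw [(h1.switch (by omega) h3).1 i hi, ← h2, Perm.inv_eq_iff_eq]

open Classical in
lemma crossing_right_moment {C : Finset (Perm α)} (hC : ConjClosed C) (q : Perm α) {m i : ℕ}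
    (hi : i < m) (hn : 3 * (m + 1) ≤ Fintype.card α) :
    ∑ ρ ∈ C, (univ.filter (fun x => SimplePath m ρ q x ∧
      (q (((ρ * q) ^ m) x) ≠ ((ρ * q) ^ m) x ∧
      q (((ρ * q) ^ i) x) = ((ρ * q) ^ (m + 1)) x))).card ≤ 3 * C.card := by
  convert crossing_moment hC q (by omega) hn
    (fun ρ x => q (((ρ * q) ^ m) x) ≠ ((ρ * q) ^ m) x ∧
      q (((ρ * q) ^ i) x) = ((ρ * q) ^ (m + 1)) x)
    (fun ρ x => q⁻¹ (ρ⁻¹ (q (((ρ * q) ^ i) x)))) (fun ρ x b h1 h2 h3 => ?_)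
  rw [(h1.switch (by omega) h3).1 i hi, Perm.inv_eq_iff_eq, Perm.inv_eq_iff_eq, sw_apply,
    swap_apply_of_ne_of_ne h2.1 (not_mem_pathPts h3 le_rfl).2, h2.2, pow_succ', Perm.mul_apply,
    Perm.mul_apply]
  have e : q (((ρ * q) ^ i) x) = ρ (q (((ρ * q) ^ m) x)) := by
    rw [h2.2, pow_succ', Perm.mul_apply, Perm.mul_apply]
  rw [← e, swap_apply_of_ne_of_ne (h1.2 i hi m le_rfl) (not_mem_pathPts h3 hi.le).2]

lemma not_simplePath {M : ℕ} {ρ q : Perm α} {x : α} (h : ¬ SimplePath M ρ q x) :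
    per (ρ * q) x ≤ M ∨ (∃ i ≤ M, q (((ρ * q) ^ i) x) = ((ρ * q) ^ i) x) ∨
    (∃ i ≤ M, ρ (q (((ρ * q) ^ i) x)) = q (((ρ * q) ^ i) x)) ∨
    (∃ m < M, ∃ i < m, SimplePath m ρ q x ∧ q (((ρ * q) ^ m) x) = ((ρ * q) ^ i) x) ∨
    (∃ m < M, ∃ i < m, SimplePath m ρ q x ∧ (q (((ρ * q) ^ m) x) ≠ ((ρ * q) ^ m) x ∧
      q (((ρ * q) ^ i) x) = ((ρ * q) ^ (m + 1)) x)) := by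
  by_contra! hcon
  obtain ⟨h1, h2, h3, h4, h5⟩ := hcon
  refine h ?_
  have key : ∀ m ≤ M, SimplePath m ρ q x := by
    intro m
    induction m with
    | zero => intro _; exact ⟨by omega, by omega⟩
    | succ m ih =>
      intro hm
      have hs := ih (by omega)
      refine ⟨by omega, fun i hi j hj heq => ?_⟩
      rcases (Nat.lt_succ_iff.1 hi).lt_or_eq with hi' | rfl
      · rcases hj.lt_or_eq with hj' | rfl
        · exact hs.2 i hi' j (by omega) heq
        · exact h5 m (by omega) i hi' hs (h2 m (by omega)) heq
      · rcases hj.lt_or_eq with hj' | rfl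
        · rcases (Nat.lt_succ_iff.1 hj').lt_or_eq with hj'' | rfl
          · exact h4 _ (by omega) j hj'' hs heq
          · exact h2 _ (by omega) heq
        · rw [pow_succ', Perm.mul_apply, Perm.mul_apply] at heq
          exact h3 i (by omega) heq.symm
  exact key M le_rfl

lemma SimplePath.close {M ℓ : ℕ} {ρ q : Perm α} {x : α} (h : SimplePath M ρ q x) (hℓ : 0 < ℓ)
    (hM : ℓ ≤ M) : per (sw x (((ρ * q) ^ ℓ) x) ρ * q) x = ℓ := by
  have hp := h.1
  have ne : ∀ {i j : ℕ}, i ≤ M → j ≤ M → i ≠ j → ((ρ * q) ^ i) x ≠ ((ρ * q) ^ j) x :=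
    fun hi hj hij => h.pow_ne hi hj hij
  obtain ⟨h1, h2⟩ := path_switch (a := x) (b := ((ρ * q) ^ ℓ) x) (ρ := ρ) (q := q) (x := x)
    (m := ℓ) (fun j hj => ⟨h.2 j (by omega) 0 (by omega), h.2 j (by omega) ℓ hM⟩)
    (fun j hj hj' => ⟨ne (j := 0) (by omega) (by omega) (by omega), ne (by omega) hM (by omega)⟩)
  refine per_eq_of_pow hℓ ?_ fun i hi hi' => ?_
  · rw [h2 hℓ, swap_apply_right]
  · rw [h1 i hi']; exact ne (j := 0) (by omega) (by omega) (by omega)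

lemma sum_inv_per_orb (w : Perm α) (x : α) : ∑ y ∈ orb w x, (1 : ℝ) / per w y = 1 := by
  rw [sum_congr rfl fun y hy => by rw [per_eq_of_mem hy], sum_const, nsmul_eq_mul]
  have : (0 : ℝ) < per w x := by exact_mod_cast per_pos w x
  change (per w x : ℝ) * _ = 1
  field_simp

open Classical in
lemma existence_moment {C : Finset (Perm α)} (hC : ConjClosed C) (q : Perm α) (P : Finset ℕ)
    {M : ℕ} (hP : ∀ p ∈ P, 0 < p ∧ p ≤ M) :
    (∑ p ∈ P, (1 : ℝ) / p) * ∑ ρ ∈ C.filter (fun ρ => ∀ y, per (ρ * q) y ∉ P),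
      ((univ.filter (fun x => SimplePath M ρ q x)).card : ℝ) ≤
      4 * Fintype.card α * C.card := by
  set Src : ℕ → Perm α → α × α → Prop := fun ℓ ρ t => (∀ y, per (ρ * q) y ∉ P) ∧
    SimplePath M ρ q t.1 ∧ t.2 = ((ρ * q) ^ ℓ) t.1 with hSrc
  have h1 : ∀ ℓ, ∑ ρ ∈ C.filter (fun ρ => ∀ y, per (ρ * q) y ∉ P),
      (univ.filter (fun x => SimplePath M ρ q x)).card ≤
      ∑ ρ ∈ C, (univ.filter (fun t => Src ℓ (sw t.1 t.2 ρ) t)).card := by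
    intro ℓ
    rw [← switch_sum hC (fun t : α × α => t.1) (fun t => t.2) (Src ℓ), sum_filter]
    refine sum_le_sum fun ρ _ => ?_
    split_ifs with h
    · refine card_le_card_of_injOn (fun x => (x, ((ρ * q) ^ ℓ) x)) ?_ ?_
      · intro x hx
        rw [mem_coe, mem_filter] at *
        exact ⟨mem_univ _, h, hx.2, rfl⟩
      · intro x _ y _ hxy; exact (Prod.mk.inj hxy).1
    · exact Nat.zero_le _
  have key : ∀ ρ ℓ x b, ℓ ∈ P → Src ℓ (sw x b ρ) (x, b) → per (ρ * q) x = ℓ ∧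
      ∀ y, per (ρ * q) y ∈ P → x ∈ nbr ρ q y ∨ b ∈ nbr ρ q y := by
    rintro ρ ℓ x b hℓ ⟨h2, h3, h4⟩
    refine ⟨?_, fun y hy => ?_⟩
    · have := h3.close (hP ℓ hℓ).1 (hP ℓ hℓ).2
      dsimp only at h4
      rwa [← h4, sw_sw] at this
    · by_contra! hcon
      refine h2 y ?_
      rwa [per, orb_switch_of_not_mem hcon.1 hcon.2]
  have h2 : ∀ ρ, ∑ ℓ ∈ P, (1 : ℝ) / ℓ * (univ.filter (fun t => Src ℓ (sw t.1 t.2 ρ) t)).card ≤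
      4 * Fintype.card α := by
    intro ρ
    set E : α → Finset α := fun b => univ.filter (fun x => per (ρ * q) x ∈ P ∧
      ∀ y, per (ρ * q) y ∈ P → x ∈ nbr ρ q y ∨ b ∈ nbr ρ q y) with hE
    have e1 : ∑ ℓ ∈ P, (1 : ℝ) / ℓ * (univ.filter (fun t => Src ℓ (sw t.1 t.2 ρ) t)).card ≤
        ∑ b, ∑ x ∈ E b, (1 : ℝ) / per (ρ * q) x := by
      calc _ ≤ ∑ ℓ ∈ P, ∑ b, ∑ x ∈ (E b).filter (fun x => per (ρ * q) x = ℓ),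
            (1 : ℝ) / per (ρ * q) x := by
            refine sum_le_sum fun ℓ hℓ => ?_
            rw [card_filter, ← univ_product_univ, sum_product_right]
            push_cast
            rw [mul_sum]
            refine sum_le_sum fun b _ => ?_
            rw [mul_sum, sum_filter, hE]
            dsimp only
            rw [sum_filter]
            refine sum_le_sum fun x _ => ?_
            split_ifs with g1 g2 g3 g3
            · have := (key ρ ℓ x b hℓ g1).1
              rw [this]; simp
            · exact absurd (key ρ ℓ x b hℓ g1).1 g3
            · have := key ρ ℓ x b hℓ g1
              exact absurd ⟨this.1 ▸ hℓ, this.2⟩ g2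
            · rw [mul_zero]; positivity
            · simp
            · simp
        _ = _ := by
            rw [sum_comm]
            refine sum_congr rfl fun b _ => ?_
            refine sum_fiberwise_of_maps_to (fun x hx => (mem_filter.1 hx).2.1) _
    refine e1.trans ?_
    have e2 : ∀ b, ∑ x ∈ E b, (1 : ℝ) / per (ρ * q) x ≤ 4 := by
      intro b
      rcases (E b).eq_empty_or_nonempty with h0 | ⟨x0, h0⟩
      · rw [h0]; norm_num
      have hx0 := (mem_filter.1 h0).2.2
      have hsub : E b ⊆ ((orb (ρ * q) x0 ∪ orb (ρ * q) (q⁻¹ x0)) ∪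
          (orb (ρ * q) b ∪ orb (ρ * q) (q⁻¹ b))) := by
        intro y hy
        have := hx0 y (mem_filter.1 hy).2.1
        by_contra hcon
        simp only [mem_union, not_or] at hcon
        rw [mem_orb_comm, mem_orb_comm (y := y) (x := q⁻¹ x0), mem_orb_comm (y := y) (x := b),
          mem_orb_comm (y := y) (x := q⁻¹ b)] at hcon
        rcases this with h | h
        · exact not_mem_nbr.2 hcon.1 h
        · exact not_mem_nbr.2 hcon.2 h
      have hu : ∀ s t : Finset α, ∑ x ∈ s ∪ t, (1 : ℝ) / per (ρ * q) x ≤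
          ∑ x ∈ s, (1 : ℝ) / per (ρ * q) x + ∑ x ∈ t, (1 : ℝ) / per (ρ * q) x := by
        intro s t
        rw [← sum_union_inter]
        have : 0 ≤ ∑ x ∈ s ∩ t, (1 : ℝ) / per (ρ * q) x := sum_nonneg fun _ _ => by positivity
        linarith
      refine (sum_le_sum_of_subset_of_nonneg hsub (fun _ _ _ => by positivity)).trans ?_
      refine (hu _ _).trans ?_
      have a1 := hu (orb (ρ * q) x0) (orb (ρ * q) (q⁻¹ x0))
      have a2 := hu (orb (ρ * q) b) (orb (ρ * q) (q⁻¹ b))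
      simp only [sum_inv_per_orb] at a1 a2
      linarith
    refine (sum_le_sum fun b _ => e2 b).trans ?_
    rw [sum_const, card_univ, nsmul_eq_mul, mul_comm]
  rw [sum_mul]
  calc _ ≤ ∑ ℓ ∈ P, (1 : ℝ) / ℓ * ∑ ρ ∈ C,
        ((univ.filter (fun t => Src ℓ (sw t.1 t.2 ρ) t)).card : ℝ) := by
        refine sum_le_sum fun ℓ _ => mul_le_mul_of_nonneg_left ?_ (by positivity)
        exact_mod_cast h1 ℓ
    _ = ∑ ρ ∈ C, ∑ ℓ ∈ P, (1 : ℝ) / ℓ *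
        (univ.filter (fun t => Src ℓ (sw t.1 t.2 ρ) t)).card := by
        simp only [mul_sum]
        rw [sum_comm]
    _ ≤ ∑ ρ ∈ C, (4 * Fintype.card α : ℝ) := sum_le_sum fun ρ _ => h2 ρ
    _ = _ := by rw [sum_const, nsmul_eq_mul]; ring

lemma card_filter_comp_perm (w : Perm α) (R : α → Prop) [DecidablePred R] :
    (univ.filter (fun x => R (w x))).card = (univ.filter R).card := by
  refine card_bij' (fun x _ => w x) (fun x _ => w⁻¹ x) ?_ ?_ ?_ ?_ <;> simp

lemma cast_sum_le {ι : Type*} {s : Finset ι} {g : ι → ℕ} {k : ℕ} (h : ∑ i ∈ s, g i ≤ k) :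
    ∑ i ∈ s, (g i : ℝ) ≤ k := by exact_mod_cast h

open Classical in
lemma nonsimple_card_le {ε : ℝ} {ρ q : Perm α} {M f : ℕ} (h : Expanding ε ρ q)
    (hM : 2 * M ≤ Fintype.card α)
    (hf : (univ.filter (fun x => q x = x)).card + (univ.filter (fun x => ρ x = x)).card ≤ f) :
    (univ.filter (fun x => ¬ SimplePath M ρ q x)).card ≤
      ∑ ℓ ∈ Icc 1 M, (richPt ε ρ q ℓ).card + (M + 1) * f +
      ∑ m ∈ range M, ∑ i ∈ range m, ((univ.filter (fun x => SimplePath m ρ q x ∧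
        q (((ρ * q) ^ m) x) = ((ρ * q) ^ i) x)).card +
        (univ.filter (fun x => SimplePath m ρ q x ∧
      (q (((ρ * q) ^ m) x) ≠ ((ρ * q) ^ m) x ∧
      q (((ρ * q) ^ i) x) = ((ρ * q) ^ (m + 1)) x))).card) := by
  have hsub : univ.filter (fun x => ¬ SimplePath M ρ q x) ⊆
      ((Icc 1 M).biUnion (fun ℓ => richPt ε ρ q ℓ) ∪
      ((range (M + 1)).biUnion (fun i => univ.filter
          (fun x => q (((ρ * q) ^ i) x) = ((ρ * q) ^ i) x)) ∪
        (range (M + 1)).biUnion (fun i => univ.filter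
          (fun x => ρ (q (((ρ * q) ^ i) x)) = q (((ρ * q) ^ i) x))))) ∪
      (range M).biUnion (fun m => (range m).biUnion (fun i =>
        univ.filter (fun x => SimplePath m ρ q x ∧
        q (((ρ * q) ^ m) x) = ((ρ * q) ^ i) x) ∪
        univ.filter (fun x => SimplePath m ρ q x ∧
      (q (((ρ * q) ^ m) x) ≠ ((ρ * q) ^ m) x ∧
      q (((ρ * q) ^ i) x) = ((ρ * q) ^ (m + 1)) x)))) := by
    intro x hx
    simp only [mem_union, mem_biUnion, mem_filter, mem_univ, true_and, mem_range, mem_Icc] at *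
    rcases not_simplePath hx with h1 | ⟨i, hi, h1⟩ | ⟨i, hi, h1⟩ | ⟨m, hm, i, hi, h1⟩ |
        ⟨m, hm, i, hi, h1⟩
    · exact .inl (.inl ⟨_, ⟨per_pos _ _, h1⟩, h.mem_richPt (by omega)⟩)
    · exact .inl (.inr (.inl ⟨i, by omega, h1⟩))
    · exact .inl (.inr (.inr ⟨i, by omega, h1⟩))
    · exact .inr ⟨m, hm, i, hi, .inl h1⟩
    · exact .inr ⟨m, hm, i, hi, .inr h1⟩
  refine (card_le_card hsub).trans ((card_union_le _ _).trans ?_)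
  gcongr ?_ + ?_
  · refine (card_union_le _ _).trans ?_
    gcongr ?_ + ?_
    · exact card_biUnion_le
    · refine (card_union_le _ _).trans ?_
      have e1 : ((range (M + 1)).biUnion (fun i => univ.filter
          (fun x => q (((ρ * q) ^ i) x) = ((ρ * q) ^ i) x))).card ≤
          (M + 1) * (univ.filter (fun x => q x = x)).card := by
        refine card_biUnion_le.trans ?_
        rw [sum_congr rfl fun i _ => card_filter_comp_perm ((ρ * q) ^ i) (fun y => q y = y),
          sum_const, card_range, smul_eq_mul]
      have e2 : ((range (M + 1)).biUnion (fun i => univ.filter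
          (fun x => ρ (q (((ρ * q) ^ i) x)) = q (((ρ * q) ^ i) x)))).card ≤
          (M + 1) * (univ.filter (fun x => ρ x = x)).card := by
        refine card_biUnion_le.trans ?_
        refine (sum_le_card_nsmul _ _ (univ.filter (fun x => ρ x = x)).card
          fun i _ => le_of_eq ?_).trans (by simp)
        exact card_filter_comp_perm (q * (ρ * q) ^ i) (fun y => ρ y = y)
      nlinarith
  · refine card_biUnion_le.trans (sum_le_sum fun m _ => card_biUnion_le.trans
      (sum_le_sum fun i _ => card_union_le _ _))

open Classical in
lemma nonsimple_moment {C : Finset (Perm α)} (hC : ConjClosed C) (q : Perm α) {ε : ℝ}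
    (hε : 0 < ε) {M f : ℕ} (hM : 3 * (M + 1) ≤ Fintype.card α)
    (hf : ∀ ρ ∈ C, (univ.filter (fun x => q x = x)).card +
      (univ.filter (fun x => ρ x = x)).card ≤ f) :
    ∑ ρ ∈ C.filter (fun ρ => Expanding ε ρ q),
      ((univ.filter (fun x => ¬ SimplePath M ρ q x)).card : ℝ) ≤
      (3 * M / ε + (M + 1) * f + 6 * M ^ 2) * C.card := by
  set C' := C.filter (fun ρ => Expanding ε ρ q)
  have h0 : ∀ ρ ∈ C', ((univ.filter (fun x => ¬ SimplePath M ρ q x)).card : ℝ) ≤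
      ∑ ℓ ∈ Icc 1 M, ((richPt ε ρ q ℓ).card : ℝ) + (M + 1) * f +
      ∑ m ∈ range M, ∑ i ∈ range m, (((univ.filter (fun x => SimplePath m ρ q x ∧
        q (((ρ * q) ^ m) x) = ((ρ * q) ^ i) x)).card : ℝ) +
        (univ.filter (fun x => SimplePath m ρ q x ∧
      (q (((ρ * q) ^ m) x) ≠ ((ρ * q) ^ m) x ∧
      q (((ρ * q) ^ i) x) = ((ρ * q) ^ (m + 1)) x))).card) := by
    intro ρ hρ
    obtain ⟨h1, h2⟩ := mem_filter.1 hρ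
    exact_mod_cast nonsimple_card_le h2 (by omega) (hf ρ h1)
  have hsub : ∀ g : Perm α → ℝ, (∀ ρ, 0 ≤ g ρ) → ∑ ρ ∈ C', g ρ ≤ ∑ ρ ∈ C, g ρ := fun g hg =>
    sum_le_sum_of_subset_of_nonneg (filter_subset _ _) fun _ _ _ => hg _
  refine (sum_le_sum h0).trans ?_
  rw [sum_add_distrib, sum_add_distrib, add_mul _ _ (C.card : ℝ), add_mul _ _ (C.card : ℝ)]
  refine add_le_add (add_le_add ?_ ?_) ?_
  · rw [sum_comm]
    have : ∀ ℓ ∈ Icc 1 M, ∑ ρ ∈ C', ((richPt ε ρ q ℓ).card : ℝ) ≤ 3 / ε * C.card := by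
      intro ℓ hℓ
      rw [mem_Icc] at hℓ
      refine (hsub _ fun _ => by positivity).trans ?_
      have := richPt_moment hC q (ε := ε) (ℓ := ℓ) (by omega) (by omega)
      rw [div_mul_eq_mul_div, le_div_iff₀ hε]; linarith
    refine (sum_le_sum this).trans (le_of_eq ?_)
    rw [sum_const, Nat.card_Icc, nsmul_eq_mul]; simp; ring
  · rw [sum_const, nsmul_eq_mul, mul_comm]
    gcongr
    exact filter_subset _ _
  · rw [sum_comm]
    calc _ ≤ ∑ m ∈ range M, (M * (6 * C.card) : ℝ) := by
          refine sum_le_sum fun m hm => ?_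
          rw [mem_range] at hm
          rw [sum_comm]
          calc _ ≤ ∑ i ∈ range m, (6 * C.card : ℝ) := by
                refine sum_le_sum fun i hi => ?_
                rw [mem_range] at hi
                refine (hsub _ fun _ => by positivity).trans ?_
                have e1 := crossing_left_moment hC q (m := m) hi (by omega)
                have e2 := crossing_right_moment hC q (m := m) hi (by omega)
                rw [sum_add_distrib]
                have e3 := cast_sum_le e1
                have e4 := cast_sum_le e2
                rw [Nat.cast_mul, Nat.cast_ofNat] at e3 e4
                linarith
            _ ≤ _ := by
                rw [sum_const, card_range, nsmul_eq_mul]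
                gcongr
      _ = _ := by rw [sum_const, card_range, nsmul_eq_mul]; ring

/-- Few expanding `ρ` have no cycle of `ρ * q` with length in `P`. -/
lemma existence_bound {C : Finset (Perm α)} (hC : ConjClosed C) (q : Perm α) {ε : ℝ}
    (hε : 0 < ε) {M f : ℕ} (hM : 3 * (M + 1) ≤ Fintype.card α) (P : Finset ℕ)
    (hP : ∀ p ∈ P, 0 < p ∧ p ≤ M)
    (hf : ∀ ρ ∈ C, (univ.filter (fun x => q x = x)).card +
      (univ.filter (fun x => ρ x = x)).card ≤ f) :
    open Classical in (∑ p ∈ P, (1 : ℝ) / p) * (Fintype.card α *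
      (C.filter (fun ρ => Expanding ε ρ q ∧ ∀ y, per (ρ * q) y ∉ P)).card -
      (3 * M / ε + (M + 1) * f + 6 * M ^ 2) * C.card) ≤ 4 * Fintype.card α * C.card := by
  classical
  refine le_trans ?_ (existence_moment hC q P hP)
  gcongr
  have h1 := nonsimple_moment hC q hε hM hf
  set B := C.filter (fun ρ => Expanding ε ρ q ∧ ∀ y, per (ρ * q) y ∉ P)
  have h2 : (Fintype.card α * B.card : ℝ) = ∑ ρ ∈ B,
      (((univ.filter (fun x => SimplePath M ρ q x)).card : ℝ) +
        (univ.filter (fun x => ¬ SimplePath M ρ q x)).card) := by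
    rw [mul_comm, ← nsmul_eq_mul, ← sum_const]
    refine sum_congr rfl fun ρ _ => ?_
    rw [← Nat.cast_add, card_filter_add_card_filter_not, card_univ]
  rw [h2, sum_add_distrib]
  have h3 : ∑ ρ ∈ B, ((univ.filter (fun x => SimplePath M ρ q x)).card : ℝ) ≤
      ∑ ρ ∈ C.filter (fun ρ => ∀ y, per (ρ * q) y ∉ P),
      ((univ.filter (fun x => SimplePath M ρ q x)).card : ℝ) :=
    sum_le_sum_of_subset_of_nonneg (fun ρ h => by
      have := mem_filter.1 h; exact mem_filter.2 ⟨this.1, this.2.2⟩) fun _ _ _ => by positivity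
  have h4 : ∑ ρ ∈ B, ((univ.filter (fun x => ¬ SimplePath M ρ q x)).card : ℝ) ≤
      ∑ ρ ∈ C.filter (fun ρ => Expanding ε ρ q),
      ((univ.filter (fun x => ¬ SimplePath M ρ q x)).card : ℝ) :=
    sum_le_sum_of_subset_of_nonneg (fun ρ h => by
      have := mem_filter.1 h; exact mem_filter.2 ⟨this.1, this.2.1⟩) fun _ _ _ => by positivity
  linarith

lemma orb_subset_of_invariant {w : Perm α} {x : α} {S : Finset α} (hx : x ∈ S)
    (hS : ∀ y ∈ S, w y ∈ S) : orb w x ⊆ S := by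
  intro y hy
  obtain ⟨i, -, rfl⟩ := exists_pow_of_mem_orb hy
  clear hy
  induction i with
  | zero => simpa using hx
  | succ i ih => rw [pow_succ', Perm.mul_apply]; exact hS _ ih

lemma orb_mul_swap_of_not_mem {σ : Perm α} {u u' x : α} (hu : u ∉ orb σ x) (hu' : u' ∉ orb σ x) :
    orb (σ * swap u u') x = orb σ x := by
  have h : ∀ y ∈ orb σ x, (σ * swap u u') y = σ y := by
    intro y hy
    rw [Perm.mul_apply, swap_apply_of_ne_of_ne]
    · rintro rfl; exact hu hy
    · rintro rfl; exact hu' hy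
  have hsub : orb (σ * swap u u') x ⊆ orb σ x :=
    orb_subset_of_invariant (self_mem_orb _ _) fun y hy => by
      rw [h y hy]; exact apply_mem_orb.2 hy
  refine hsub.antisymm (orb_subset_of_invariant (self_mem_orb _ _) fun y hy => ?_)
  rw [← h y (hsub hy)]; exact apply_mem_orb.2 hy

lemma orb_mul_swap_merge {σ : Perm α} {u u' : α} (h : u' ∉ orb σ u) :
    orb (σ * swap u u') u = orb σ u ∪ orb σ u' := by
  set τ := σ * swap u u' with hτ
  have hu : τ u = σ u' := by rw [hτ, Perm.mul_apply, swap_apply_left]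
  have hu' : τ u' = σ u := by rw [hτ, Perm.mul_apply, swap_apply_right]
  have ho : ∀ y, y ≠ u → y ≠ u' → τ y = σ y := fun y h1 h2 => by
    rw [hτ, Perm.mul_apply, swap_apply_of_ne_of_ne h1 h2]
  apply Subset.antisymm
  · refine orb_subset_of_invariant (mem_union_left _ (self_mem_orb _ _)) fun y hy => ?_
    by_cases h1 : y = u
    · subst h1; rw [hu]; exact mem_union_right _ (apply_mem_orb.2 (self_mem_orb _ _))
    by_cases h2 : y = u'
    · subst h2; rw [hu']; exact mem_union_left _ (apply_mem_orb.2 (self_mem_orb _ _))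
    rw [ho y h1 h2]
    simpa only [mem_union, apply_mem_orb] using hy
  · have hmem : u' ∈ orb τ u := by
      by_contra hcon
      have h1 : orb σ (σ u') ⊆ orb τ u ∩ orb σ u' := by
        refine orb_subset_of_invariant (mem_inter.2 ⟨?_, apply_mem_orb.2 (self_mem_orb _ _)⟩)
          fun y hy => ?_
        · rw [← hu]; exact apply_mem_orb.2 (self_mem_orb _ _)
        · obtain ⟨hy1, hy2⟩ := mem_inter.1 hy
          refine mem_inter.2 ⟨?_, apply_mem_orb.2 hy2⟩
          rw [← ho y, apply_mem_orb]
          · exact hy1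
          · rintro rfl; exact h (mem_orb_comm.1 hy2)
          · rintro rfl; exact hcon hy1
      have h2 : u' ∈ orb σ (σ u') := by
        rw [mem_orb_comm]; exact apply_mem_orb.2 (self_mem_orb _ _)
      exact hcon (mem_inter.1 (h1 h2)).1
    have hinv : ∀ y ∈ orb τ u, σ y ∈ orb τ u := by
      intro y hy
      by_cases h1 : y = u
      · subst h1; rw [← hu']; exact apply_mem_orb.2 hmem
      by_cases h2 : y = u'
      · subst h2; rw [← hu]; exact apply_mem_orb.2 (self_mem_orb _ _)
      rw [← ho y h1 h2]; exact apply_mem_orb.2 hy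
    exact union_subset (orb_subset_of_invariant (self_mem_orb _ _) hinv)
      (orb_subset_of_invariant hmem hinv)

lemma orb_mul_swap_split {σ : Perm α} {u u' : α} (h : u' ∈ orb σ u) (hne : u ≠ u') :
    per (σ * swap u u') u + per (σ * swap u u') u' = per σ u := by
  set τ := σ * swap u u' with hτ
  have hσ : σ = τ * swap u u' := by rw [hτ, mul_assoc, swap_mul_self, mul_one]
  have hnot : u ∉ orb τ u' := by
    intro hcon
    obtain ⟨k, hk, hk'⟩ := exists_pow_of_mem_orb h
    have hk0 : 0 < k := by
      rcases Nat.eq_zero_or_pos k with rfl | h0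
      · exact absurd (by simpa using hk') hne
      · exact h0
    have h1 : ∀ i < k, (τ ^ (i + 1)) u' = (σ ^ (i + 1)) u := by
      intro i
      induction i with
      | zero => intro _; simp [hτ]
      | succ i ih =>
        intro hi
        rw [pow_succ', Perm.mul_apply, ih (by omega), pow_succ' σ (i + 1), Perm.mul_apply σ (σ ^ (i + 1)), hτ,
          Perm.mul_apply, swap_apply_of_ne_of_ne]
        · intro h2
          exact absurd (pow_inj (w := σ) (x := u) (i := i + 1) (j := 0) (by omega) (per_pos _ _) (by simpa using h2))
            (by omega)
        · intro h2; rw [← hk'] at h2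
          exact absurd (pow_inj (by omega) hk h2) (by omega)
    have h2 : (τ ^ k) u' = u' := by
      have := h1 (k - 1) (by omega)
      rw [Nat.sub_add_cancel hk0] at this
      rw [this, hk']
    rw [orb_eq_image hk0 h2, mem_image] at hcon
    obtain ⟨i, hi, hi'⟩ := hcon
    rw [mem_range] at hi
    rcases Nat.eq_zero_or_pos i with rfl | h0
    · exact hne (by simpa using hi'.symm)
    · have h3 := h1 (i - 1) (by omega)
      rw [Nat.sub_add_cancel h0, hi'] at h3
      exact absurd (pow_inj (w := σ) (x := u) (i := 0) (j := i) (per_pos _ _) (by omega) (by simpa using h3))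
        (by omega)
  have hnot' : u' ∉ orb τ u := fun hc => hnot (mem_orb_comm.1 hc)
  have := orb_mul_swap_merge hnot'
  rw [← hσ] at this
  rw [per, per, per, this, card_union_of_disjoint (disjoint_orb hnot')]

lemma sw_mul_eq (a b : α) (ρ q : Perm α) :
    sw a b ρ * q = (ρ * q) * swap ((ρ * q)⁻¹ a) ((ρ * q)⁻¹ b) * swap (q⁻¹ a) (q⁻¹ b) := by
  rw [← swap_mul_eq_mul_swap, mul_assoc, mul_assoc, ← swap_mul_eq_mul_swap, sw]
  group

lemma inv_apply_mem_orb {w : Perm α} {x y : α} : w⁻¹ y ∈ orb w x ↔ y ∈ orb w x := by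
  rw [← apply_mem_orb]; simp

/-- Effect on a large cycle of opening a smaller one. -/
lemma switch_large_cycle {p : ℕ} {ρ q : Perm α} {a b c : α} (ha : per (ρ * q) a = p)
    (hc : c ∉ orb (ρ * q) a) (hp : p ∣ per (ρ * q) c) (hu : q⁻¹ a ∉ orb (ρ * q) a)
    (hb : b ∉ nbr ρ q a) (hiff : q⁻¹ a ∈ orb (ρ * q) c ↔ q⁻¹ b ∈ orb (ρ * q) c) :
    ∃ s, p ∣ s ∧ per (ρ * q) c ≤ s ∧ ((∃ z, per (sw a b ρ * q) z = s) ∨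
      per (sw a b ρ * q) (q⁻¹ a) + per (sw a b ρ * q) (q⁻¹ b) = s) := by
  rw [not_mem_nbr] at hb
  set w := ρ * q with hw
  set w₁ := w * swap (w⁻¹ a) (w⁻¹ b) with hw₁
  have hab : a ≠ b := by rintro rfl; exact hb.1 (self_mem_orb _ _)
  have huu : q⁻¹ a ≠ q⁻¹ b := fun h => hab (q⁻¹.injective h)
  have ha_c : a ∉ orb w c := fun h => hc (mem_orb_comm.1 h)
  -- the cycle of `c` after the first multiplication
  obtain ⟨z, hdvd, hle, hmem⟩ : ∃ z, p ∣ per w₁ z ∧ per w c ≤ per w₁ z ∧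
      ∀ y, y ∉ orb w a → (y ∈ orb w₁ z ↔ y ∈ orb w c) := by
    by_cases hbc : b ∈ orb w c
    · have hm := orb_mul_swap_merge (σ := w) (u := w⁻¹ a) (u' := w⁻¹ b) (by
        rw [inv_apply_mem_orb, orb_eq_of_mem (inv_apply_mem_orb.2 (self_mem_orb w a))]
        exact hb.1)
      rw [orb_eq_of_mem (inv_apply_mem_orb.2 (self_mem_orb w a)),
        orb_eq_of_mem (inv_apply_mem_orb.2 hbc)] at hm
      have hcard : per w₁ (w⁻¹ a) = per w a + per w c := by
        rw [per, hm, card_union_of_disjoint (disjoint_orb hc), per, per]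
      refine ⟨w⁻¹ a, ?_, ?_, fun y hy => ?_⟩
      · rw [hcard, ha]; exact dvd_add dvd_rfl hp
      · omega
      · rw [hm, mem_union]; tauto
    · have hm := orb_mul_swap_of_not_mem (σ := w) (u := w⁻¹ a) (u' := w⁻¹ b) (x := c)
        (by rwa [inv_apply_mem_orb]) (by rwa [inv_apply_mem_orb])
      refine ⟨c, ?_, ?_, fun y _ => ?_⟩
      · rw [per, hm]; exact hp
      · rw [per, per, hm]
      · rw [hm]
  refine ⟨per w₁ z, hdvd, hle, ?_⟩
  rw [sw_mul_eq, ← hw, ← hw₁]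
  by_cases h : q⁻¹ a ∈ orb w c
  · right
    have h1 := (hmem _ hu).2 h
    rw [orb_mul_swap_split _ huu, per_eq_of_mem h1]
    rw [orb_eq_of_mem h1]
    exact (hmem _ hb.2).2 (hiff.1 h)
  · left
    refine ⟨z, ?_⟩
    rw [per, per, orb_mul_swap_of_not_mem]
    · rwa [hmem _ hu]
    · rwa [hmem _ hb.2, ← hiff]

lemma card_primes_dvd_le (P : Finset ℕ) (hP : ∀ p ∈ P, p.Prime) {s N : ℕ} (hs : 0 < s)
    (hN : s ≤ N) : (P.filter (fun p => p ∣ s)).card ≤ Nat.log 2 N := by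
  refine Nat.le_log_of_pow_le (by norm_num) (le_trans ?_ hN)
  have hsub : P.filter (fun p => p ∣ s) ⊆ s.primeFactors := fun p hp => by
    rw [mem_filter] at hp
    exact Nat.mem_primeFactors.2 ⟨hP p hp.1, hp.2, by omega⟩
  calc 2 ^ (P.filter (fun p => p ∣ s)).card ≤ 2 ^ s.primeFactors.card :=
        Nat.pow_le_pow_right (by norm_num) (card_le_card hsub)
    _ ≤ ∏ p ∈ s.primeFactors, p := by
        rw [← prod_const]
        exact prod_le_prod' fun p hp => (Nat.prime_of_mem_primeFactors hp).two_le
    _ ≤ s := Nat.le_of_dvd hs (Nat.prod_primeFactors_dvd s)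

/-- The lengths of the cycles of `w` that contain at least one point in `k`. -/
def largePers (w : Perm α) (k : ℕ) : Finset ℕ :=
  (univ.filter (fun z => Fintype.card α ≤ k * per w z)).image (per w)

lemma card_largePers_le (w : Perm α) (k : ℕ) : (largePers w k).card ≤ k := by
  classical
  rcases isEmpty_or_nonempty α with h | h
  · have : largePers w k = ∅ := by simp [largePers]
    rw [this]; simp
  have hn : 0 < Fintype.card α := Fintype.card_pos
  have h1 : ∑ s ∈ largePers w k, s ≤ Fintype.card α := by
    calc ∑ s ∈ largePers w k, s ≤ ∑ s ∈ largePers w k,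
          (univ.filter (fun z => per w z = s)).card := by
          refine sum_le_sum fun s hs => ?_
          obtain ⟨z, -, rfl⟩ := mem_image.1 hs
          refine card_le_card fun y hy => ?_
          exact mem_filter.2 ⟨mem_univ _, per_eq_of_mem hy⟩
      _ = ((largePers w k).biUnion (fun s => univ.filter (fun z => per w z = s))).card := by
          rw [card_biUnion]
          intro s _ t _ hst
          rw [Function.onFun, disjoint_left]
          intro z hz hz'
          exact hst ((mem_filter.1 hz).2.symm.trans (mem_filter.1 hz').2)
      _ ≤ _ := card_le_univ _
  have h2 : (largePers w k).card * Fintype.card α ≤ k * ∑ s ∈ largePers w k, s := by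
    rw [mul_sum, ← smul_eq_mul, ← sum_const]
    refine sum_le_sum fun s hs => ?_
    obtain ⟨z, hz, rfl⟩ := mem_image.1 hs
    exact (mem_filter.1 hz).2
  exact Nat.le_of_mul_le_mul_right (h2.trans (Nat.mul_le_mul_left _ h1)) hn

/-- Pairs `(a, b)` such that switching `a` and `b` opens a `p`-cycle and keeps track of a large
cycle with length divisible by `p`. -/
noncomputable def openPair (ρ q : Perm α) (p : ℕ) : Finset (α × α) :=
  open Classical in univ.filter (fun t => per (ρ * q) t.1 = p ∧ q⁻¹ t.1 ∉ orb (ρ * q) t.1 ∧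
    t.2 ∉ nbr ρ q t.1 ∧ ∃ c, c ∉ orb (ρ * q) t.1 ∧ p ∣ per (ρ * q) c ∧
      Fintype.card α ≤ 4 * per (ρ * q) c ∧
      (q⁻¹ t.1 ∈ orb (ρ * q) c ↔ q⁻¹ t.2 ∈ orb (ρ * q) c))

lemma mem_openPair {ρ q : Perm α} {p : ℕ} {a b : α} : (a, b) ∈ openPair ρ q p ↔
    per (ρ * q) a = p ∧ q⁻¹ a ∉ orb (ρ * q) a ∧ b ∉ nbr ρ q a ∧
    ∃ c, c ∉ orb (ρ * q) a ∧ p ∣ per (ρ * q) c ∧ Fintype.card α ≤ 4 * per (ρ * q) c ∧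
      (q⁻¹ a ∈ orb (ρ * q) c ↔ q⁻¹ b ∈ orb (ρ * q) c) := by simp [openPair]

lemma per_le_card (w : Perm α) (x : α) : per w x ≤ Fintype.card α := card_le_univ _

open Classical in
lemma card_dvd_largePers_le (w : Perm α) (k : ℕ) (P : Finset ℕ) (hP : ∀ p ∈ P, p.Prime)
    (g : α → ℕ) (hg : ∀ a, g a ≤ Fintype.card α) :
    ((P ×ˢ (univ : Finset α)).filter (fun t => ∃ s ∈ largePers w k, t.1 ∣ g t.2 + s)).card ≤
      Fintype.card α * (k * Nat.log 2 (2 * Fintype.card α)) := by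
  rw [card_filter, sum_product_right]
  refine (sum_le_card_nsmul _ _ (k * Nat.log 2 (2 * Fintype.card α)) fun a _ => ?_).trans
    (by rw [card_univ, smul_eq_mul])
  rw [← card_filter]
  have hsub : P.filter (fun p => ∃ s ∈ largePers w k, p ∣ g a + s) ⊆
      (largePers w k).biUnion (fun s => P.filter (fun p => p ∣ g a + s)) := by
    intro p hp
    obtain ⟨h1, s, h2, h3⟩ := mem_filter.1 hp
    exact mem_biUnion.2 ⟨s, h2, mem_filter.2 ⟨h1, h3⟩⟩
  refine (card_le_card hsub).trans (card_biUnion_le.trans ?_)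
  refine (sum_le_card_nsmul _ _ (Nat.log 2 (2 * Fintype.card α)) fun s hs => ?_).trans ?_
  · obtain ⟨z, -, rfl⟩ := mem_image.1 hs
    have h1 := per_pos w z
    have h2 := per_le_card w z
    have h3 := hg a
    exact card_primes_dvd_le P hP (by omega) (by omega)
  · rw [smul_eq_mul]
    exact Nat.mul_le_mul_right _ (card_largePers_le w k)

lemma mem_largePers {w : Perm α} {k : ℕ} {z : α} (h : Fintype.card α ≤ k * per w z) :
    per w z ∈ largePers w k := mem_image.2 ⟨z, mem_filter.2 ⟨mem_univ _, h⟩, rfl⟩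

lemma openPair_switch {ρ q : Perm α} {p : ℕ} {a b : α} (h : (a, b) ∈ openPair (sw a b ρ) q p) :
    b = ((ρ * q) ^ p) a ∧ ((∃ s ∈ largePers (ρ * q) 4, p ∣ 0 + s) ∨
      (∃ s ∈ largePers (ρ * q) 8, p ∣ per (ρ * q) (q⁻¹ a) + s) ∨
      ∃ s ∈ largePers (ρ * q) 8, p ∣ per (ρ * q) (q⁻¹ b) + s) := by
  obtain ⟨h1, h2, h3, c, h4, h5, h6, h7⟩ := mem_openPair.1 h
  have e := (pow_switch_of_exposed h2 h3).1
  rw [sw_sw, h1] at e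
  refine ⟨e.symm, ?_⟩
  obtain ⟨s, hs1, hs2, hs3⟩ := switch_large_cycle h1 h4 h5 h2 h3 h7
  rw [sw_sw] at hs3
  rcases hs3 with ⟨z, rfl⟩ | rfl
  · exact .inl ⟨_, mem_largePers (z := z) (by omega), by simpa using hs1⟩
  · rcases le_total (per (ρ * q) (q⁻¹ a)) (per (ρ * q) (q⁻¹ b)) with hle | hle
    · exact .inr (.inl ⟨_, mem_largePers (z := q⁻¹ b) (by omega), hs1⟩)
    · exact .inr (.inr ⟨_, mem_largePers (z := q⁻¹ a) (by omega), by rwa [add_comm]⟩)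

open Classical in
lemma openPair_moment {C : Finset (Perm α)} (hC : ConjClosed C) (q : Perm α) (P : Finset ℕ)
    (hP : ∀ p ∈ P, p.Prime) :
    ∑ p ∈ P, ∑ ρ ∈ C, (openPair ρ q p).card ≤
      20 * Fintype.card α * Nat.log 2 (2 * Fintype.card α) * C.card := by
  have h1 : ∀ p, ∑ ρ ∈ C, (openPair ρ q p).card =
      ∑ ρ ∈ C, (univ.filter (fun t : α × α => t ∈ openPair (sw t.1 t.2 ρ) q p)).card := by
    intro p
    rw [← switch_sum hC (fun t : α × α => t.1) (fun t => t.2) (fun ρ t => t ∈ openPair ρ q p)]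
    refine sum_congr rfl fun ρ _ => congrArg card (by ext; simp)
  rw [sum_congr rfl fun p _ => h1 p, sum_comm]
  refine (sum_le_card_nsmul _ _ (20 * Fintype.card α * Nat.log 2 (2 * Fintype.card α))
    fun ρ _ => ?_).trans (by rw [smul_eq_mul, mul_comm])
  set w := ρ * q with hw
  set X : Finset (ℕ × α × α) := (P ×ˢ (univ : Finset (α × α))).filter
    (fun t => t.2 ∈ openPair (sw t.2.1 t.2.2 ρ) q t.1) with hX
  have hXc : ∑ p ∈ P, (univ.filter (fun t : α × α => t ∈ openPair (sw t.1 t.2 ρ) q p)).card =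
      X.card := by
    rw [hX, card_filter, sum_product]
    simp only [card_filter]
  rw [hXc]
  have inj : ∀ t ∈ X, t.2.2 = (w ^ t.1) t.2.1 := fun t ht =>
    (openPair_switch (mem_filter.1 ht).2).1
  have bound : ∀ (k : ℕ) (g : α → ℕ) (π : ℕ × α × α → ℕ × α) (X' : Finset (ℕ × α × α)),
      (∀ a, g a ≤ Fintype.card α) → Set.InjOn π X' →
      (∀ t ∈ X', (π t).1 ∈ P ∧ ∃ s ∈ largePers w k, (π t).1 ∣ g (π t).2 + s) →
      X'.card ≤ Fintype.card α * (k * Nat.log 2 (2 * Fintype.card α)) := by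
    intro k g π X' hg hinj hmap
    refine le_trans ?_ (card_dvd_largePers_le w k P hP g hg)
    refine card_le_card_of_injOn π (fun t ht => ?_) hinj
    rw [mem_coe, mem_filter, mem_product]
    exact ⟨⟨(hmap t ht).1, mem_univ _⟩, (hmap t ht).2⟩
  have injA : Set.InjOn (fun t : ℕ × α × α => (t.1, t.2.1)) X := by
    rintro ⟨p, a, b⟩ h1 ⟨p', a', b'⟩ h2 heq
    have e1 := inj _ h1
    have e2 := inj _ h2
    simp only [Prod.mk.injEq] at *
    obtain ⟨rfl, rfl⟩ := heq
    exact ⟨rfl, rfl, by rw [e1, e2]⟩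
  have injB : Set.InjOn (fun t : ℕ × α × α => (t.1, t.2.2)) X := by
    rintro ⟨p, a, b⟩ h1 ⟨p', a', b'⟩ h2 heq
    have e1 := inj _ h1
    have e2 := inj _ h2
    simp only [Prod.mk.injEq] at *
    obtain ⟨rfl, rfl⟩ := heq
    exact ⟨rfl, (w ^ p).injective (by rw [← e1, ← e2]), rfl⟩
  set X1 := X.filter (fun t => ∃ s ∈ largePers w 4, t.1 ∣ 0 + s) with hX1
  set X2 := X.filter (fun t => ∃ s ∈ largePers w 8, t.1 ∣ per w (q⁻¹ t.2.1) + s) with hX2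
  set X3 := X.filter (fun t => ∃ s ∈ largePers w 8, t.1 ∣ per w (q⁻¹ t.2.2) + s) with hX3
  have hsub : X ⊆ X1 ∪ (X2 ∪ X3) := by
    intro t ht
    rw [mem_union, mem_union]
    rcases (openPair_switch (mem_filter.1 ht).2).2 with h | h | h
    · exact .inl (mem_filter.2 ⟨ht, h⟩)
    · exact .inr (.inl (mem_filter.2 ⟨ht, h⟩))
    · exact .inr (.inr (mem_filter.2 ⟨ht, h⟩))
  have hPX : ∀ t ∈ X, t.1 ∈ P := fun t ht => (mem_product.1 (mem_filter.1 ht).1).1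
  have b1 := bound 4 (fun _ => 0) (fun t => (t.1, t.2.1)) X1 (fun _ => Nat.zero_le _)
    (injA.mono (coe_subset.2 (filter_subset _ _)))
    (fun t ht => ⟨hPX t (mem_filter.1 ht).1, (mem_filter.1 ht).2⟩)
  have b2 := bound 8 (fun a => per w (q⁻¹ a)) (fun t => (t.1, t.2.1)) X2
    (fun _ => per_le_card _ _) (injA.mono (coe_subset.2 (filter_subset _ _)))
    (fun t ht => ⟨hPX t (mem_filter.1 ht).1, (mem_filter.1 ht).2⟩)
  have b3 := bound 8 (fun a => per w (q⁻¹ a)) (fun t => (t.1, t.2.2)) X3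
    (fun _ => per_le_card _ _) (injB.mono (coe_subset.2 (filter_subset _ _)))
    (fun t ht => ⟨hPX t (mem_filter.1 ht).1, (mem_filter.1 ht).2⟩)
  have b4 := (card_le_card hsub).trans ((card_union_le _ _).trans
    (Nat.add_le_add_left (card_union_le _ _) _))
  linarith

lemma per_add_per_le {w : Perm α} {x y : α} (h : y ∉ orb w x) :
    per w x + per w y ≤ Fintype.card α := by
  rw [per, per, ← card_union_of_disjoint (disjoint_orb h)]
  exact card_le_univ _

lemma card_openPair_ge {ρ q : Perm α} {p K : ℕ} {x c : α} {A : Finset α}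
    (hx : per (ρ * q) x = p) (hc : c ∉ orb (ρ * q) x) (hp : p ∣ per (ρ * q) c)
    (hL : Fintype.card α ≤ 4 * per (ρ * q) c) (hK : 4 * K ≤ Fintype.card α)
    (hA : ∀ a ∈ A, a ∈ orb (ρ * q) x ∧ q⁻¹ a ∉ orb (ρ * q) x ∧
      (q⁻¹ a ∈ orb (ρ * q) c ∨ K ≤ Fintype.card α - per (ρ * q) c)) :
    A.card * (K - 2 * p) ≤ (openPair ρ q p).card := by
  classical
  set G : α → Finset α := fun a => (univ.filter (fun b => q⁻¹ a ∈ orb (ρ * q) c ↔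
    q⁻¹ b ∈ orb (ρ * q) c)) \ nbr ρ q x with hG
  have h1 : ∀ a ∈ A, K - 2 * p ≤ (G a).card := by
    intro a ha
    have hn := card_nbr_le ρ q x
    rw [hx] at hn
    have hle : K ≤ (univ.filter (fun b => q⁻¹ a ∈ orb (ρ * q) c ↔
        q⁻¹ b ∈ orb (ρ * q) c)).card := by
      have hin : (univ.filter (fun b => q⁻¹ b ∈ orb (ρ * q) c)).card = per (ρ * q) c := by
        rw [card_filter_comp_perm q⁻¹ (fun y => y ∈ orb (ρ * q) c), per]
        congr 1; ext; simp
      by_cases hu : q⁻¹ a ∈ orb (ρ * q) c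
      · simp only [hu, true_iff]; omega
      · simp only [hu, false_iff]
        have h2 := card_filter_add_card_filter_not (s := (univ : Finset α))
          (fun b => q⁻¹ b ∈ orb (ρ * q) c)
        rw [card_univ] at h2
        rcases (hA a ha).2.2 with h3 | h3
        · exact absurd h3 hu
        · omega
    have := le_card_sdiff (nbr ρ q x) (univ.filter (fun b => q⁻¹ a ∈ orb (ρ * q) c ↔
        q⁻¹ b ∈ orb (ρ * q) c))
    rw [hG]; dsimp only; omega
  calc A.card * (K - 2 * p) ≤ ∑ a ∈ A, (G a).card := by
        rw [← smul_eq_mul, ← sum_const]; exact sum_le_sum h1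
    _ = (A.sigma G).card := (card_sigma _ _).symm
    _ ≤ _ := by
      refine card_le_card_of_injOn (fun t => (t.1, t.2)) ?_ ?_
      · rintro ⟨a, b⟩ ht
        obtain ⟨ha, hb2⟩ := mem_sigma.1 (mem_coe.1 ht)
        obtain ⟨hb1, hb'⟩ := mem_sdiff.1 hb2
        have hb := (mem_filter.1 hb1).2
        obtain ⟨h2, h3, -⟩ := hA a ha
        dsimp only at *
        rw [mem_coe, mem_openPair, per_eq_of_mem h2, orb_eq_of_mem h2, nbr, orb_eq_of_mem h2]
        exact ⟨hx, h3, hb', c, hc, hp, hL, hb⟩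
      · rintro ⟨a, b⟩ _ ⟨a', b'⟩ _ h; simpa using h

set_option maxHeartbeats 800000 in
lemma one_le_openPair_add_contact {ρ q : Perm α} {ε : ℝ} (hε : 0 < ε) {p K m : ℕ} (hm : 0 < m)
    (hK0 : 0 < K) (hK : 4 * K ≤ Fintype.card α) (hmp : m ≤ p) (h4p : 4 * p ≤ K)
    (h3p : 3 * (p + K) ≤ Fintype.card α) (he : Expanding ε ρ q) {x c : α}
    (hx : per (ρ * q) x = p) (hc : c ∉ orb (ρ * q) x) (hpc : p ∣ per (ρ * q) c)
    (hL : Fintype.card α ≤ 4 * per (ρ * q) c) :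
    1 ≤ 4 / (ε * m * K) * ((openPair ρ q p).card : ℝ) +
      ∑ ℓ ∈ Icc 1 K, 2 / (ε * p) * ((contact ρ q p ℓ).card : ℝ) := by
  classical
  set n := Fintype.card α with hn
  have hmR : (0 : ℝ) < m := by exact_mod_cast hm
  have hKR : (0 : ℝ) < K := by exact_mod_cast hK0
  have hpR : (0 : ℝ) < p := by exact_mod_cast hm.trans_le hmp
  have hmpR : (m : ℝ) ≤ p := by exact_mod_cast hmp
  have hA := (mem_richPt.1 (he.mem_richPt (x := x) (by omega))).2
  rw [hx] at hA
  set A := (orb (ρ * q) x).filter (fun z => q⁻¹ z ∉ orb (ρ * q) x) with hAdef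
  have hAmem : ∀ a ∈ A, a ∈ orb (ρ * q) x ∧ q⁻¹ a ∉ orb (ρ * q) x := fun a ha =>
    mem_filter.1 ha
  have large : ∀ A' : Finset α, ε * p ≤ 2 * A'.card → (∀ a ∈ A', a ∈ orb (ρ * q) x ∧
      q⁻¹ a ∉ orb (ρ * q) x ∧ (q⁻¹ a ∈ orb (ρ * q) c ∨ K ≤ n - per (ρ * q) c)) →
      1 ≤ 4 / (ε * m * K) * ((openPair ρ q p).card : ℝ) := by
    intro A' h1 h2
    have h3 := card_openPair_ge hx hc hpc hL hK h2
    have h4 : A'.card * K ≤ 2 * (openPair ρ q p).card := by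
      have : K ≤ 2 * (K - 2 * p) := by omega
      calc A'.card * K ≤ A'.card * (2 * (K - 2 * p)) := Nat.mul_le_mul_left _ this
        _ = 2 * (A'.card * (K - 2 * p)) := by ring
        _ ≤ _ := Nat.mul_le_mul_left _ h3
    have h4R : (A'.card : ℝ) * K ≤ 2 * (openPair ρ q p).card := by exact_mod_cast h4
    rw [div_mul_eq_mul_div, le_div_iff₀ (by positivity)]
    have h5 : ε * m * K ≤ ε * p * K := by gcongr
    have h6 : ε * p * K ≤ 2 * A'.card * K := by gcongr
    linarith
  have nonneg1 : 0 ≤ 4 / (ε * m * K) * ((openPair ρ q p).card : ℝ) :=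
    mul_nonneg (by positivity) (Nat.cast_nonneg _)
  have nonneg2 : 0 ≤ ∑ ℓ ∈ Icc 1 K, 2 / (ε * p) * ((contact ρ q p ℓ).card : ℝ) :=
    sum_nonneg fun _ _ => mul_nonneg (by positivity) (Nat.cast_nonneg _)
  clear_value n
  by_cases hbig : K ≤ n - per (ρ * q) c
  · have := large A (by have : (0 : ℝ) < A.card := lt_of_lt_of_le (by positivity) hA
                        linarith) fun a ha => ⟨(hAmem a ha).1, (hAmem a ha).2, .inr hbig⟩
    linarith
  have hsplit := card_filter_add_card_filter_not (s := A) (fun z => q⁻¹ z ∈ orb (ρ * q) c)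
  by_cases hA1 : ε * p ≤ 2 * (A.filter (fun z => q⁻¹ z ∈ orb (ρ * q) c)).card
  · have := large _ hA1 fun a ha => ⟨(hAmem a (mem_filter.1 ha).1).1,
      (hAmem a (mem_filter.1 ha).1).2, .inl (mem_filter.1 ha).2⟩
    linarith
  · have hA2 : ε * p ≤ 2 * (A.filter (fun z => ¬ q⁻¹ z ∈ orb (ρ * q) c)).card := by
      push Not at hA1
      rw [← hsplit] at hA
      push_cast at hA
      linarith
    have hsub : (A.filter (fun z => ¬ q⁻¹ z ∈ orb (ρ * q) c)) ⊆
        (Icc 1 K).biUnion (fun ℓ => contact ρ q p ℓ) := by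
      intro z hz
      obtain ⟨hz1, hz2⟩ := mem_filter.1 hz
      obtain ⟨hz3, hz4⟩ := hAmem z hz1
      have h5 := per_add_per_le hz2
      have h6 := per_pos (ρ * q) (q⁻¹ z)
      refine mem_biUnion.2 ⟨per (ρ * q) (q⁻¹ z), mem_Icc.2 ⟨h6, by omega⟩, ?_⟩
      rw [contact, mem_filter, per_eq_of_mem hz3, orb_eq_of_mem hz3]
      exact ⟨mem_univ _, hx, rfl, hz4⟩
    have h7 : ((A.filter (fun z => ¬ q⁻¹ z ∈ orb (ρ * q) c)).card : ℝ) ≤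
        ∑ ℓ ∈ Icc 1 K, ((contact ρ q p ℓ).card : ℝ) := by
      exact_mod_cast (card_le_card hsub).trans card_biUnion_le
    have h8 : 1 ≤ ∑ ℓ ∈ Icc 1 K, 2 / (ε * p) * ((contact ρ q p ℓ).card : ℝ) := by
      rw [← mul_sum, div_mul_eq_mul_div, le_div_iff₀ (by positivity)]
      linarith
    linarith

open Classical in
/-- It is unlikely that some `p`-cycle coexists with a large cycle of length divisible by `p`. -/
lemma large_cycle_bound {C : Finset (Perm α)} (hC : ConjClosed C) (q : Perm α) {ε : ℝ}
    (hε : 0 < ε) (P : Finset ℕ) (hP : ∀ p ∈ P, p.Prime) {K m : ℕ} (hm : 0 < m) (hK0 : 0 < K)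
    (hK : 4 * K ≤ Fintype.card α)
    (hPK : ∀ p ∈ P, m ≤ p ∧ 4 * p ≤ K ∧ 3 * (p + K) ≤ Fintype.card α) :
    ((C.filter (fun ρ => Expanding ε ρ q ∧ ∃ p ∈ P, ∃ x c, per (ρ * q) x = p ∧
      c ∉ orb (ρ * q) x ∧ p ∣ per (ρ * q) c ∧ Fintype.card α ≤ 4 * per (ρ * q) c)).card : ℝ) ≤
    (80 * Fintype.card α * Nat.log 2 (2 * Fintype.card α) / (ε * m * K) +
      36 * K * (∑ p ∈ P, (1 : ℝ) / p) / (Fintype.card α * ε ^ 3)) * C.card := by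
  set n := Fintype.card α with hn
  set B := C.filter (fun ρ => Expanding ε ρ q ∧ ∃ p ∈ P, ∃ x c, per (ρ * q) x = p ∧
      c ∉ orb (ρ * q) x ∧ p ∣ per (ρ * q) c ∧ n ≤ 4 * per (ρ * q) c) with hB
  have hmR : (0 : ℝ) < m := by exact_mod_cast hm
  have hKR : (0 : ℝ) < K := by exact_mod_cast hK0
  have hnR : (0 : ℝ) < n := by have : 0 < n := by omega
                               exact_mod_cast this
  obtain ⟨F, hFdef⟩ : ∃ F : Perm α → ℕ → ℝ, F = fun ρ p => 4 / (ε * m * K) *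
    ((openPair ρ q p).card : ℝ) + ∑ ℓ ∈ Icc 1 K, 2 / (ε * p) * ((contact ρ q p ℓ).card : ℝ) :=
    ⟨_, rfl⟩
  have key : ∀ ρ ∈ B, (1 : ℝ) ≤ ∑ p ∈ P, F ρ p := by
    intro ρ hρ
    obtain ⟨-, he, p, hp, x, c, hx, hc, hpc, hL⟩ := mem_filter.1 hρ
    obtain ⟨hmp, h4p, h3p⟩ := hPK p hp
    have hF : ∀ p ∈ P, 0 ≤ F ρ p := fun p _ => by
      rw [hFdef]; exact add_nonneg (by positivity) (sum_nonneg fun _ _ => by positivity)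
    exact (one_le_openPair_add_contact hε hm hK0 hK hmp h4p h3p he hx hc hpc hL).trans
      ((by rw [hFdef] : _ = F ρ p).le.trans
      (single_le_sum hF hp))
  have hBC : B ⊆ C.filter (fun ρ => Expanding ε ρ q) := fun ρ h => by
    have := mem_filter.1 h; exact mem_filter.2 ⟨this.1, this.2.1⟩
  have hCC : C.filter (fun ρ => Expanding ε ρ q) ⊆ C := filter_subset _ _
  calc (B.card : ℝ) = ∑ ρ ∈ B, (1 : ℝ) := by simp
    _ ≤ ∑ ρ ∈ B, ∑ p ∈ P, F ρ p := sum_le_sum key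
    _ = 4 / (ε * m * K) * ∑ p ∈ P, ∑ ρ ∈ B, ((openPair ρ q p).card : ℝ) +
        ∑ p ∈ P, 2 / (ε * p) * ∑ ℓ ∈ Icc 1 K, ∑ ρ ∈ B, ((contact ρ q p ℓ).card : ℝ) := by
        rw [sum_comm, hFdef]
        simp only [sum_add_distrib, mul_sum]
        congr 1
        exact sum_congr rfl fun p _ => sum_comm
    _ ≤ 4 / (ε * m * K) * (20 * n * Nat.log 2 (2 * n) * C.card) +
        ∑ p ∈ P, 2 / (ε * p) * ∑ ℓ ∈ Icc 1 K, 18 * C.card / (n * ε ^ 2) := by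
        gcongr with p hp ℓ hℓ
        · have h1 := openPair_moment hC q P hP
          have h2 : ∑ p ∈ P, ∑ ρ ∈ B, (openPair ρ q p).card ≤
              ∑ p ∈ P, ∑ ρ ∈ C, (openPair ρ q p).card :=
            sum_le_sum fun p _ => sum_le_sum_of_subset (hBC.trans hCC)
          exact_mod_cast h2.trans h1
        · obtain ⟨hmp, h4p, h3p⟩ := hPK p hp
          rw [mem_Icc] at hℓ
          have h1 := contact_moment hC q (ℓ₁ := p) (ℓ₂ := ℓ) (by omega) (by omega) hε (by omega)
          rw [le_div_iff₀ (by positivity), mul_comm]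
          refine le_trans ?_ h1
          gcongr
    _ = _ := by
        simp only [sum_const, Nat.card_Icc, nsmul_eq_mul, Nat.add_sub_cancel]
        rw [add_mul]
        congr 1
        · field_simp; ring
        · rw [mul_sum, sum_div, sum_mul]
          refine sum_congr rfl fun p hp => ?_
          have hpR : (0 : ℝ) < p := by exact_mod_cast (hP p hp).pos
          field_simp; ring

open Classical in
/-- It is unlikely that some `p`-cycle coexists with a short cycle of length divisible by `p`. -/
lemma small_cycle_bound {C : Finset (Perm α)} (hC : ConjClosed C) (q : Perm α) {ε : ℝ}
    (hε : 0 < ε) (P : Finset ℕ) {m : ℕ} (hm : 0 < m) (hP : ∀ p ∈ P, m ≤ p) :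
    ((C.filter (fun ρ => Expanding ε ρ q ∧ ∃ p ∈ P, ∃ x c, per (ρ * q) x = p ∧
      c ∉ orb (ρ * q) x ∧ p ∣ per (ρ * q) c ∧ 3 * (p + per (ρ * q) c) ≤ Fintype.card α)).card : ℝ)
      ≤ 36 * (∑ p ∈ P, (1 : ℝ) / p) * (1 + Real.log (Fintype.card α)) / (ε ^ 2 * m) * C.card := by
  set n := Fintype.card α with hn
  have hmR : (0 : ℝ) < m := by exact_mod_cast hm
  set D : ℕ → ℕ → Finset (Perm α) := fun p k => C.filter (fun ρ => Expanding ε ρ q ∧ ∃ x c,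
    per (ρ * q) x = p ∧ per (ρ * q) c = k * p ∧ c ∉ orb (ρ * q) x ∧ 3 * (p + k * p) ≤ n) with hD
  have hsub : C.filter (fun ρ => Expanding ε ρ q ∧ ∃ p ∈ P, ∃ x c, per (ρ * q) x = p ∧
      c ∉ orb (ρ * q) x ∧ p ∣ per (ρ * q) c ∧ 3 * (p + per (ρ * q) c) ≤ n) ⊆
      P.biUnion (fun p => (Icc 1 n).biUnion (D p)) := by
    intro ρ hρ
    obtain ⟨h1, h2, p, hp, x, c, hx, hc, ⟨k, hk⟩, h3⟩ := mem_filter.1 hρ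
    have hc0 := per_pos (ρ * q) c
    have hk0 : 0 < k := by
      rcases Nat.eq_zero_or_pos k with rfl | h
      · simp [hk] at hc0
      · exact h
    have hp0 : 0 < p := hm.trans_le (hP p hp)
    have hkn : k ≤ n := by
      have : k ≤ p * k := Nat.le_mul_of_pos_left _ hp0
      omega
    refine mem_biUnion.2 ⟨p, hp, mem_biUnion.2 ⟨k, mem_Icc.2 ⟨hk0, hkn⟩, mem_filter.2
      ⟨h1, h2, x, c, hx, by rw [hk, mul_comm], hc, by rwa [hk, mul_comm p k] at h3⟩⟩⟩
  have hDb : ∀ p ∈ P, ∀ k ∈ Icc 1 n, ((D p k).card : ℝ) ≤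
      36 / (ε ^ 2 * m) * (1 / p) * (1 / k) * C.card := by
    intro p hp k hk
    have hk1 := (mem_Icc.1 hk).1
    have hp0 : 0 < p := hm.trans_le (hP p hp)
    have hpR : (0 : ℝ) < p := by exact_mod_cast hp0
    have hkR : (0 : ℝ) < k := by exact_mod_cast hk1
    by_cases h3 : 3 * (p + k * p) ≤ n
    · have h := two_cycles_bound hC q hp0 (Nat.le_mul_of_pos_left p hk1) hε h3
      have h4 : ((D p k).card : ℝ) ≤ ((C.filter (fun ρ => Expanding ε ρ q ∧ ∃ x c,
          per (ρ * q) x = p ∧ per (ρ * q) c = k * p ∧ c ∉ orb (ρ * q) x)).card : ℝ) := by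
        refine Nat.cast_le.2 (card_le_card fun ρ hρ => ?_)
        obtain ⟨h5, h6, x, c, h7, h8, h9, -⟩ := mem_filter.1 hρ
        exact mem_filter.2 ⟨h5, h6, x, c, h7, h8, h9⟩
      refine h4.trans ?_
      have hmp : (m : ℝ) ≤ p := by exact_mod_cast hP p hp
      push_cast at h
      rw [show 36 / (ε ^ 2 * m) * (1 / (p : ℝ)) * (1 / k) * C.card =
        36 * C.card / (ε ^ 2 * m * p * k) by field_simp, le_div_iff₀ (by positivity)]
      refine le_trans ?_ h
      rw [mul_comm]
      have : ε ^ 2 * m * p * k ≤ ε ^ 2 * p * (k * p) := by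
        have : (m : ℝ) * (ε ^ 2 * p * k) ≤ p * (ε ^ 2 * p * k) := by gcongr
        linarith
      gcongr
    · have : D p k = ∅ := by
        refine filter_eq_empty_iff.2 ?_
        rintro ρ - ⟨-, x, c, -, -, -, h⟩
        exact h3 h
      rw [this, card_empty, Nat.cast_zero]
      positivity
  calc _ ≤ ∑ p ∈ P, ∑ k ∈ Icc 1 n, ((D p k).card : ℝ) := by
        have h1 := (card_le_card hsub).trans (card_biUnion_le.trans
          (sum_le_sum fun p _ => card_biUnion_le))
        exact_mod_cast h1
    _ ≤ ∑ p ∈ P, ∑ k ∈ Icc 1 n, 36 / (ε ^ 2 * m) * (1 / p) * (1 / k) * C.card :=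
        sum_le_sum fun p hp => sum_le_sum fun k hk => hDb p hp k hk
    _ = 36 * (∑ p ∈ P, (1 : ℝ) / p) * (∑ k ∈ Icc 1 n, (1 : ℝ) / k) / (ε ^ 2 * m) * C.card := by
        simp only [← sum_mul, ← mul_sum]
        ring
    _ ≤ _ := by
        have h : (∑ k ∈ Icc 1 n, (1 : ℝ) / k) ≤ 1 + Real.log n := by
          have := harmonic_le_one_add_log n
          rw [harmonic_eq_sum_Icc] at this
          push_cast at this
          simpa using this
        gcongr

lemma le_four_mul_of_lt {n p l : ℕ} (hp : 12 * p ≤ n) (h : ¬ 3 * (p + l) ≤ n) : n ≤ 4 * l := by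
  omega

/-- If the lengths of all other cycles are prime to `p`, a suitable power is a `p`-cycle. -/
lemma exists_isCycle_pow {w : Perm α} {x : α} {p : ℕ} (hp : p.Prime) (hx : per w x = p)
    (h : ∀ y, y ∉ orb w x → ¬ p ∣ per w y) :
    ∃ k : ℕ, (w ^ k).IsCycle ∧ (w ^ k).support = orb w x := by
  set k := ∏ y ∈ univ.filter (fun y => y ∉ orb w x), per w y with hk
  have hpk : ¬ p ∣ k := by
    rw [hk, Prime.dvd_finsetProd_iff hp.prime]
    rintro ⟨y, hy, hd⟩
    exact h y (mem_filter.1 hy).2 hd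
  have hout : ∀ y, y ∉ orb w x → (w ^ k) y = y := fun y hy =>
    (pow_eq_iff _ _ _).2 (dvd_prod_of_mem _ (mem_filter.2 ⟨mem_univ _, hy⟩))
  have hin : ∀ y, y ∈ orb w x → (w ^ k) y ≠ y := fun y hy he => by
    rw [pow_eq_iff, per_eq_of_mem hy, hx] at he
    exact hpk he
  refine ⟨k, ⟨x, hin x (self_mem_orb _ _), fun y hy => ?_⟩, ?_⟩
  · have hy' : y ∈ orb w x := by by_contra hc; exact hy (hout y hc)
    obtain ⟨i, -, hi⟩ := exists_pow_of_mem_orb hy'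
    have hcop : Nat.Coprime k p := ((Nat.Prime.coprime_iff_not_dvd hp).2 hpk).symm
    obtain ⟨j, -, hj⟩ := Nat.exists_mul_mod_eq_of_coprime i hcop hp.ne_zero
    refine ⟨j, ?_⟩
    rw [zpow_natCast, ← pow_mul, ← hi]
    exact ((isCycleOn_orb w x).pow_apply_eq_pow_apply (self_mem_orb w x)).2
      (show _ ≡ _ [MOD per w x] by rw [hx]; exact hj)
  · ext y
    rw [mem_support]
    exact ⟨fun h => by by_contra hc; exact h (hout y hc), hin y⟩

open MulAction in
/-- Jordan: a primitive group containing a cycle of prime length `p`, with `2 p ≤ n`,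
contains the alternating group. -/
lemma alternatingGroup_le_of_prime_cycle {G : Subgroup (Perm α)} (hG : IsPreprimitive G α)
    {p : ℕ} (hp : p.Prime) (hpn : 2 * p ≤ Fintype.card α) {g : Perm α} (hgc : g.IsCycle)
    (hgp : g.support.card = p) (hg : g ∈ G) : alternatingGroup α ≤ G := by
  have hp2 := hp.two_le
  obtain ⟨N, hN⟩ : ∃ N, Fintype.card α = p + (N + 1) := ⟨Fintype.card α - p - 1, by omega⟩
  classical
  have hmul : IsMultiplyPreprimitive G α (N + 2) := by
    apply hG.isMultiplyPreprimitive (s := (g.supportᶜ : Set α))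
    · apply Nat.add_left_cancel
      rw [Set.ncard_add_ncard_compl, Set.ncard_coe_finset, hgp, Nat.card_eq_fintype_card, hN]
    · rw [Nat.card_eq_fintype_card]; omega
    have := isPretransitive_of_isCycle_mem hgc hg
    apply IsPreprimitive.of_prime_card
    convert! hp
    rw [Nat.card_eq_fintype_card, Fintype.card_subtype, ← hgp]
    apply congr_arg
    ext x
    simp [SubMulAction.mem_ofFixingSubgroup_iff]
  have hmt : IsMultiplyPretransitive G α (N + 2) := IsMultiplyPreprimitive.isMultiplyPretransitive ..
  have hmp : IsMultiplyPretransitive G α p := isMultiplyPretransitive_of_le (n := N + 2)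
    (by omega) (by rw [Nat.card_eq_fintype_card]; omega)
  obtain ⟨a, ha⟩ : g.support.Nonempty := card_pos.1 (by omega)
  obtain ⟨z, hz⟩ : ∃ z, z ∉ g.support := by
    by_contra! h
    have : g.support = univ := eq_univ_iff_forall.2 h
    rw [this, card_univ] at hgp
    omega
  let e : Fin p ↪ α := ⟨fun i => ((g.support.equivFinOfCardEq hgp).symm i : α),
    Subtype.val_injective.comp (Equiv.injective _)⟩
  obtain ⟨h, hh⟩ := hmp.exists_smul_eq e (e.trans (swap a z).toEmbedding)
  have hs : ∀ x ∈ g.support, (h : Perm α) x = swap a z x := by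
    intro x hx
    have := DFunLike.congr_fun hh (g.support.equivFinOfCardEq hgp ⟨x, hx⟩)
    simpa [e, Subgroup.smul_def] using this
  have hd : Disjoint (swap a z * (h : Perm α)) g := by
    intro x
    by_cases hx : x ∈ g.support
    · left; rw [mul_apply, hs x hx, swap_apply_self]
    · right; exact notMem_support.1 hx
  have hcomm := hd.commute.inv_right
  have key : g * h * g⁻¹ * (h : Perm α)⁻¹ = swap z (g a) * swap z a := by
    have h1 : (h : Perm α) = swap a z * (swap a z * (h : Perm α)) := by
      rw [← mul_assoc, swap_mul_self, one_mul]
    have h2 : (h : Perm α) * g⁻¹ * (h : Perm α)⁻¹ = swap a z * g⁻¹ * swap a z := by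
      rw [h1, mul_inv_rev, swap_inv, mul_assoc (swap a z), hcomm.eq]
      group
    have h3 : g * swap a z * g⁻¹ = swap (g a) (g z) := by
      rw [mul_swap_eq_swap_mul]; group
    rw [mul_assoc g, mul_assoc g, h2, ← mul_assoc, ← mul_assoc, h3, notMem_support.1 hz,
      swap_comm, swap_comm a]
  have haz : a ≠ z := fun h => hz (h ▸ ha)
  have hgaz : g a ≠ z := fun h => hz (h ▸ apply_mem_support.2 ha)
  refine alternatingGroup_le_of_isPreprimitive_of_isThreeCycle_mem hG
    (isThreeCycle_swap_mul_swap_same hgaz.symm haz.symm (mem_support.1 ha)) ?_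
  rw [← key]
  exact G.mul_mem (G.mul_mem (G.mul_mem hg h.2) (G.inv_mem hg)) (G.inv_mem h.2)

/-- The set of orbits of a permutation. -/
def orbs (q : Perm α) : Finset (Finset α) := univ.image (orb q)

lemma orb_mem_orbs (q : Perm α) (x : α) : orb q x ∈ orbs q := mem_image_of_mem _ (mem_univ _)

lemma pairwiseDisjoint_orbs (q : Perm α) : (orbs q : Set (Finset α)).PairwiseDisjoint id := by
  intro A hA B hB hAB
  obtain ⟨x, -, rfl⟩ := mem_image.1 (mem_coe.1 hA)
  obtain ⟨y, -, rfl⟩ := mem_image.1 (mem_coe.1 hB)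
  exact disjoint_orb fun h => hAB (orb_eq_of_mem h).symm

lemma sum_card_orbs (q : Perm α) : ∑ O ∈ orbs q, O.card = Fintype.card α := by
  rw [← card_univ, ← card_biUnion (t := fun O => O) (pairwiseDisjoint_orbs q)]
  congr 1
  refine eq_univ_iff_forall.2 fun x => mem_biUnion.2 ⟨_, orb_mem_orbs q x, self_mem_orb q x⟩

/-- The sets invariant under a permutation. -/
def invSets (q : Perm α) : Finset (Finset α) := univ.filter (fun V => ∀ x ∈ V, q x ∈ V)

lemma mem_invSets {q : Perm α} {V : Finset α} : V ∈ invSets q ↔ ∀ x ∈ V, q x ∈ V := by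
  simp [invSets]

lemma orb_subset_of_mem_invSets {q : Perm α} {V : Finset α} (h : V ∈ invSets q) {x : α}
    (hx : x ∈ V) : orb q x ⊆ V := orb_subset_of_invariant hx (mem_invSets.1 h)

lemma biUnion_orbs_of_mem_invSets {q : Perm α} {V : Finset α} (h : V ∈ invSets q) :
    ((orbs q).filter (fun O => O ⊆ V)).biUnion id = V := by
  ext x
  rw [mem_biUnion]
  constructor
  · rintro ⟨O, hO, hx⟩; exact (mem_filter.1 hO).2 hx
  · intro hx
    exact ⟨_, mem_filter.2 ⟨orb_mem_orbs q x, orb_subset_of_mem_invSets h hx⟩, self_mem_orb q x⟩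

/-- The generating polynomial of the invariant sets, by size. -/
noncomputable def invGen (q : Perm α) (z : ℝ) : ℝ := ∑ V ∈ invSets q, z ^ V.card

lemma invGen_nonneg (q : Perm α) {z : ℝ} (hz : 0 ≤ z) : 0 ≤ invGen q z :=
  sum_nonneg fun _ _ => pow_nonneg hz _

lemma invGen_le_prod (q : Perm α) {z : ℝ} (hz : 0 ≤ z) :
    invGen q z ≤ ∏ O ∈ orbs q, (1 + z ^ O.card) := by
  classical
  rw [prod_one_add]
  have hinj : Set.InjOn (fun V => (orbs q).filter (fun O => O ⊆ V)) (invSets q) := by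
    intro V hV W hW h
    rw [← biUnion_orbs_of_mem_invSets (mem_coe.1 hV), ← biUnion_orbs_of_mem_invSets (mem_coe.1 hW)]
    exact congrArg (fun T => T.biUnion id) h
  calc invGen q z = ∑ V ∈ invSets q, ∏ O ∈ (orbs q).filter (fun O => O ⊆ V), z ^ O.card := by
        refine sum_congr rfl fun V hV => ?_
        rw [prod_pow_eq_pow_sum, ← card_biUnion (t := fun O => O)
          ((pairwiseDisjoint_orbs q).subset (coe_subset.2 (filter_subset _ _)))]
        congr 2
        exact (biUnion_orbs_of_mem_invSets hV).symm
    _ = ∑ T ∈ (invSets q).image (fun V => (orbs q).filter (fun O => O ⊆ V)),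
          ∏ O ∈ T, z ^ O.card := by rw [sum_image hinj]
    _ ≤ _ := by
        refine sum_le_sum_of_subset_of_nonneg ?_ fun _ _ _ => prod_nonneg fun _ _ => by positivity
        intro T hT
        obtain ⟨V, -, rfl⟩ := mem_image.1 hT
        exact mem_powerset.2 (filter_subset _ _)

/-- The number of orbits of size `k`. -/
def numOrb (q : Perm α) (k : ℕ) : ℕ := ((orbs q).filter (fun O => O.card = k)).card

/-- The number of orbits of size at least `3`. -/
def numBig (q : Perm α) : ℕ := ((orbs q).filter (fun O => 3 ≤ O.card)).card

lemma card_pos_of_mem_orbs {q : Perm α} {O : Finset α} (h : O ∈ orbs q) : 0 < O.card := by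
  obtain ⟨x, -, rfl⟩ := mem_image.1 h
  exact per_pos q x

lemma orbs_split (q : Perm α) : orbs q = (orbs q).filter (fun O => O.card = 1) ∪
    ((orbs q).filter (fun O => O.card = 2) ∪ (orbs q).filter (fun O => 3 ≤ O.card)) := by
  rw [← filter_or, ← filter_or]
  refine (filter_true_of_mem fun O hO => ?_).symm
  have := card_pos_of_mem_orbs hO
  omega

lemma orbs_split_disjoint (q : Perm α) : Disjoint ((orbs q).filter (fun O => O.card = 2))
    ((orbs q).filter (fun O => 3 ≤ O.card)) :=
  disjoint_filter.2 fun _ _ h => by omega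

lemma orbs_split_disjoint' (q : Perm α) : Disjoint ((orbs q).filter (fun O => O.card = 1))
    ((orbs q).filter (fun O => O.card = 2) ∪ (orbs q).filter (fun O => 3 ≤ O.card)) := by
  rw [← filter_or]
  exact disjoint_filter.2 fun _ _ h => by omega

lemma card_orbs (q : Perm α) : (orbs q).card = numOrb q 1 + (numOrb q 2 + numBig q) := by
  rw [orbs_split, card_union_of_disjoint (orbs_split_disjoint' q),
    card_union_of_disjoint (orbs_split_disjoint q)]
  rfl

lemma numOrb_add_le (q : Perm α) : numOrb q 1 + 2 * numOrb q 2 + 3 * numBig q ≤ Fintype.card α := by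
  rw [← sum_card_orbs q]
  conv_rhs => rw [orbs_split, sum_union (orbs_split_disjoint' q), sum_union (orbs_split_disjoint q)]
  have h1 : ∑ O ∈ (orbs q).filter (fun O => O.card = 1), O.card = numOrb q 1 := by
    rw [sum_congr rfl fun O hO => (mem_filter.1 hO).2, sum_const, smul_eq_mul, mul_one, numOrb]
  have h2 : ∑ O ∈ (orbs q).filter (fun O => O.card = 2), O.card = numOrb q 2 * 2 := by
    rw [sum_congr rfl fun O hO => (mem_filter.1 hO).2, sum_const, smul_eq_mul, numOrb]
  have h3 : numBig q * 3 ≤ ∑ O ∈ (orbs q).filter (fun O => 3 ≤ O.card), O.card := by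
    rw [numBig, ← smul_eq_mul]
    exact card_nsmul_le_sum _ _ _ fun O hO => (mem_filter.1 hO).2
  omega

lemma invGen_le (q : Perm α) {z : ℝ} (hz : 0 ≤ z) (hz1 : z ≤ 1) : invGen q z ≤
    (1 + z) ^ numOrb q 1 * ((1 + z ^ 2) ^ numOrb q 2 * (1 + z ^ 3) ^ numBig q) := by
  refine (invGen_le_prod q hz).trans ?_
  rw [orbs_split, prod_union (orbs_split_disjoint' q), prod_union (orbs_split_disjoint q)]
  have hpos : ∀ s : Finset (Finset α), 0 ≤ ∏ O ∈ s, (1 + z ^ O.card) :=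
    fun s => prod_nonneg fun _ _ => by positivity
  refine mul_le_mul (le_of_eq ?_) (mul_le_mul (le_of_eq ?_) ?_ (hpos _) (by positivity))
    (mul_nonneg (hpos _) (hpos _)) (by positivity)
  · rw [prod_congr rfl fun O hO => by rw [(mem_filter.1 hO).2], prod_const, numOrb, pow_one]
  · rw [prod_congr rfl fun O hO => by rw [(mem_filter.1 hO).2], prod_const, numOrb]
  · rw [numBig, ← prod_const]
    refine prod_le_prod (fun _ _ => by positivity) fun O hO => ?_
    have := pow_le_pow_of_le_one hz hz1 (mem_filter.1 hO).2
    linarith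

lemma card_invSets_le (q : Perm α) {z : ℝ} (hz : 0 < z) (L : ℕ) :
    (((invSets q).filter (fun V => V.card = L)).card : ℝ) * z ^ L ≤ invGen q z := by
  rw [← nsmul_eq_mul, ← sum_const, sum_congr rfl fun V hV => by rw [← (mem_filter.1 hV).2]]
  exact sum_le_sum_of_subset_of_nonneg (filter_subset _ _) fun _ _ _ => by positivity

lemma card_invSets_mem_le (q : Perm α) {z : ℝ} (hz : 0 < z) (hz1 : z ≤ 1) (v : α) (L : ℕ) :
    (((invSets q).filter (fun V => V.card = L ∧ v ∈ V)).card : ℝ) * z ^ L ≤ z * invGen q z := by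
  have hinj : Set.InjOn (fun V => V \ orb q v) ((invSets q).filter (fun V => V.card = L ∧ v ∈ V)) := by
    intro V hV W hW h
    obtain ⟨hV1, -, hV2⟩ := mem_filter.1 (mem_coe.1 hV)
    obtain ⟨hW1, -, hW2⟩ := mem_filter.1 (mem_coe.1 hW)
    rw [← sdiff_union_of_subset (orb_subset_of_mem_invSets hV1 hV2),
      ← sdiff_union_of_subset (orb_subset_of_mem_invSets hW1 hW2)]
    exact congrArg (fun T => T ∪ orb q v) h
  calc (((invSets q).filter (fun V => V.card = L ∧ v ∈ V)).card : ℝ) * z ^ L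
      = ∑ V ∈ (invSets q).filter (fun V => V.card = L ∧ v ∈ V), z ^ L := by
        rw [sum_const, nsmul_eq_mul]
    _ ≤ ∑ V ∈ (invSets q).filter (fun V => V.card = L ∧ v ∈ V), z * z ^ (V \ orb q v).card := by
        refine sum_le_sum fun V hV => ?_
        obtain ⟨hV1, hV2, hV3⟩ := mem_filter.1 hV
        have h1 := card_sdiff_add_card_eq_card (orb_subset_of_mem_invSets hV1 hV3)
        have h2 : 0 < (orb q v).card := per_pos q v
        rw [← pow_succ']
        exact pow_le_pow_of_le_one hz.le hz1 (by omega)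
    _ = z * ∑ V ∈ ((invSets q).filter (fun V => V.card = L ∧ v ∈ V)).image (fun V => V \ orb q v),
          z ^ V.card := by rw [sum_image hinj, mul_sum]
    _ ≤ _ := by
        refine mul_le_mul_of_nonneg_left (sum_le_sum_of_subset_of_nonneg ?_
          fun _ _ _ => by positivity) hz.le
        intro T hT
        obtain ⟨V, hV, rfl⟩ := mem_image.1 hT
        have hV1 := (mem_filter.1 hV).1
        refine mem_invSets.2 fun x hx => ?_
        rw [Finset.mem_sdiff] at hx ⊢
        exact ⟨mem_invSets.1 hV1 x hx.1, fun h => hx.2 (apply_mem_orb.1 h)⟩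

/-- The sets of size `L` with at most `h` points whose `q`-preimage lies outside. -/
def nearSets (q : Perm α) (h L : ℕ) : Finset (Finset α) :=
  univ.filter (fun W => W.card = L ∧ (W.filter (fun z => q⁻¹ z ∉ W)).card ≤ h)

lemma card_exit_eq (q : Perm α) (W : Finset α) :
    (W.filter (fun z => q z ∉ W)).card = (W.filter (fun z => q⁻¹ z ∉ W)).card := by
  have h1 := card_filter_add_card_filter_not (s := W) (fun z => q z ∈ W)
  have h2 := card_filter_add_card_filter_not (s := W) (fun z => q⁻¹ z ∈ W)
  have h3 : (W.filter (fun z => q z ∈ W)).card = (W.filter (fun z => q⁻¹ z ∈ W)).card := by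
    refine card_bij (fun z _ => q z) ?_ (fun _ _ _ _ h => q.injective h) ?_
    · intro z hz; simpa [and_comm] using hz
    · intro z hz; exact ⟨q⁻¹ z, by simpa [and_comm] using hz, by simp⟩
  omega

lemma card_filter_card_le (h : ℕ) :
    ((univ : Finset (Finset α)).filter (fun E => E.card ≤ h)).card ≤ (Fintype.card α + 1) ^ h := by
  have h1 : (univ : Finset (Finset α)).filter (fun E => E.card ≤ h) =
      (range (h + 1)).biUnion (fun k => powersetCard k univ) := by
    ext E; simp
  rw [h1, add_pow]
  refine card_biUnion_le.trans (sum_le_sum fun k hk => ?_)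
  rw [card_powersetCard, card_univ, one_pow, mul_one]
  exact (Nat.choose_le_pow _ _).trans (Nat.le_mul_of_pos_right _
    (Nat.choose_pos (Nat.lt_succ_iff.1 (mem_range.1 hk))))

/-- A set is determined by the orbits it contains, its entry points and its exit points. -/
lemma subset_of_boundary_eq {q : Perm α} {W W' : Finset α}
    (hV : W.filter (fun x => orb q x ⊆ W) = W'.filter (fun x => orb q x ⊆ W'))
    (hE : W.filter (fun z => q⁻¹ z ∉ W) = W'.filter (fun z => q⁻¹ z ∉ W'))
    (hF : W.filter (fun z => q z ∉ W) = W'.filter (fun z => q z ∉ W')) : W ⊆ W' := by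
  intro x hx
  by_cases hxV : orb q x ⊆ W
  · have : x ∈ W.filter (fun x => orb q x ⊆ W) := mem_filter.2 ⟨hx, hxV⟩
    rw [hV] at this
    exact (mem_filter.1 this).1
  · have hback : ∃ k : ℕ, (q⁻¹ ^ k) x ∉ W := by
      by_contra! h
      apply hxV
      intro y hy
      obtain ⟨i, hi, hiy⟩ := exists_pow_of_mem_orb (mem_orb_comm.1 hy)
      rw [← hiy] at h
      have := h i
      rw [← mul_apply, inv_pow, inv_mul_cancel, one_apply] at this
      exact this
    classical
    have hspec := Nat.find_spec hback
    have hmin : ∀ j < Nat.find hback, (q⁻¹ ^ j) x ∈ W := fun j hj => by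
      have := Nat.find_min hback hj; push Not at this; exact this
    obtain ⟨k, hk⟩ : ∃ k, Nat.find hback = k + 1 := Nat.exists_eq_succ_of_ne_zero fun h0 => by
      rw [h0] at hspec; exact hspec (by simpa using hx)
    rw [hk] at hspec hmin
    have claim : ∀ j ≤ k, (q⁻¹ ^ (k - j)) x ∈ W' := by
      intro j
      induction j with
      | zero =>
        intro _
        have : (q⁻¹ ^ k) x ∈ W.filter (fun z => q⁻¹ z ∉ W) := mem_filter.2
          ⟨hmin k (Nat.lt_succ_self k), by rwa [pow_succ', mul_apply] at hspec⟩
        rw [hE] at this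
        exact (mem_filter.1 this).1
      | succ j ih =>
        intro hj
        have h1 := ih (by omega)
        have h2 : q ((q⁻¹ ^ (k - j)) x) = (q⁻¹ ^ (k - (j + 1))) x := by
          rw [show k - j = (k - (j + 1)) + 1 by omega, pow_succ', mul_apply]; simp
        by_contra hc
        have h3 : (q⁻¹ ^ (k - j)) x ∈ W'.filter (fun z => q z ∉ W') :=
          mem_filter.2 ⟨h1, by rwa [h2]⟩
        rw [← hF, mem_filter, h2] at h3
        exact h3.2 (hmin _ (by omega))
    simpa using claim k le_rfl

lemma card_nearSets_le (q : Perm α) {z : ℝ} (hz : 0 < z) (hz1 : z ≤ 1) (h L : ℕ) :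
    ((nearSets q h L).card : ℝ) * z ^ L ≤
      ((Fintype.card α + 1 : ℕ) : ℝ) ^ (2 * h) * invGen q z := by
  set S := (univ : Finset (Finset α)).filter (fun E => E.card ≤ h) with hS
  set φ : Finset α → Finset α × (Finset α × Finset α) := fun W =>
    (W.filter (fun x => orb q x ⊆ W), (W.filter (fun z => q⁻¹ z ∉ W), W.filter (fun z => q z ∉ W)))
    with hφ
  have hinj : Set.InjOn φ (nearSets q h L) := by
    intro W _ W' _ h
    simp only [hφ, Prod.mk.injEq] at h
    exact (subset_of_boundary_eq h.1 h.2.1 h.2.2).antisymm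
      (subset_of_boundary_eq h.1.symm h.2.1.symm h.2.2.symm)
  calc ((nearSets q h L).card : ℝ) * z ^ L = ∑ W ∈ nearSets q h L, z ^ L := by
        rw [sum_const, nsmul_eq_mul]
    _ ≤ ∑ W ∈ nearSets q h L, z ^ (φ W).1.card := by
        refine sum_le_sum fun W hW => pow_le_pow_of_le_one hz.le hz1 ?_
        rw [← (mem_filter.1 hW).2.1]
        exact card_filter_le _ _
    _ = ∑ t ∈ (nearSets q h L).image φ, z ^ t.1.card := by rw [sum_image hinj]
    _ ≤ ∑ t ∈ invSets q ×ˢ (S ×ˢ S), z ^ t.1.card := by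
        refine sum_le_sum_of_subset_of_nonneg ?_ fun _ _ _ => by positivity
        intro t ht
        obtain ⟨W, hW, rfl⟩ := mem_image.1 ht
        have hW2 := (mem_filter.1 hW).2.2
        refine mem_product.2 ⟨mem_invSets.2 fun x hx => ?_, mem_product.2
          ⟨mem_filter.2 ⟨mem_univ _, hW2⟩, mem_filter.2 ⟨mem_univ _, by
            simp only [hφ]; rwa [card_exit_eq]⟩⟩⟩
        obtain ⟨-, h2⟩ := mem_filter.1 hx
        have h3 : q x ∈ orb q x := apply_mem_orb.2 (self_mem_orb q x)
        exact mem_filter.2 ⟨h2 h3, by rwa [orb_eq_of_mem h3]⟩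
    _ = ((S.card : ℝ) * S.card) * invGen q z := by
        rw [sum_product]
        simp only [sum_const, card_product, nsmul_eq_mul]
        rw [← mul_sum, invGen]; push_cast; ring
    _ ≤ _ := by
        have h1 : (S.card : ℝ) ≤ ((Fintype.card α + 1 : ℕ) : ℝ) ^ h := by
          exact_mod_cast card_filter_card_le (α := α) h
        have h0 := invGen_nonneg q hz.le
        rw [two_mul, pow_add]
        gcongr

lemma succ_pow_le_exp_mul_pow (n : ℕ) : ((n + 1 : ℕ) : ℝ) ^ n ≤ Real.exp 1 * (n : ℝ) ^ n := by
  rcases Nat.eq_zero_or_pos n with rfl | hn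
  · simp
  have hnR : (0 : ℝ) < n := by exact_mod_cast hn
  have h : (1 + 1 / (n : ℝ)) ^ n ≤ Real.exp 1 := by
    calc (1 + 1 / (n : ℝ)) ^ n ≤ Real.exp (1 / n) ^ n := by
          gcongr
          have := Real.add_one_le_exp (1 / (n : ℝ))
          linarith
      _ = Real.exp 1 := by rw [← Real.exp_nat_mul]; congr 1; field_simp
  calc ((n + 1 : ℕ) : ℝ) ^ n = (1 + 1 / (n : ℝ)) ^ n * (n : ℝ) ^ n := by
        rw [← mul_pow]; congr 1; push_cast; field_simp
    _ ≤ _ := by gcongr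

lemma exp_mul_pow_le_succ_pow (n : ℕ) : Real.exp 1 * (n : ℝ) ^ (n + 1) ≤ ((n + 1 : ℕ) : ℝ) ^ (n + 1) := by
  rcases Nat.eq_zero_or_pos n with rfl | hn
  · simp
  have hnR : (0 : ℝ) < n := by exact_mod_cast hn
  have h : (n : ℝ) / (n + 1) ≤ Real.exp (-(1 / (n + 1))) := by
    have := Real.add_one_le_exp (-(1 / ((n : ℝ) + 1)))
    refine le_trans (le_of_eq ?_) this
    field_simp; ring
  have h2 : ((n : ℝ) / (n + 1)) ^ (n + 1) ≤ Real.exp (-1) := by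
    calc ((n : ℝ) / (n + 1)) ^ (n + 1) ≤ Real.exp (-(1 / (n + 1))) ^ (n + 1) := by gcongr
      _ = Real.exp (-1) := by
        rw [← Real.exp_nat_mul]; congr 1; push_cast; field_simp
  calc Real.exp 1 * (n : ℝ) ^ (n + 1)
      = Real.exp 1 * (((n : ℝ) / (n + 1)) ^ (n + 1) * ((n : ℝ) + 1) ^ (n + 1)) := by
        rw [← mul_pow]; congr 2; field_simp
    _ ≤ Real.exp 1 * (Real.exp (-1) * ((n : ℝ) + 1) ^ (n + 1)) := by gcongr
    _ = _ := by rw [← mul_assoc, ← Real.exp_add]; simp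

lemma factorial_mul_exp_le {L : ℕ} (hL : 1 ≤ L) :
    (L.factorial : ℝ) * Real.exp L ≤ Real.exp 1 * L * (L : ℝ) ^ L := by
  induction L, hL using Nat.le_induction with
  | base => simp
  | succ n hn ih =>
    have h1 := exp_mul_pow_le_succ_pow n
    rw [Nat.factorial_succ]
    push_cast at *
    rw [Real.exp_add]
    calc ((n : ℝ) + 1) * n.factorial * (Real.exp n * Real.exp 1)
        = (n + 1) * Real.exp 1 * (n.factorial * Real.exp n) := by ring
      _ ≤ (n + 1) * Real.exp 1 * (Real.exp 1 * n * (n : ℝ) ^ n) := by gcongr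
      _ = (n + 1) * Real.exp 1 * (Real.exp 1 * (n : ℝ) ^ (n + 1)) := by ring
      _ ≤ (n + 1) * Real.exp 1 * (((n : ℝ) + 1) ^ (n + 1)) := by gcongr
      _ = _ := by ring

lemma factorial_mul_exp_mono {m n : ℕ} (h : m ≤ n) :
    (m.factorial : ℝ) * Real.exp m * (n : ℝ) ^ n ≤ n.factorial * Real.exp n * (m : ℝ) ^ m := by
  induction n, h using Nat.le_induction with
  | base => rfl
  | succ n hn ih =>
    have h1 := succ_pow_le_exp_mul_pow n
    rw [Nat.factorial_succ]
    push_cast at *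
    rw [Real.exp_add]
    calc (m.factorial : ℝ) * Real.exp m * ((n : ℝ) + 1) ^ (n + 1)
        = (n + 1) * (m.factorial * Real.exp m * ((n : ℝ) + 1) ^ n) := by ring
      _ ≤ (n + 1) * (m.factorial * Real.exp m * (Real.exp 1 * (n : ℝ) ^ n)) := by gcongr
      _ = (n + 1) * Real.exp 1 * (m.factorial * Real.exp m * (n : ℝ) ^ n) := by ring
      _ ≤ (n + 1) * Real.exp 1 * (n.factorial * Real.exp n * (m : ℝ) ^ m) := by gcongr
      _ = _ := by ring

lemma pow_self_le_choose {n L : ℕ} (hL : 1 ≤ L) (hLn : L ≤ n) :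
    (n : ℝ) ^ n ≤ Real.exp 1 * L * n.choose L * ((L : ℝ) ^ L * ((n - L : ℕ) : ℝ) ^ (n - L)) := by
  have h1 := factorial_mul_exp_le hL
  have h2 := factorial_mul_exp_mono (Nat.sub_le n L)
  have h3 : (n.choose L : ℝ) * L.factorial * (n - L).factorial = n.factorial := by
    exact_mod_cast Nat.choose_mul_factorial_mul_factorial hLn
  have h4 : Real.exp n = Real.exp (n - L : ℕ) * Real.exp L := by
    rw [← Real.exp_add]; congr 1; push_cast [hLn]; ring
  rw [h4, ← h3] at h2
  have h5 : (0 : ℝ) < (n - L).factorial * Real.exp (n - L : ℕ) := by positivity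
  have h6 : (n : ℝ) ^ n ≤ n.choose L * (L.factorial * Real.exp L) * ((n - L : ℕ) : ℝ) ^ (n - L) := by
    refine le_of_mul_le_mul_left (h2.trans (le_of_eq ?_)) h5
    ring
  refine h6.trans ?_
  calc _ ≤ (n.choose L : ℝ) * (Real.exp 1 * L * (L : ℝ) ^ L) * ((n - L : ℕ) : ℝ) ^ (n - L) := by gcongr
    _ = _ := by ring

lemma one_add_pow_le_choose {n L : ℕ} (hL : 1 ≤ L) (hLn : L < n) :
    (1 + (L : ℝ) / (n - L)) ^ n ≤ Real.exp 1 * L * n.choose L * ((L : ℝ) / (n - L)) ^ L := by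
  have h := pow_self_le_choose hL hLn.le
  push_cast [hLn.le] at h
  have hpos : (0 : ℝ) < n - L := by have : (L : ℝ) < n := by exact_mod_cast hLn
                                    linarith
  have h1 : 1 + (L : ℝ) / (n - L) = n / (n - L) := by field_simp; ring
  rw [h1, div_pow, div_pow, div_le_iff₀ (by positivity)]
  refine h.trans (le_of_eq ?_)
  have h2 : ((n : ℝ) - L) ^ n = (n - L) ^ L * (n - L) ^ (n - L) := by
    rw [← pow_add]; congr 1; omega
  rw [h2]
  field_simp

lemma exp_half_le_one_add {x : ℝ} (h0 : 0 ≤ x) (h1 : x ≤ 1) : Real.exp (x / 2) ≤ 1 + x := by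
  have h : 1 - x / 2 ≤ Real.exp (-(x / 2)) := by
    have := Real.add_one_le_exp (-(x / 2)); linarith
  rw [Real.exp_neg] at h
  have hp := Real.exp_pos (x / 2)
  have h2 : (1 - x / 2) * Real.exp (x / 2) ≤ 1 := by
    have := mul_le_mul_of_nonneg_right h hp.le
    rwa [inv_mul_cancel₀ hp.ne'] at this
  nlinarith

lemma one_add_pow_le_exp {x : ℝ} (h0 : 0 ≤ x) (k : ℕ) : (1 + x) ^ k ≤ Real.exp (k * x) := by
  rw [Real.exp_nat_mul]
  have := Real.add_one_le_exp x
  gcongr; linarith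

lemma natCast_le_mul_exp {c : ℝ} (hc : 0 < c) (L : ℝ) : L ≤ 1 / c * Real.exp (c * L) := by
  rw [div_mul_eq_mul_div, le_div_iff₀ hc, one_mul]
  have := Real.add_one_le_exp (c * L)
  linarith

/-- Joint exponential bound for the invariant sets of two permutations, relative to the
number of subsets of the same size. -/
def CoreBound (q q' : Perm α) (A c : ℝ) : Prop :=
  ∀ L : ℕ, 1 ≤ L → 2 * L ≤ Fintype.card α → ∃ z z' : ℝ, 0 < z ∧ z ≤ 1 ∧ 0 < z' ∧ z' ≤ 1 ∧
    z ^ 3 * Fintype.card α ≤ A * L ^ 3 ∧ z' ^ 3 * Fintype.card α ≤ A * L ^ 3 ∧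
    invGen q z * invGen q' z' ≤
      A * Real.exp (-(c * L)) * (Fintype.card α).choose L * (z * z') ^ L

lemma core_balanced {q q' : Perm α} {δ : ℝ} (hδ : 0 < δ)
    (h2 : (numOrb q 2 + numOrb q' 2 : ℝ) ≤ (1 - δ) * Fintype.card α) {L : ℕ} (hL : 1 ≤ L)
    (hLn : 2 * L ≤ Fintype.card α)
    (h1 : (numOrb q 1 + numOrb q' 1 : ℝ) ^ 2 * (24 / δ) ^ 2 ≤ L * Fintype.card α) :
    ∃ z : ℝ, 0 < z ∧ z ≤ 1 ∧ z ^ 3 * Fintype.card α ≤ 2 * L ^ 3 ∧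
    invGen q z * invGen q' z ≤ (24 * Real.exp 1 / δ) * Real.exp (-(δ / 24 * L)) *
      (Fintype.card α).choose L * (z * z) ^ L := by
  set n := Fintype.card α with hn
  have hLR : (1 : ℝ) ≤ L := by exact_mod_cast hL
  have hLnR : 2 * (L : ℝ) ≤ n := by exact_mod_cast hLn
  have hnL : (0 : ℝ) < n - L := by linarith
  set x : ℝ := L / (n - L) with hx
  have hx0 : 0 < x := by positivity
  have hx1 : x ≤ 1 := by rw [hx, div_le_one hnL]; linarith
  have hxl : L ≤ n * x := by
    rw [hx, mul_div_assoc', le_div_iff₀ hnL]; nlinarith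
  have hxu : n * x ≤ 2 * L := by
    rw [hx, mul_div_assoc', div_le_iff₀ hnL]; nlinarith
  set u := Real.sqrt x with hu
  have hu0 : 0 < u := Real.sqrt_pos.2 hx0
  have hu1 : u ≤ 1 := Real.sqrt_le_one.2 hx1
  have hu2 : u ^ 2 = x := Real.sq_sqrt hx0.le
  refine ⟨u, hu0, hu1, ?_, ?_⟩
  · calc u ^ 3 * n = u * (n * x) := by rw [← hu2]; ring
      _ ≤ 1 * (2 * L) := by gcongr
      _ ≤ 2 * L ^ 3 := by nlinarith [sq_nonneg ((L : ℝ) - 1), mul_pos (by linarith : (0:ℝ) < L) (by linarith : (0:ℝ) < L)]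
  set a : ℝ := numOrb q 1 + numOrb q' 1 with ha
  have ha0 : 0 ≤ a := by positivity
  set N := numOrb q 2 + numBig q + (numOrb q' 2 + numBig q') with hN
  have hNn : (N : ℝ) ≤ n - δ / 3 * n := by
    have e1 : (numOrb q 1 + 2 * numOrb q 2 + 3 * numBig q : ℝ) ≤ n := by
      exact_mod_cast numOrb_add_le q
    have e2 : (numOrb q' 1 + 2 * numOrb q' 2 + 3 * numBig q' : ℝ) ≤ n := by
      exact_mod_cast numOrb_add_le q'
    have e3 : (N : ℝ) = numOrb q 2 + numBig q + (numOrb q' 2 + numBig q') := by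
      rw [hN]; push_cast; ring
    linarith
  have hau : a * u ≤ δ / 12 * L := by
    have e1 : (a * (24 / δ)) ^ 2 * u ^ 2 ≤ 2 * L ^ 2 := by
      calc (a * (24 / δ)) ^ 2 * u ^ 2 = a ^ 2 * (24 / δ) ^ 2 * x := by rw [hu2]; ring
        _ ≤ L * n * x := by gcongr
        _ = L * (n * x) := by ring
        _ ≤ L * (2 * L) := by gcongr
        _ = _ := by ring
    have e2 : a * (24 / δ) * u ≤ 2 * L := by
      refine abs_le_of_sq_le_sq' ?_ (by positivity) |>.2
      nlinarith [sq_nonneg (L : ℝ)]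
    have e3 : a * u * 24 ≤ 2 * L * δ := by
      have := mul_le_mul_of_nonneg_right e2 hδ.le
      calc a * u * 24 = a * (24 / δ) * u * δ := by field_simp
        _ ≤ _ := this
    linarith
  have key : invGen q u * invGen q' u ≤ Real.exp (a * u) * (1 + x) ^ N := by
    have f : ∀ r : Perm α, invGen r u ≤ Real.exp (numOrb r 1 * u) *
        (1 + x) ^ (numOrb r 2 + numBig r) := by
      intro r
      refine (invGen_le r hu0.le hu1).trans ?_
      rw [pow_add, hu2]
      have e1 := one_add_pow_le_exp hu0.le (numOrb r 1)
      have e2 : u ^ 3 ≤ x := by rw [← hu2]; exact pow_le_pow_of_le_one hu0.le hu1 (by norm_num)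
      gcongr
    calc _ ≤ _ := mul_le_mul (f q) (f q') (invGen_nonneg _ hu0.le) (by positivity)
      _ = _ := by rw [hN, pow_add (1 + x) _ (numOrb q' 2 + _), ha, add_mul, Real.exp_add]; ring
  have hNle : N ≤ n := by
    have : (N : ℝ) ≤ n := hNn.trans (by nlinarith)
    exact_mod_cast this
  have hbig : Real.exp (δ / 6 * L) ≤ (1 + x) ^ (n - N) := by
    calc Real.exp (δ / 6 * L) ≤ Real.exp ((n - N : ℕ) * (x / 2)) := by
          refine Real.exp_le_exp.2 ?_
          push_cast [hNle]
          have : δ / 3 * n * (x / 2) ≤ ((n : ℝ) - N) * (x / 2) := by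
            gcongr; linarith
          nlinarith
      _ = Real.exp (x / 2) ^ (n - N) := Real.exp_nat_mul _ _
      _ ≤ _ := by gcongr; exact exp_half_le_one_add hx0.le hx1
  have hch := one_add_pow_le_choose hL (by omega : L < n)
  rw [← hx] at hch
  have h7 : (1 + x) ^ N * Real.exp (δ / 6 * L) ≤ Real.exp 1 * L * n.choose L * x ^ L := by
    refine le_trans ?_ hch
    calc _ ≤ (1 + x) ^ N * (1 + x) ^ (n - N) := by gcongr
      _ = (1 + x) ^ n := by rw [← pow_add]; congr 1; omega
  have h8 : (1 + x) ^ N ≤ Real.exp 1 * L * n.choose L * x ^ L * Real.exp (-(δ / 6 * L)) := by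
    rw [Real.exp_neg, ← div_eq_mul_inv, le_div_iff₀ (Real.exp_pos _)]
    exact h7
  calc _ ≤ Real.exp (a * u) * (1 + x) ^ N := key
    _ ≤ Real.exp (δ / 12 * L) *
        (Real.exp 1 * L * n.choose L * x ^ L * Real.exp (-(δ / 6 * L))) := by gcongr
    _ ≤ Real.exp (δ / 12 * L) * (Real.exp 1 * (1 / (δ / 24) * Real.exp (δ / 24 * L)) *
          n.choose L * x ^ L * Real.exp (-(δ / 6 * L))) := by
        gcongr
        exact natCast_le_mul_exp (by positivity) _
    _ = 24 * Real.exp 1 / δ * (Real.exp (δ / 12 * L) * Real.exp (δ / 24 * L) *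
          Real.exp (-(δ / 6 * L))) * n.choose L * x ^ L := by field_simp
    _ = _ := by
        rw [← Real.exp_add, ← Real.exp_add, ← sq, hu2]
        congr 4; ring

/-- The regime dominated by the fixed points of `q`. -/
lemma core_lopsided {q q' : Perm α} {M K B : ℝ} (hM : 0 < M) (hB : 8 ≤ B)
    (hBM : 8 * M ≤ B) (hn : B ^ 3 ≤ Fintype.card α)
    (h11 : (numOrb q 1 * numOrb q' 1 : ℝ) ≤ K * Fintype.card α)
    (h12 : (numOrb q 1 ^ 2 * numOrb q' 2 : ℝ) ≤ K ^ 2 * Fintype.card α ^ 2)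
    (h13 : (numOrb q 1 : ℝ) ^ 3 ≤ Fintype.card α ^ 2) {L : ℕ} (hL : 1 ≤ L)
    (hLn : 2 * L ≤ Fintype.card α)
    (h1 : (L * Fintype.card α : ℝ) ≤ 4 * numOrb q 1 ^ 2 * M ^ 2) :
    ∃ z z' : ℝ, 0 < z ∧ z ≤ 1 ∧ 0 < z' ∧ z' ≤ 1 ∧
    z ^ 3 * Fintype.card α ≤ B ^ 3 * L ^ 3 ∧ z' ^ 3 * Fintype.card α ≤ B ^ 3 * L ^ 3 ∧
    invGen q z * invGen q' z' ≤ 4 * Real.exp (1 + (B * K + B ^ 2 * K ^ 2 + B ^ 3)) *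
      Real.exp (-(1 / 4 * L)) * (Fintype.card α).choose L * (z * z') ^ L := by
  set n := Fintype.card α with hnd
  have hLR : (1 : ℝ) ≤ L := by exact_mod_cast hL
  have hLnR : 2 * (L : ℝ) ≤ n := by exact_mod_cast hLn
  have hnL : (0 : ℝ) < n - L := by linarith
  have hn0 : (0 : ℝ) < n := by linarith
  set x : ℝ := L / (n - L) with hx
  have hx0 : 0 < x := by positivity
  have hxu : n * x ≤ 2 * L := by
    rw [hx, mul_div_assoc', div_le_iff₀ hnL]; nlinarith
  set a : ℝ := ((numOrb q 1 : ℕ) : ℝ) with ha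
  have ha0 : 0 < a := by
    rcases (Nat.cast_nonneg (numOrb q 1) : (0 : ℝ) ≤ _).eq_or_lt with h | h
    · rw [ha, ← h] at h1
      have : (0 : ℝ) < L * n := by positivity
      norm_num at h1; linarith
    · exact h
  have hB0 : 0 < B := by linarith
  set z' : ℝ := B * a / n with hz'
  have hz'0 : 0 < z' := by positivity
  have hz'1 : z' ≤ 1 := by
    rw [hz', div_le_one hn0]
    have : (B * a) ^ 3 ≤ (n : ℝ) ^ 3 := by
      calc (B * a) ^ 3 = B ^ 3 * a ^ 3 := by ring
        _ ≤ (n : ℝ) * (n : ℝ) ^ 2 := by gcongr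
        _ = _ := by ring
    exact le_of_pow_le_pow_left₀ (by norm_num) hn0.le this
  set z : ℝ := x / z' with hz
  have hz0 : 0 < z := by positivity
  have hzz : z * z' = x := by rw [hz]; field_simp
  have haz : a * z ≤ 1 / 4 * L := by
    have : a * z = n * x / B := by rw [hz, hz']; field_simp
    rw [this, div_le_iff₀ hB0]
    nlinarith
  have hnz : n * z ^ 2 ≤ 1 / 4 * L := by
    have e1 : (n * z ^ 2) * (B ^ 2 * a ^ 2) = n * (n * x) ^ 2 := by rw [hz, hz']; field_simp
    have e2 : n * (n * x) ^ 2 ≤ n * (2 * L) ^ 2 := by gcongr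
    have e3 : (n : ℝ) * (2 * L) ^ 2 ≤ 4 * L * (4 * a ^ 2 * M ^ 2) := by
      calc (n : ℝ) * (2 * L) ^ 2 = 4 * L * (L * n) := by ring
        _ ≤ _ := by gcongr
    have e4 : 4 * L * (4 * a ^ 2 * M ^ 2) ≤ 1 / 4 * L * (B ^ 2 * a ^ 2) := by
      have : (8 * M) ^ 2 ≤ B ^ 2 := by gcongr
      have : (L * a ^ 2) * (8 * M) ^ 2 ≤ L * a ^ 2 * B ^ 2 := by gcongr
      linarith
    refine le_of_mul_le_mul_right ?_ (by positivity : 0 < B ^ 2 * a ^ 2)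
    linarith
  have hz1 : z ≤ 1 := by
    have : n * z ^ 2 ≤ n * 1 := by linarith
    have := le_of_mul_le_mul_left this hn0
    exact (sq_le_one_iff₀ hz0.le).1 this
  have g : ∀ r : Perm α, ∀ y : ℝ, 0 < y → y ≤ 1 → invGen r y ≤ Real.exp (numOrb r 1 * y +
      (numOrb r 2 * y ^ 2 + numBig r * y ^ 3)) := by
    intro r y hy hy1
    refine (invGen_le r hy.le hy1).trans ?_
    rw [Real.exp_add, Real.exp_add]
    have e1 := one_add_pow_le_exp hy.le (numOrb r 1)
    have e2 := one_add_pow_le_exp (x := y ^ 2) (by positivity) (numOrb r 2)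
    have e3 := one_add_pow_le_exp (x := y ^ 3) (by positivity) (numBig r)
    gcongr
  have hr : ∀ r : Perm α, (numOrb r 2 + numBig r : ℝ) ≤ n := by
    intro r
    have := numOrb_add_le r
    have : numOrb r 2 + numBig r ≤ n := by omega
    exact_mod_cast this
  have g1 : invGen q z ≤ Real.exp (1 / 2 * L) := by
    refine (g q z hz0 hz1).trans (Real.exp_le_exp.2 ?_)
    have e1 : z ^ 3 ≤ z ^ 2 := pow_le_pow_of_le_one hz0.le hz1 (by norm_num)
    have e2 : (numOrb q 2 * z ^ 2 + numBig q * z ^ 3 : ℝ) ≤ n * z ^ 2 := by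
      calc _ ≤ (numOrb q 2 * z ^ 2 + numBig q * z ^ 2 : ℝ) := by gcongr
        _ = (numOrb q 2 + numBig q : ℝ) * z ^ 2 := by ring
        _ ≤ _ := by gcongr; exact hr q
    linarith
  have hz'3 : n * z' ^ 3 ≤ B ^ 3 := by
    have : n * z' ^ 3 = B ^ 3 * (a ^ 3 / n ^ 2) := by rw [hz']; field_simp
    rw [this]
    have : a ^ 3 / (n : ℝ) ^ 2 ≤ 1 := by rw [div_le_one (by positivity)]; exact h13
    exact mul_le_of_le_one_right (by positivity) this
  have g2 : invGen q' z' ≤ Real.exp (B * K + B ^ 2 * K ^ 2 + B ^ 3) := by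
    refine (g q' z' hz'0 hz'1).trans (Real.exp_le_exp.2 ?_)
    have e1 : numOrb q' 1 * z' ≤ B * K := by
      have : numOrb q' 1 * z' = B * (a * numOrb q' 1 / n) := by rw [hz']; ring
      rw [this]; gcongr; rwa [div_le_iff₀ hn0]
    have e2 : numOrb q' 2 * z' ^ 2 ≤ B ^ 2 * K ^ 2 := by
      have : numOrb q' 2 * z' ^ 2 = B ^ 2 * (a ^ 2 * numOrb q' 2 / n ^ 2) := by rw [hz']; ring
      rw [this]; gcongr; rwa [div_le_iff₀ (by positivity)]
    have e3 : numBig q' * z' ^ 3 ≤ n * z' ^ 3 := by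
      have := hr q'
      have h0 : (0 : ℝ) ≤ numOrb q' 2 := Nat.cast_nonneg _
      exact mul_le_mul_of_nonneg_right (by linarith) (by positivity)
    linarith
  have hL3 : (1 : ℝ) ≤ L ^ 3 := one_le_pow₀ hLR
  have hLL3 : (L : ℝ) ≤ L ^ 3 := le_self_pow₀ hLR (by norm_num)
  refine ⟨z, z', hz0, hz1, hz'0, hz'1, ?_, ?_, ?_⟩
  · have hB3 : 1 ≤ B ^ 3 := one_le_pow₀ (by linarith)
    calc z ^ 3 * n ≤ z ^ 2 * n := by
          gcongr ?_ * _; exact pow_le_pow_of_le_one hz0.le hz1 (by norm_num)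
      _ ≤ 1 * (L : ℝ) ^ 3 := by linarith
      _ ≤ _ := by gcongr
  · calc z' ^ 3 * n ≤ B ^ 3 * 1 := by linarith
      _ ≤ _ := by gcongr
  have hch := one_add_pow_le_choose hL (by omega : L < n)
  rw [← hx] at hch
  have hexp : Real.exp L ≤ (1 + x) ^ n := by
    have : Real.exp (L / n) ≤ 1 + x := by
      have e1 : 1 - (L : ℝ) / n ≤ Real.exp (-(L / n)) := by
        have := Real.add_one_le_exp (-((L : ℝ) / n)); linarith
      rw [Real.exp_neg, le_inv_comm₀ (by rw [sub_pos, div_lt_one hn0]; linarith)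
        (Real.exp_pos _)] at e1
      refine e1.trans (le_of_eq ?_)
      rw [hx]; field_simp; ring
    calc Real.exp L = Real.exp (L / n) ^ n := by
          rw [← Real.exp_nat_mul]; congr 1; field_simp
      _ ≤ _ := by gcongr
  set E := B * K + B ^ 2 * K ^ 2 + B ^ 3 with hE
  have h9 : 1 ≤ Real.exp (-(L : ℝ)) * (Real.exp 1 * L * n.choose L * x ^ L) := by
    rw [Real.exp_neg, ← div_eq_inv_mul, le_div_iff₀ (Real.exp_pos _), one_mul]
    exact hexp.trans hch
  calc _ ≤ Real.exp (1 / 2 * L) * Real.exp E * 1 := by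
        rw [mul_one]; exact mul_le_mul g1 g2 (invGen_nonneg _ hz'0.le) (Real.exp_nonneg _)
    _ ≤ Real.exp (1 / 2 * L) * Real.exp E *
        (Real.exp (-(L : ℝ)) * (Real.exp 1 * (1 / (1 / 4) * Real.exp (1 / 4 * L)) *
          n.choose L * x ^ L)) := by
        refine mul_le_mul_of_nonneg_left (h9.trans ?_) (by positivity)
        gcongr
        exact natCast_le_mul_exp (by norm_num) _
    _ = 4 * (Real.exp 1 * Real.exp E) * (Real.exp (1 / 2 * L) * Real.exp (-(L : ℝ)) *
          Real.exp (1 / 4 * L)) * n.choose L * x ^ L := by ring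
    _ = _ := by
        rw [← Real.exp_add, ← Real.exp_add, ← Real.exp_add, hzz]
        congr 4; ring

/-- The constant used to bound the counting functions of invariant sets. -/
noncomputable def coreConst (δ K : ℝ) : ℝ :=
  2 + 24 * Real.exp 1 / δ + (8 * (24 / δ)) ^ 3 +
    4 * Real.exp (1 + ((8 * (24 / δ)) * K + (8 * (24 / δ)) ^ 2 * K ^ 2 + (8 * (24 / δ)) ^ 3))

lemma coreConst_pos {δ : ℝ} (hδ : 0 < δ) (K : ℝ) : 0 < coreConst δ K := by
  unfold coreConst; positivity

lemma coreBound_of {q q' : Perm α} {δ K : ℝ} (hδ : 0 < δ) (hδ1 : δ ≤ 1)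
    (hn : (8 * (24 / δ)) ^ 3 ≤ Fintype.card α)
    (h2 : (numOrb q 2 + numOrb q' 2 : ℝ) ≤ (1 - δ) * Fintype.card α)
    (h11 : (numOrb q 1 * numOrb q' 1 : ℝ) ≤ K * Fintype.card α)
    (h12 : (numOrb q 1 : ℝ) ^ 2 * numOrb q' 2 ≤ K ^ 2 * (Fintype.card α : ℝ) ^ 2)
    (h21 : (numOrb q' 1 : ℝ) ^ 2 * numOrb q 2 ≤ K ^ 2 * (Fintype.card α : ℝ) ^ 2)
    (h13 : (numOrb q 1 : ℝ) ^ 3 ≤ (Fintype.card α : ℝ) ^ 2)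
    (h31 : (numOrb q' 1 : ℝ) ^ 3 ≤ (Fintype.card α : ℝ) ^ 2) :
    CoreBound q q' (coreConst δ K) (δ / 24) := by
  intro L hL hLn
  have hM : (24 : ℝ) ≤ 24 / δ := by rw [le_div_iff₀ hδ]; nlinarith
  have hM0 : (0 : ℝ) < 24 / δ := by linarith
  have hL0 : (0 : ℝ) ≤ L := Nat.cast_nonneg L
  have hL3 : (0 : ℝ) ≤ (L : ℝ) ^ 3 := by positivity
  have t1 : (0 : ℝ) ≤ 24 * Real.exp 1 / δ := by positivity
  have t2 : (0 : ℝ) ≤ (8 * (24 / δ)) ^ 3 := by positivity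
  have t3 : (0 : ℝ) ≤ 4 * Real.exp (1 + ((8 * (24 / δ)) * K + (8 * (24 / δ)) ^ 2 * K ^ 2 +
    (8 * (24 / δ)) ^ 3)) := by positivity
  have a1 : 2 ≤ coreConst δ K := by unfold coreConst; linarith
  have a2 : 24 * Real.exp 1 / δ ≤ coreConst δ K := by unfold coreConst; linarith
  have a3 : (8 * (24 / δ)) ^ 3 ≤ coreConst δ K := by unfold coreConst; linarith
  have a4 : 4 * Real.exp (1 + ((8 * (24 / δ)) * K + (8 * (24 / δ)) ^ 2 * K ^ 2 +
    (8 * (24 / δ)) ^ 3)) ≤ coreConst δ K := by unfold coreConst; linarith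
  have hexp : Real.exp (-(1 / 4 * (L : ℝ))) ≤ Real.exp (-(δ / 24 * L)) := by
    apply Real.exp_le_exp.2
    have : δ / 24 * L ≤ 1 / 4 * L := by gcongr; linarith
    linarith
  by_cases hb : (numOrb q 1 + numOrb q' 1 : ℝ) ^ 2 * (24 / δ) ^ 2 ≤ L * Fintype.card α
  · obtain ⟨z, hz, hz1, hz3, h⟩ := core_balanced hδ h2 hL hLn hb
    refine ⟨z, z, hz, hz1, hz, hz1, hz3.trans (by gcongr), hz3.trans (by gcongr), h.trans ?_⟩
    gcongr
  push Not at hb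
  rcases le_total (numOrb q' 1) (numOrb q 1) with hle | hle
  · have hle' : (numOrb q' 1 : ℝ) ≤ numOrb q 1 := by exact_mod_cast hle
    obtain ⟨z, z', hz, hz1, hz', hz1', hz3, hz3', h⟩ := core_lopsided (q := q) (q' := q') hM0
      (B := 8 * (24 / δ)) (by linarith) le_rfl hn h11 h12 h13 hL hLn (hb.le.trans (by
        have : (numOrb q 1 + numOrb q' 1 : ℝ) ^ 2 ≤ (2 * numOrb q 1) ^ 2 := by gcongr; linarith
        calc _ ≤ (2 * numOrb q 1 : ℝ) ^ 2 * (24 / δ) ^ 2 := by gcongr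
          _ = _ := by ring))
    refine ⟨z, z', hz, hz1, hz', hz1', hz3.trans (by gcongr), hz3'.trans (by gcongr), h.trans ?_⟩
    gcongr
  · have hle' : (numOrb q 1 : ℝ) ≤ numOrb q' 1 := by exact_mod_cast hle
    obtain ⟨z, z', hz, hz1, hz', hz1', hz3, hz3', h⟩ := core_lopsided (q := q') (q' := q) hM0
      (B := 8 * (24 / δ)) (by linarith) le_rfl hn (by rwa [mul_comm]) h21 h31 hL hLn (hb.le.trans (by
        have : (numOrb q 1 + numOrb q' 1 : ℝ) ^ 2 ≤ (2 * numOrb q' 1) ^ 2 := by gcongr; linarith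
        calc _ ≤ (2 * numOrb q' 1 : ℝ) ^ 2 * (24 / δ) ^ 2 := by gcongr
          _ = _ := by ring))
    refine ⟨z', z, hz', hz1', hz, hz1, hz3'.trans (by gcongr), hz3.trans (by gcongr), ?_⟩
    rw [mul_comm (invGen q z'), mul_comm z' z]
    refine h.trans ?_
    gcongr

section LocalLemma
variable {Ω ι : Type*} [Fintype Ω] [DecidableEq Ω] [DecidableEq ι]

open Classical in
/-- The outcomes avoiding all the events indexed by `S`. -/
noncomputable def avoid (A : ι → Finset Ω) (S : Finset ι) : Finset Ω :=
  univ.filter (fun ω => ∀ j ∈ S, ω ∉ A j)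

lemma mem_avoid {A : ι → Finset Ω} {S : Finset ι} {ω : Ω} :
    ω ∈ avoid A S ↔ ∀ j ∈ S, ω ∉ A j := by simp [avoid]

lemma avoid_anti (A : ι → Finset Ω) {S T : Finset ι} (h : S ⊆ T) : avoid A T ⊆ avoid A S :=
  fun _ hω => mem_avoid.2 fun j hj => mem_avoid.1 hω j (h hj)

lemma card_avoid_insert (A : ι → Finset Ω) (S : Finset ι) (i : ι) :
    ((avoid A (insert i S)).card : ℝ) = (avoid A S).card - (avoid A S ∩ A i).card := by
  have h : avoid A (insert i S) = avoid A S \ A i := by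
    ext ω; simp only [mem_avoid, Finset.mem_sdiff, Finset.mem_insert]; grind
  rw [h, eq_sub_iff_add_eq]
  exact_mod_cast card_sdiff_add_card_inter _ _

/-- A counting version of the lopsided Lovász local lemma. -/
lemma card_inter_avoid_le (A : ι → Finset Ω) (I : Finset ι) (dep : ι → ι → Prop)
    [DecidableRel dep] (P x : ι → ℝ) (hx0 : ∀ i ∈ I, 0 ≤ x i) (hx1 : ∀ i ∈ I, x i ≤ 1)
    (hP : ∀ i ∈ I, ∀ J ⊆ I, (∀ j ∈ J, ¬ dep i j) →
      ((avoid A J ∩ A i).card : ℝ) ≤ P i * (avoid A J).card)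
    (hPx : ∀ i ∈ I, P i ≤ x i * ∏ j ∈ I.filter (dep i), (1 - x j)) :
    ∀ S ⊆ I, ∀ i ∈ I, ((avoid A S ∩ A i).card : ℝ) ≤ x i * (avoid A S).card := by
  intro S
  induction S using Finset.strongInduction with
  | H S ih =>
  intro hS i hi
  have key : ∀ T ⊆ S.filter (dep i), (∏ j ∈ T, (1 - x j)) *
      (avoid A (S.filter (fun j => ¬ dep i j))).card ≤
      (avoid A (T ∪ S.filter (fun j => ¬ dep i j))).card := by
    intro T
    induction T using Finset.induction_on with
    | empty => intro _; simp
    | insert j T hj ihT =>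
      intro hT
      have hjS : j ∈ S.filter (dep i) := hT (mem_insert_self _ _)
      have hjI : j ∈ I := hS (mem_filter.1 hjS).1
      have hTS : T ⊆ S.filter (dep i) := fun a ha => hT (mem_insert_of_mem ha)
      have hlt : T ∪ S.filter (fun j => ¬ dep i j) ⊂ S := by
        rw [Finset.ssubset_iff_of_subset]
        · exact ⟨j, (mem_filter.1 hjS).1, by
            simp [hj, (mem_filter.1 hjS).2]⟩
        · exact union_subset (hTS.trans (filter_subset _ _)) (filter_subset _ _)
      have h1 := ih _ hlt (hlt.1.trans hS) j hjI
      rw [prod_insert hj, insert_union, card_avoid_insert]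
      have h2 := ihT hTS
      have h3 : 0 ≤ 1 - x j := by linarith [hx1 j hjI]
      calc _ = (1 - x j) * ((∏ j ∈ T, (1 - x j)) *
            (avoid A (S.filter (fun j => ¬ dep i j))).card) := by ring
        _ ≤ (1 - x j) * (avoid A (T ∪ S.filter (fun j => ¬ dep i j))).card := by gcongr
        _ ≤ _ := by linarith
  have h4 := key _ subset_rfl
  rw [filter_union_filter_not_eq] at h4
  have h5 : ∏ j ∈ I.filter (dep i), (1 - x j) ≤ ∏ j ∈ S.filter (dep i), (1 - x j) := by
    rw [← prod_sdiff (filter_subset_filter (dep i) hS)]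
    have hnn : 0 ≤ ∏ j ∈ S.filter (dep i), (1 - x j) :=
      prod_nonneg fun j hj => by linarith [hx1 j (hS (mem_filter.1 hj).1)]
    refine mul_le_of_le_one_left hnn (prod_le_one ?_ ?_)
    · intro j hj; linarith [hx1 j (mem_filter.1 (Finset.mem_sdiff.1 hj).1).1]
    · intro j hj; linarith [hx0 j (mem_filter.1 (Finset.mem_sdiff.1 hj).1).1]
  have hsub : avoid A S ∩ A i ⊆ avoid A (S.filter (fun j => ¬ dep i j)) ∩ A i :=
    inter_subset_inter_right (avoid_anti A (filter_subset _ _))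
  calc ((avoid A S ∩ A i).card : ℝ)
      ≤ (avoid A (S.filter (fun j => ¬ dep i j)) ∩ A i).card := by
        exact_mod_cast card_le_card hsub
    _ ≤ P i * (avoid A (S.filter (fun j => ¬ dep i j))).card :=
        hP i hi _ ((filter_subset _ _).trans hS) (fun j hj => (mem_filter.1 hj).2)
    _ ≤ (x i * ∏ j ∈ S.filter (dep i), (1 - x j)) *
        (avoid A (S.filter (fun j => ¬ dep i j))).card := by
        gcongr
        exact (hPx i hi).trans (mul_le_mul_of_nonneg_left h5 (hx0 i hi))
    _ = x i * ((∏ j ∈ S.filter (dep i), (1 - x j)) *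
        (avoid A (S.filter (fun j => ¬ dep i j))).card) := by ring
    _ ≤ _ := mul_le_mul_of_nonneg_left h4 (hx0 i hi)

lemma prod_le_card_avoid (A : ι → Finset Ω) (I : Finset ι) (dep : ι → ι → Prop)
    [DecidableRel dep] (P x : ι → ℝ) (hx0 : ∀ i ∈ I, 0 ≤ x i) (hx1 : ∀ i ∈ I, x i ≤ 1)
    (hP : ∀ i ∈ I, ∀ J ⊆ I, (∀ j ∈ J, ¬ dep i j) →
      ((avoid A J ∩ A i).card : ℝ) ≤ P i * (avoid A J).card)
    (hPx : ∀ i ∈ I, P i ≤ x i * ∏ j ∈ I.filter (dep i), (1 - x j)) :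
    (∏ j ∈ I, (1 - x j)) * Fintype.card Ω ≤ (avoid A I).card := by
  have main := card_inter_avoid_le A I dep P x hx0 hx1 hP hPx
  have key : ∀ T ⊆ I, (∏ j ∈ T, (1 - x j)) * Fintype.card Ω ≤ (avoid A T).card := by
    intro T
    induction T using Finset.induction_on with
    | empty => intro _; simp [avoid]
    | insert j T hj ihT =>
      intro hT
      have hjI : j ∈ I := hT (mem_insert_self _ _)
      have hTS : T ⊆ I := fun a ha => hT (mem_insert_of_mem ha)
      have h1 := main T hTS j hjI
      have h2 := ihT hTS
      have h3 : 0 ≤ 1 - x j := by linarith [hx1 j hjI]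
      rw [prod_insert hj, card_avoid_insert]
      calc _ = (1 - x j) * ((∏ j ∈ T, (1 - x j)) * Fintype.card Ω) := by ring
        _ ≤ (1 - x j) * (avoid A T).card := by gcongr
        _ ≤ _ := by linarith
  exact key I subset_rfl

lemma exp_neg_two_mul_le {x : ℝ} (h0 : 0 ≤ x) (h1 : x ≤ 1 / 2) :
    Real.exp (-(2 * x)) ≤ 1 - x := by
  have h := Real.add_one_le_exp (2 * x)
  rw [Real.exp_neg]
  refine inv_le_of_inv_le₀ (by linarith) ?_
  refine le_trans ?_ h
  rw [inv_le_iff_one_le_mul₀ (by linarith)]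
  nlinarith

lemma exp_le_prod_one_sub (J : Finset ι) (x : ι → ℝ) (h0 : ∀ j ∈ J, 0 ≤ x j)
    (h1 : ∀ j ∈ J, x j ≤ 1 / 2) :
    Real.exp (-(2 * ∑ j ∈ J, x j)) ≤ ∏ j ∈ J, (1 - x j) := by
  rw [mul_sum, ← sum_neg_distrib, Real.exp_sum]
  exact prod_le_prod (fun _ _ => (Real.exp_pos _).le)
    fun j hj => exp_neg_two_mul_le (h0 j hj) (h1 j hj)

end LocalLemma

section NegativeDependency

/-- The event that `σ` maps the first set of the pair onto the second. -/
def mapEvent (i : Finset α × Finset α) : Finset (Perm α) :=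
  univ.filter (fun σ => i.1.image σ = i.2)

lemma mem_mapEvent {i : Finset α × Finset α} {σ : Perm α} :
    σ ∈ mapEvent i ↔ i.1.image σ = i.2 := by simp [mapEvent]

/-- Two sets of equal size are matched by a permutation fixing everything outside their union. -/
lemma exists_perm_image_eq {W W' : Finset α} (h : W.card = W'.card) :
    ∃ τ : Perm α, W.image τ = W' ∧ ∀ y, y ∉ W ∪ W' → τ y = y := by
  let β := {x // x ∈ W ∪ W'}
  have e : {x : β // x.1 ∈ W} ≃ {x : β // x.1 ∈ W'} := by
    refine Fintype.equivOfCardEq ?_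
    rw [Fintype.card_subtype, Fintype.card_subtype]
    have h1 : ∀ V : Finset α, V ⊆ W ∪ W' →
        (univ.filter (fun x : β => x.1 ∈ V)).card = V.card := by
      intro V hV
      refine card_bij (fun x _ => x.1) (fun x hx => (mem_filter.1 hx).2)
        (fun x _ y _ hxy => Subtype.ext hxy) (fun y hy => ⟨⟨y, hV hy⟩, by simp [hy], rfl⟩)
    rw [h1 W subset_union_left, h1 W' subset_union_right, h]
  refine ⟨Perm.ofSubtype e.extendSubtype, ?_, fun y hy => Perm.ofSubtype_apply_of_not_mem _ hy⟩
  refine eq_of_subset_of_card_le ?_ ?_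
  · intro y hy
    obtain ⟨x, hx, rfl⟩ := mem_image.1 hy
    have hxU : x ∈ W ∪ W' := mem_union_left _ hx
    have := e.extendSubtype_mem ⟨x, hxU⟩ hx
    rwa [Perm.ofSubtype_apply_of_mem _ hxU]
  · rw [card_image_of_injective _ (Equiv.injective _), h]

lemma card_avoid_inter_mapEvent_le {i : Finset α × Finset α}
    (J : Finset (Finset α × Finset α))
    (hJ : ∀ j ∈ J, Disjoint j.1 i.1 ∧ Disjoint j.2 i.2) :
    (avoid mapEvent J ∩ mapEvent i).card * (Fintype.card α).choose i.2.card ≤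
      (avoid mapEvent J).card := by
  have hτ : ∀ W' : Finset α, ∃ τ : Perm α, W'.card = i.2.card →
      i.2.image τ = W' ∧ ∀ y, y ∉ i.2 ∪ W' → τ y = y := by
    intro W'
    by_cases h : W'.card = i.2.card
    · obtain ⟨τ, h1⟩ := exists_perm_image_eq h.symm
      exact ⟨τ, fun _ => h1⟩
    · exact ⟨1, fun h' => absurd h' h⟩
  choose τ hτ using hτ
  have hcomp : ∀ (W' : Finset α) (σ : Perm α), W'.card = i.2.card → i.1.image σ = i.2 →
      i.1.image (τ W' * σ) = W' := by
    intro W' σ h1 h2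
    have h3 := (hτ W' h1).1
    rw [← h2, image_image] at h3
    exact h3
  rw [mul_comm, ← card_univ, ← card_powersetCard, ← card_product]
  refine card_le_card_of_injOn (fun p => τ p.1 * p.2) ?_ ?_
  · rintro ⟨W', σ⟩ hp
    simp only [mem_coe, mem_product, mem_powersetCard, mem_inter, mem_avoid, mem_mapEvent] at hp ⊢
    obtain ⟨⟨-, hW'⟩, hav, hσ⟩ := hp
    obtain ⟨him, hfix⟩ := hτ W' hW'
    intro j hj hjm
    apply hav j hj
    have hd := hJ j hj
    have h1 : Disjoint j.2 W' := by
      have := (disjoint_image (Equiv.injective (τ W' * σ))).2 hd.1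
      rwa [hcomp W' σ hW' hσ, hjm] at this
    have h2 : j.2.image (τ W') = j.2 := by
      conv_rhs => rw [← image_id (s := j.2)]
      refine image_congr fun y hy => hfix y ?_
      rw [Finset.mem_union, not_or]
      exact ⟨Finset.disjoint_left.1 hd.2 hy, Finset.disjoint_left.1 h1 hy⟩
    have h3 : (j.1.image σ).image (τ W') = j.2.image (τ W') := by
      rw [image_image, h2]; exact hjm
    exact image_injective (Equiv.injective (τ W')) h3
  · rintro ⟨W₁, σ₁⟩ h₁ ⟨W₂, σ₂⟩ h₂ heq
    simp only [mem_coe, mem_product, mem_powersetCard, mem_inter, mem_mapEvent] at h₁ h₂ heq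
    have e1 : i.1.image (τ W₁ * σ₁) = W₁ := hcomp _ _ h₁.1.2 h₁.2.2
    have e2 : i.1.image (τ W₂ * σ₂) = W₂ := hcomp _ _ h₂.1.2 h₂.2.2
    have : W₁ = W₂ := by rw [← e1, ← e2, heq]
    subst this
    rw [mul_left_cancel heq]

end NegativeDependency

lemma sum_exp_neg_le {a : ℝ} (ha : 0 < a) (N : ℕ) :
    ∑ L ∈ Icc 1 N, Real.exp (-(a * L)) ≤ 1 / a := by
  have h : ∀ N : ℕ, ∑ L ∈ Icc 1 N, Real.exp (-(a * L)) ≤ 1 / a * (1 - Real.exp (-(a * N))) := by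
    intro N
    induction N with
    | zero => simp
    | succ N ih =>
      rw [sum_Icc_succ_top (by omega)]
      have h1 : Real.exp (-(a * N)) = Real.exp a * Real.exp (-(a * (N + 1 : ℕ))) := by
        rw [← Real.exp_add]; congr 1; push_cast; ring
      have h2 := Real.add_one_le_exp a
      have h3 : a * Real.exp (-(a * (N + 1 : ℕ))) ≤
          (Real.exp a - 1) * Real.exp (-(a * (N + 1 : ℕ))) := by gcongr; linarith
      have h4 : Real.exp (-(a * (N + 1 : ℕ))) ≤
          1 / a * ((Real.exp a - 1) * Real.exp (-(a * (N + 1 : ℕ)))) := by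
        rw [one_div, ← div_eq_inv_mul, le_div_iff₀ ha]; linarith
      rw [h1] at ih
      nlinarith
  refine (h N).trans ?_
  have : 0 < Real.exp (-(a * N)) := Real.exp_pos _
  have h0 : 0 < 1 / a := by positivity
  nlinarith

lemma sum_biUnion_le_sum_sum {ι κ : Type*} [DecidableEq κ] {s : Finset ι} {t : ι → Finset κ}
    {x : κ → ℝ} (hx : ∀ j, 0 ≤ x j) : ∑ j ∈ s.biUnion t, x j ≤ ∑ v ∈ s, ∑ j ∈ t v, x j := by
  classical
  rw [← sum_sigma (s := s) (t := t) (f := fun p => x p.2)]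
  have h : s.biUnion t = (s.sigma t).image (fun p => p.2) := by
    ext j; simp
  rw [h]
  exact sum_image_le_of_nonneg (g := fun p : (_ : ι) × κ => p.2) (f := x) (fun _ _ => hx _)

/-- Pairs of small nonempty invariant sets of equal size. -/
def pairIdx (p q : Perm α) : Finset (Finset α × Finset α) :=
  (invSets p ×ˢ invSets q).filter
    (fun i => i.1.card = i.2.card ∧ 1 ≤ i.1.card ∧ 2 * i.1.card ≤ Fintype.card α)

lemma mem_pairIdx {p q : Perm α} {i : Finset α × Finset α} : i ∈ pairIdx p q ↔
    (i.1 ∈ invSets p ∧ i.2 ∈ invSets q) ∧ i.1.card = i.2.card ∧ 1 ≤ i.1.card ∧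
      2 * i.1.card ≤ Fintype.card α := by
  simp [pairIdx]

/-- The weight attached to a pair of sets of size `L`. -/
noncomputable def lllWeight (n : ℕ) (c : ℝ) (L : ℕ) : ℝ :=
  Real.exp (c / 2 * L) / n.choose L

lemma lllWeight_nonneg (n : ℕ) (c : ℝ) (L : ℕ) : 0 ≤ lllWeight n c L := by
  unfold lllWeight; positivity

lemma sum_lllWeight_le (p q : Perm α) (c : ℝ) {I : Finset (Finset α × Finset α)}
    (hI : I ⊆ pairIdx p q) (m : ℕ → ℝ)
    (hm : ∀ L, 1 ≤ L → 2 * L ≤ Fintype.card α →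
      ((I.filter (fun i => i.1.card = L)).card : ℝ) ≤ m L) :
    ∑ i ∈ I, lllWeight (Fintype.card α) c i.1.card ≤
      ∑ L ∈ Icc 1 (Fintype.card α / 2), m L * lllWeight (Fintype.card α) c L := by
  rw [← sum_fiberwise_of_maps_to (s := I) (t := Icc 1 (Fintype.card α / 2))
    (g := fun i => i.1.card)]
  · refine sum_le_sum fun L hL => ?_
    rw [mem_Icc] at hL
    have : ∑ i ∈ I.filter (fun i => i.1.card = L), lllWeight (Fintype.card α) c i.1.card =
        (I.filter (fun i => i.1.card = L)).card * lllWeight (Fintype.card α) c L := by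
      rw [← nsmul_eq_mul, ← sum_const]
      exact sum_congr rfl fun i hi => by rw [(mem_filter.1 hi).2]
    rw [this]
    exact mul_le_mul_of_nonneg_right (hm L hL.1 (by omega)) (lllWeight_nonneg _ _ _)
  · intro i hi
    have := mem_pairIdx.1 (hI hi)
    rw [mem_Icc]; omega

lemma card_prod_mul_lllWeight_le {a b x c A : ℝ} {n L : ℕ} (hL : 2 * L ≤ n)
    {z z' u v : ℝ} (hz : 0 < z) (hz' : 0 < z') (ha : a * z ^ L ≤ x * u) (hb : b * z' ^ L ≤ v)
    (ha0 : 0 ≤ a) (hx : 0 ≤ x) (hb0 : 0 ≤ b)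
    (h : u * v ≤ A * Real.exp (-(c * L)) * n.choose L * (z * z') ^ L) :
    a * b * lllWeight n c L ≤ x * A * Real.exp (-(c / 2 * L)) := by
  have hch : (0 : ℝ) < n.choose L := by exact_mod_cast Nat.choose_pos (by omega)
  have h1 : a * b * (z * z') ^ L ≤ x * (A * Real.exp (-(c * L)) * n.choose L) * (z * z') ^ L := by
    calc a * b * (z * z') ^ L = (a * z ^ L) * (b * z' ^ L) := by rw [mul_pow]; ring
      _ ≤ (x * u) * v := mul_le_mul ha hb (by positivity) ((by positivity : 0 ≤ a * z ^ L).trans ha)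
      _ = x * (u * v) := by ring
      _ ≤ x * (A * Real.exp (-(c * L)) * n.choose L * (z * z') ^ L) := by gcongr
      _ = _ := by ring
  have h2 := le_of_mul_le_mul_right h1 (by positivity)
  unfold lllWeight
  rw [← mul_div_assoc, div_le_iff₀ hch]
  calc a * b * Real.exp (c / 2 * L) ≤
      x * (A * Real.exp (-(c * L)) * n.choose L) * Real.exp (c / 2 * L) := by gcongr
    _ = x * A * (Real.exp (-(c * L)) * Real.exp (c / 2 * L)) * n.choose L := by ring
    _ = _ := by rw [← Real.exp_add]; congr 3; ring

lemma card_filter_pairIdx_le {I : Finset (Finset α × Finset α)} {L : ℕ}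
    {S T : Finset (Finset α)}
    (h : ∀ i ∈ I, i.1.card = L → i.1 ∈ S ∧ i.2 ∈ T) :
    ((I.filter (fun i => i.1.card = L)).card : ℝ) ≤ S.card * T.card := by
  rw [← Nat.cast_mul, ← card_product]
  refine Nat.cast_le.2 (card_le_card fun i hi => ?_)
  rw [mem_filter] at hi
  exact mem_product.2 (h i hi.1 hi.2)

lemma sum_pairIdx_le {p q : Perm α} {A c : ℝ} (hA : 0 < A) (hc : 0 < c)
    (hcore : CoreBound p q A c) :
    ∑ i ∈ pairIdx p q, lllWeight (Fintype.card α) c i.1.card ≤ 2 * A / c := by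
  refine (sum_lllWeight_le p q c subset_rfl (fun L =>
    ((invSets p).filter (fun V => V.card = L)).card *
      ((invSets q).filter (fun V => V.card = L)).card) ?_).trans ?_
  · intro L hL _
    refine card_filter_pairIdx_le fun i hi hiL => ?_
    have := mem_pairIdx.1 hi
    exact ⟨mem_filter.2 ⟨this.1.1, hiL⟩, mem_filter.2 ⟨this.1.2, by omega⟩⟩
  calc _ ≤ ∑ L ∈ Icc 1 (Fintype.card α / 2), A * Real.exp (-(c / 2 * L)) := by
        refine sum_le_sum fun L hL => ?_
        rw [mem_Icc] at hL
        obtain ⟨z, z', hz, -, hz', -, -, -, h⟩ := hcore L hL.1 (by omega)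
        have h2L : 2 * L ≤ Fintype.card α := by omega
        have := card_prod_mul_lllWeight_le (x := 1) h2L hz hz'
          ((card_invSets_le p hz L).trans (one_mul _).ge) (card_invSets_le q hz' L)
          (by positivity) (by norm_num) (by positivity) h
        simpa using this
    _ ≤ A * (1 / (c / 2)) := by
        rw [← mul_sum]; gcongr; exact sum_exp_neg_le (by positivity) _
    _ = _ := by field_simp

lemma le_of_pow_three_mul_le {z A η L n : ℝ} (hn : 0 < n) (hη : 0 ≤ η) (hL : 0 ≤ L)
    (h : z ^ 3 * n ≤ A * L ^ 3) (hA : A ≤ η ^ 3 * n) : z ≤ η * L := by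
  by_contra! hlt
  have h1 : (η * L) ^ 3 < z ^ 3 := by gcongr
  have h2 : (η * L) ^ 3 * n < z ^ 3 * n := by gcongr
  have h3 : A * L ^ 3 ≤ η ^ 3 * n * L ^ 3 := by gcongr
  have : (η * L) ^ 3 * n = η ^ 3 * n * L ^ 3 := by ring
  linarith

lemma sum_pointed_aux {c A η : ℝ} (hA : 0 < A) (hc : 0 < c) (hη : 0 < η) (N : ℕ) :
    ∑ L ∈ Icc 1 N, η * L * A * Real.exp (-(c / 2 * L)) ≤ 16 * η * A / c ^ 2 := by
  calc _ ≤ ∑ L ∈ Icc 1 N, η * A * (4 / c) * Real.exp (-(c / 4 * L)) := by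
        refine sum_le_sum fun L _ => ?_
        have h := natCast_le_mul_exp (c := c / 4) (by positivity) L
        calc η * L * A * Real.exp (-(c / 2 * L))
            ≤ η * (1 / (c / 4) * Real.exp (c / 4 * L)) * A * Real.exp (-(c / 2 * L)) := by gcongr
          _ = η * A * (1 / (c / 4)) * (Real.exp (c / 4 * L) * Real.exp (-(c / 2 * L))) := by ring
          _ = _ := by
            rw [← Real.exp_add]; congr 2
            · field_simp
            · ring
    _ ≤ η * A * (4 / c) * (1 / (c / 4)) := by
        rw [← mul_sum]; gcongr; exact sum_exp_neg_le (by positivity) _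
    _ = _ := by field_simp; norm_num

lemma sum_pointed_fst_le {p q : Perm α} {A c η : ℝ} (hA : 0 < A) (hc : 0 < c) (hη : 0 < η)
    (hn : A ≤ η ^ 3 * Fintype.card α) (hcore : CoreBound p q A c) (v : α) :
    ∑ i ∈ (pairIdx p q).filter (fun i => v ∈ i.1), lllWeight (Fintype.card α) c i.1.card ≤
      16 * η * A / c ^ 2 := by
  have hn0 : (0 : ℝ) < Fintype.card α := by exact_mod_cast Fintype.card_pos_iff.2 ⟨v⟩
  refine (sum_lllWeight_le p q c (filter_subset _ _) (fun L =>
    ((invSets p).filter (fun V => V.card = L ∧ v ∈ V)).card *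
      ((invSets q).filter (fun V => V.card = L)).card) ?_).trans ?_
  · intro L hL _
    refine card_filter_pairIdx_le fun i hi hiL => ?_
    have := mem_pairIdx.1 (mem_filter.1 hi).1
    exact ⟨mem_filter.2 ⟨this.1.1, hiL, (mem_filter.1 hi).2⟩, mem_filter.2 ⟨this.1.2, by omega⟩⟩
  refine le_trans (sum_le_sum fun L hL => ?_) (sum_pointed_aux hA hc hη _)
  rw [mem_Icc] at hL
  obtain ⟨z, z', hz, hz1, hz', -, h3, -, h⟩ := hcore L hL.1 (by omega)
  have h2L : 2 * L ≤ Fintype.card α := by omega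
  have := card_prod_mul_lllWeight_le (x := z) h2L hz hz'
    (card_invSets_mem_le p hz hz1 v L) (card_invSets_le q hz' L)
    (by positivity) hz.le (by positivity) h
  refine this.trans ?_
  have := le_of_pow_three_mul_le hn0 hη.le (Nat.cast_nonneg L) h3 hn
  gcongr

lemma sum_pointed_snd_le {p q : Perm α} {A c η : ℝ} (hA : 0 < A) (hc : 0 < c) (hη : 0 < η)
    (hn : A ≤ η ^ 3 * Fintype.card α) (hcore : CoreBound p q A c) (v : α) :
    ∑ i ∈ (pairIdx p q).filter (fun i => v ∈ i.2), lllWeight (Fintype.card α) c i.1.card ≤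
      16 * η * A / c ^ 2 := by
  have hn0 : (0 : ℝ) < Fintype.card α := by exact_mod_cast Fintype.card_pos_iff.2 ⟨v⟩
  refine (sum_lllWeight_le p q c (filter_subset _ _) (fun L =>
    ((invSets p).filter (fun V => V.card = L)).card *
      ((invSets q).filter (fun V => V.card = L ∧ v ∈ V)).card) ?_).trans ?_
  · intro L hL _
    refine card_filter_pairIdx_le fun i hi hiL => ?_
    have := mem_pairIdx.1 (mem_filter.1 hi).1
    exact ⟨mem_filter.2 ⟨this.1.1, hiL⟩,
      mem_filter.2 ⟨this.1.2, by omega, (mem_filter.1 hi).2⟩⟩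
  refine le_trans (sum_le_sum fun L hL => ?_) (sum_pointed_aux hA hc hη _)
  rw [mem_Icc] at hL
  obtain ⟨z, z', hz, hz1, hz', hz1', -, h3, h⟩ := hcore L hL.1 (by omega)
  have h2L : 2 * L ≤ Fintype.card α := by omega
  have := card_prod_mul_lllWeight_le (x := z') h2L hz' hz
    (card_invSets_mem_le q hz' hz1' v L) (card_invSets_le p hz L)
    (by positivity) hz'.le (by positivity) (by rw [mul_comm (invGen q z'), mul_comm z' z]; exact h)
  rw [mul_comm (((invSets p).filter (fun V => V.card = L)).card : ℝ)]
  refine this.trans ?_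
  have := le_of_pow_three_mul_le hn0 hη.le (Nat.cast_nonneg L) h3 hn
  gcongr

theorem le_card_avoid_pairIdx {p q : Perm α} {A c : ℝ} (hA : 0 < A) (hc : 0 < c) (hc1 : c ≤ 1)
    (hn : A ≤ (c ^ 3 / (128 * A)) ^ 3 * Fintype.card α) (hcore : CoreBound p q A c) :
    Real.exp (-(4 * A / c)) * Fintype.card (Perm α) ≤ (avoid mapEvent (pairIdx p q)).card := by
  classical
  set η : ℝ := c ^ 3 / (128 * A) with hη
  have hη0 : 0 < η := by positivity
  have hD : 16 * η * A / c ^ 2 = c / 8 := by rw [hη]; field_simp; norm_num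
  have hfst := sum_pointed_fst_le hA hc hη0 hn hcore
  have hsnd := sum_pointed_snd_le hA hc hη0 hn hcore
  rw [hD] at hfst hsnd
  set x : Finset α × Finset α → ℝ := fun i => lllWeight (Fintype.card α) c i.1.card with hx
  have hx0 : ∀ i, 0 ≤ x i := fun i => lllWeight_nonneg _ _ _
  have hxh : ∀ i ∈ pairIdx p q, x i ≤ 1 / 2 := by
    intro i hi
    obtain ⟨v, hv⟩ := card_pos.1 (mem_pairIdx.1 hi).2.2.1
    have := single_le_sum (f := x) (fun i _ => hx0 i)
      (mem_filter.2 ⟨hi, hv⟩ : i ∈ (pairIdx p q).filter (fun i => v ∈ i.1))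
    linarith [hfst v]
  refine le_trans ?_ (prod_le_card_avoid mapEvent (pairIdx p q)
    (fun i j => ¬ (Disjoint j.1 i.1 ∧ Disjoint j.2 i.2))
    (fun i => 1 / (Fintype.card α).choose i.1.card) x (fun i _ => hx0 i)
    (fun i hi => (hxh i hi).trans (by norm_num)) ?_ ?_)
  · gcongr
    refine le_trans ?_ (exp_le_prod_one_sub _ _ (fun i _ => hx0 i) hxh)
    apply Real.exp_le_exp.2
    have := sum_pairIdx_le hA hc hcore
    have h2 : 4 * A / c = 2 * (2 * A / c) := by ring
    rw [h2]; linarith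
  · intro i hi J _ hJ
    have hi' := mem_pairIdx.1 hi
    have hch : (0 : ℝ) < (Fintype.card α).choose i.1.card := by
      exact_mod_cast Nat.choose_pos (by omega)
    have := card_avoid_inter_mapEvent_le (i := i) J (fun j hj => by simpa using hJ j hj)
    rw [← hi'.2.1] at this
    rw [div_mul_eq_mul_div, one_mul, le_div_iff₀ hch]
    exact_mod_cast this
  · intro i hi
    have hi' := mem_pairIdx.1 hi
    have hsum : ∑ j ∈ (pairIdx p q).filter
        (fun j => ¬ (Disjoint j.1 i.1 ∧ Disjoint j.2 i.2)), x j ≤ i.1.card * (c / 4) := by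
      calc _ ≤ ∑ j ∈ (i.1.biUnion fun v => (pairIdx p q).filter (fun j => v ∈ j.1)) ∪
            (i.2.biUnion fun v => (pairIdx p q).filter (fun j => v ∈ j.2)), x j := by
            refine sum_le_sum_of_subset_of_nonneg (fun j hj => ?_) (fun _ _ _ => hx0 _)
            rw [mem_filter, not_and_or, Finset.not_disjoint_iff, Finset.not_disjoint_iff] at hj
            simp only [Finset.mem_union, mem_biUnion, mem_filter]
            obtain ⟨hj, ⟨v, h1, h2⟩ | ⟨v, h1, h2⟩⟩ := hj
            · exact Or.inl ⟨v, h2, hj, h1⟩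
            · exact Or.inr ⟨v, h2, hj, h1⟩
        _ ≤ (∑ v ∈ i.1, ∑ j ∈ (pairIdx p q).filter (fun j => v ∈ j.1), x j) +
            ∑ v ∈ i.2, ∑ j ∈ (pairIdx p q).filter (fun j => v ∈ j.2), x j := by
            refine le_trans ?_ (add_le_add (sum_biUnion_le_sum_sum hx0) (sum_biUnion_le_sum_sum hx0))
            rw [← sum_union_inter]
            exact le_add_of_nonneg_right (sum_nonneg fun _ _ => hx0 _)
        _ ≤ (∑ v ∈ i.1, c / 8) + ∑ v ∈ i.2, c / 8 :=
            add_le_add (sum_le_sum fun v _ => hfst v) (sum_le_sum fun v _ => hsnd v)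
        _ = _ := by
            rw [sum_const, sum_const, ← hi'.2.1, nsmul_eq_mul]; ring
    have hprod := exp_le_prod_one_sub ((pairIdx p q).filter
        (fun j => ¬ (Disjoint j.1 i.1 ∧ Disjoint j.2 i.2))) x (fun i _ => hx0 i)
        (fun j hj => hxh j (mem_filter.1 hj).1)
    have hge : Real.exp (-(c / 2 * i.1.card)) ≤ ∏ j ∈ (pairIdx p q).filter
        (fun j => ¬ (Disjoint j.1 i.1 ∧ Disjoint j.2 i.2)), (1 - x j) := by
      refine le_trans (Real.exp_le_exp.2 ?_) hprod
      linarith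
    have heq : 1 / ((Fintype.card α).choose i.1.card : ℝ) =
        x i * Real.exp (-(c / 2 * i.1.card)) := by
      simp only [hx, lllWeight]
      rw [div_mul_eq_mul_div, ← Real.exp_add, add_neg_cancel, Real.exp_zero]
    change 1 / ((Fintype.card α).choose i.1.card : ℝ) ≤ _
    rw [heq]
    exact mul_le_mul_of_nonneg_left hge (hx0 i)

/-- The conjugacy class of `p`, as a finset. -/
def cls (p : Perm α) : Finset (Perm α) := univ.filter (fun ρ => ∃ σ : Perm α, σ * p * σ⁻¹ = ρ)

lemma mem_cls {p ρ : Perm α} : ρ ∈ cls p ↔ ∃ σ : Perm α, σ * p * σ⁻¹ = ρ := by simp [cls]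

lemma conjClosed_cls (p : Perm α) : ConjClosed (cls p) := by
  intro ρ hρ τ
  obtain ⟨σ, rfl⟩ := mem_cls.1 hρ
  exact mem_cls.2 ⟨τ * σ, by group⟩

open Classical in
lemma card_conj_mul_card_cls (p : Perm α) (B : Perm α → Prop) :
    (univ.filter (fun σ : Perm α => B (σ * p * σ⁻¹))).card * (cls p).card =
      ((cls p).filter B).card * Fintype.card (Perm α) := by
  set k := (univ.filter (fun σ : Perm α => σ * p * σ⁻¹ = p)).card with hk
  have hfib : ∀ ρ ∈ cls p, (univ.filter (fun σ : Perm α => σ * p * σ⁻¹ = ρ)).card = k := by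
    intro ρ hρ
    obtain ⟨τ, rfl⟩ := mem_cls.1 hρ
    refine card_bij (fun σ _ => τ⁻¹ * σ) ?_ ?_ ?_
    · intro σ hσ
      rw [mem_filter] at hσ ⊢
      refine ⟨mem_univ _, ?_⟩
      have : τ⁻¹ * σ * p * (τ⁻¹ * σ)⁻¹ = τ⁻¹ * (σ * p * σ⁻¹) * τ := by group
      rw [this, hσ.2]; group
    · intro a _ b _ h
      exact mul_left_cancel h
    · intro b hb
      refine ⟨τ * b, ?_, by group⟩
      rw [mem_filter] at hb ⊢
      refine ⟨mem_univ _, ?_⟩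
      have : τ * b * p * (τ * b)⁻¹ = τ * (b * p * b⁻¹) * τ⁻¹ := by group
      rw [this, hb.2]
  have hcount : ∀ B : Perm α → Prop,
      (univ.filter (fun σ : Perm α => B (σ * p * σ⁻¹))).card = ((cls p).filter B).card * k := by
    intro B
    rw [card_eq_sum_card_fiberwise (f := fun σ => σ * p * σ⁻¹) (t := (cls p).filter B)]
    · rw [← smul_eq_mul, ← sum_const]
      refine sum_congr rfl fun ρ hρ => ?_
      rw [mem_filter] at hρ
      rw [← hfib ρ hρ.1, filter_filter]
      congr 1
      ext σ
      simp only [mem_filter, mem_univ, true_and]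
      constructor
      · exact fun h => h.2
      · rintro rfl; exact ⟨hρ.2, rfl⟩
    · intro σ hσ
      rw [mem_coe, mem_filter] at hσ ⊢
      exact ⟨mem_cls.2 ⟨σ, rfl⟩, hσ.2⟩
  have h1 := hcount (fun _ => True)
  rw [filter_true, filter_true, card_univ] at h1
  rw [hcount B, h1]; ring

lemma card_filter_cls_le {p : Perm α} {B : Perm α → Prop} [DecidablePred B]
    [DecidablePred fun σ : Perm α => B (σ * p * σ⁻¹)] {t : ℝ}
    (h : ((univ.filter (fun σ : Perm α => B (σ * p * σ⁻¹))).card : ℝ) ≤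
      t * Fintype.card (Perm α)) : (((cls p).filter B).card : ℝ) ≤ t * (cls p).card := by
  have h1 : ((univ.filter (fun σ : Perm α => B (σ * p * σ⁻¹))).card : ℝ) * (cls p).card =
      ((cls p).filter B).card * Fintype.card (Perm α) := by
    have := card_conj_mul_card_cls p B
    norm_cast
    convert this
  have h2 : (0 : ℝ) < Fintype.card (Perm α) := by exact_mod_cast Fintype.card_pos
  refine le_of_mul_le_mul_right ?_ h2
  rw [← h1]
  calc _ ≤ t * Fintype.card (Perm α) * (cls p).card := by gcongr
    _ = _ := by ring

lemma le_card_filter_cls {p : Perm α} {B : Perm α → Prop} [DecidablePred B]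
    [DecidablePred fun σ : Perm α => B (σ * p * σ⁻¹)] {t : ℝ}
    (h : t * Fintype.card (Perm α) ≤
      ((univ.filter (fun σ : Perm α => B (σ * p * σ⁻¹))).card : ℝ)) :
    t * (cls p).card ≤ (((cls p).filter B).card : ℝ) := by
  have h1 : ((univ.filter (fun σ : Perm α => B (σ * p * σ⁻¹))).card : ℝ) * (cls p).card =
      ((cls p).filter B).card * Fintype.card (Perm α) := by
    have := card_conj_mul_card_cls p B
    norm_cast
    convert this
  have h2 : (0 : ℝ) < Fintype.card (Perm α) := by exact_mod_cast Fintype.card_pos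
  refine le_of_mul_le_mul_right ?_ h2
  rw [← h1]
  calc _ = t * Fintype.card (Perm α) * (cls p).card := by ring
    _ ≤ _ := by gcongr

/-- There is no nonempty set of at most half of the points invariant under `ρ` and `q`. -/
def NoSmallInvariant (ρ q : Perm α) : Prop :=
  ∀ W : Finset α, W.Nonempty → (∀ x ∈ W, ρ x ∈ W) → (∀ x ∈ W, q x ∈ W) →
    Fintype.card α < 2 * W.card

lemma noSmallInvariant_of_mem_avoid {p q σ : Perm α} (h : σ ∈ avoid mapEvent (pairIdx p q)) :
    NoSmallInvariant (σ * p * σ⁻¹) q := by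
  intro W hW h1 h2
  by_contra! hlt
  have hc : (W.image σ.symm).card = W.card := card_image_of_injective _ σ.symm.injective
  refine mem_avoid.1 h (W.image σ.symm, W) (mem_pairIdx.2 ⟨⟨?_, mem_invSets.2 h2⟩, hc, ?_, ?_⟩) ?_
  · rw [mem_invSets]
    intro x hx
    obtain ⟨y, hy, rfl⟩ := mem_image.1 hx
    refine mem_image.2 ⟨_, h1 y hy, ?_⟩
    simp [Perm.inv_def]
  · rw [hc]; exact hW.card_pos
  · rw [hc]; exact hlt
  · rw [mem_mapEvent]
    simp [image_image]

open Classical in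
theorem le_card_noSmallInvariant {p q : Perm α} {A c : ℝ} (hA : 0 < A) (hc : 0 < c) (hc1 : c ≤ 1)
    (hn : A ≤ (c ^ 3 / (128 * A)) ^ 3 * Fintype.card α) (hcore : CoreBound p q A c) :
    Real.exp (-(4 * A / c)) * (cls p).card ≤
      ((cls p).filter (fun ρ => NoSmallInvariant ρ q)).card := by
  refine le_card_filter_cls ((le_card_avoid_pairIdx hA hc hc1 hn hcore).trans ?_)
  refine Nat.cast_le.2 (card_le_card fun σ hσ => ?_)
  exact mem_filter.2 ⟨mem_univ _, noSmallInvariant_of_mem_avoid hσ⟩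

lemma mem_nearSets {q : Perm α} {h L : ℕ} {W : Finset α} :
    W ∈ nearSets q h L ↔ W.card = L ∧ (W.filter (fun z => q⁻¹ z ∉ W)).card ≤ h := by
  simp [nearSets]

lemma image_symm_mem_nearSets {p σ : Perm α} {h L : ℕ} {W : Finset α}
    (hW : W ∈ nearSets (σ * p * σ⁻¹) h L) : W.image σ.symm ∈ nearSets p h L := by
  rw [mem_nearSets] at hW ⊢
  refine ⟨by rw [card_image_of_injective _ σ.symm.injective, hW.1], le_trans ?_ hW.2⟩
  refine card_le_card_of_injOn σ ?_ σ.injective.injOn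
  intro x hx
  rw [mem_coe, mem_filter] at hx ⊢
  obtain ⟨y, hy, rfl⟩ := mem_image.1 hx.1
  refine ⟨by simpa using hy, fun hmem => hx.2 (mem_image.2 ⟨_, hmem, ?_⟩)⟩
  simp [Perm.inv_def]

lemma exists_nearSets_of_not_expanding {ρ q : Perm α} {ε : ℝ} 
    (hT : NoSmallInvariant ρ q) (hE : ¬ Expanding ε ρ q) :
    ∃ L : ℕ, 1 ≤ L ∧ 2 * L ≤ Fintype.card α ∧ 1 ≤ ε * L ∧
      ∃ W, W ∈ nearSets q ⌊ε * L⌋₊ L ∧ W ∈ nearSets ρ ⌊ε * L⌋₊ L := by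
  unfold Expanding at hE
  push Not at hE
  obtain ⟨W, hW, hinv, h2, hlt⟩ := hE
  have hq : (W.filter (fun z => q⁻¹ z ∉ W)).card ≤ ⌊ε * W.card⌋₊ := Nat.le_floor hlt.le
  have hinv' : W ∈ invSets (ρ * q) := mem_invSets.2 hinv
  have hρ : (W.filter (fun z => ρ⁻¹ z ∉ W)).card ≤ (W.filter (fun z => q⁻¹ z ∉ W)).card := by
    rw [← card_exit_eq q]
    have himg : W.image (ρ * q) = W := by
      refine eq_of_subset_of_card_le ?_ (by rw [card_image_of_injective _ (ρ * q).injective])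
      intro y hy
      obtain ⟨x, hx, rfl⟩ := mem_image.1 hy
      exact hinv x hx
    refine (card_le_card (t := (W.filter (fun z => q z ∉ W)).image (ρ * q)) ?_).trans
      card_image_le
    intro z hz
    rw [mem_filter] at hz
    obtain ⟨y, hy, rfl⟩ := mem_image.1 (himg.symm ▸ hz.1 : z ∈ W.image (ρ * q))
    refine mem_image.2 ⟨y, mem_filter.2 ⟨hy, ?_⟩, rfl⟩
    simpa using hz.2
  refine ⟨W.card, hW.card_pos, h2, ?_, W, mem_nearSets.2 ⟨rfl, hq⟩,
    mem_nearSets.2 ⟨rfl, hρ.trans hq⟩⟩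
  by_contra! h1
  rw [Nat.floor_eq_zero.2 h1, Nat.le_zero, ] at hq
  have hρ0 := Nat.le_zero.1 (hq ▸ hρ)
  have hz : ∀ τ : Perm α, (W.filter (fun z => τ⁻¹ z ∉ W)).card = 0 → ∀ x ∈ W, τ x ∈ W := by
    intro τ h x hx
    rw [← card_exit_eq τ, card_eq_zero, filter_eq_empty_iff] at h
    simpa using h hx
  have := hT W hW (hz ρ hρ0) (hz q hq)
  omega

lemma card_mapEvent_mul_choose_le (i : Finset α × Finset α) :
    (mapEvent i).card * (Fintype.card α).choose i.2.card ≤ Fintype.card (Perm α) := by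
  have := card_avoid_inter_mapEvent_le (i := i) ∅ (by simp)
  have h : avoid (mapEvent (α := α)) ∅ = univ := by ext; simp [mem_avoid]
  simpa [h, Finset.univ_inter] using this

lemma succ_pow_le_exp {n L : ℕ} {ε c : ℝ} (hε : 0 < ε) (h : 8 * ε * Real.log (n + 1) ≤ c) :
    ((n + 1 : ℕ) : ℝ) ^ (4 * ⌊ε * L⌋₊) ≤ Real.exp (c / 2 * L) := by
  have h1 : ((n + 1 : ℕ) : ℝ) = Real.exp (Real.log (n + 1)) := by
    rw [Real.exp_log (by positivity)]; push_cast; ring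
  rw [h1, ← Real.exp_nat_mul]
  apply Real.exp_le_exp.2
  have h2 : (⌊ε * L⌋₊ : ℝ) ≤ ε * L := Nat.floor_le (by positivity)
  have h3 : 0 ≤ Real.log ((n : ℝ) + 1) := Real.log_nonneg (by linarith [Nat.cast_nonneg (α := ℝ) n])
  push_cast
  calc 4 * (⌊ε * L⌋₊ : ℝ) * Real.log (n + 1) ≤ 4 * (ε * L) * Real.log (n + 1) := by gcongr
    _ = (8 * ε * Real.log (n + 1)) / 2 * L := by ring
    _ ≤ _ := by gcongr

open Classical in
theorem card_not_expanding_le {p q : Perm α} {A c ε : ℝ} (hA : 0 < A) (hc : 0 < c) (hε : 0 < ε)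
    (hεc : 8 * ε * Real.log (Fintype.card α + 1) ≤ c) (hcore : CoreBound p q A c) :
    (((cls p).filter (fun ρ => NoSmallInvariant ρ q ∧ ¬ Expanding ε ρ q)).card : ℝ) ≤
      4 * A / c * Real.exp (-(c / (4 * ε))) * (cls p).card := by
  apply card_filter_cls_le
  set n := Fintype.card α with hn
  set Ls := (Icc 1 (n / 2)).filter (fun L : ℕ => 1 ≤ ε * L) with hLs
  have hsub : univ.filter (fun σ : Perm α => NoSmallInvariant (σ * p * σ⁻¹) q ∧
      ¬ Expanding ε (σ * p * σ⁻¹) q) ⊆ Ls.biUnion fun L =>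
        (nearSets p ⌊ε * L⌋₊ L ×ˢ nearSets q ⌊ε * L⌋₊ L).biUnion mapEvent := by
    intro σ hσ
    obtain ⟨-, hT, hE⟩ := mem_filter.1 hσ
    obtain ⟨L, hL1, hL2, hL3, W, hWq, hWp⟩ := exists_nearSets_of_not_expanding hT hE
    refine mem_biUnion.2 ⟨L, mem_filter.2 ⟨mem_Icc.2 ⟨hL1, by omega⟩, hL3⟩,
      mem_biUnion.2 ⟨(W.image σ.symm, W), mem_product.2 ⟨image_symm_mem_nearSets hWp, hWq⟩, ?_⟩⟩
    rw [mem_mapEvent]; simp [image_image]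
  have hterm : ∀ L ∈ Ls, (((nearSets p ⌊ε * L⌋₊ L ×ˢ nearSets q ⌊ε * L⌋₊ L).biUnion
      mapEvent).card : ℝ) ≤ A * Real.exp (-(c / (4 * ε))) * Real.exp (-(c / 4 * L)) *
        Fintype.card (Perm α) := by
    intro L hL
    obtain ⟨hL, hεL⟩ := mem_filter.1 hL
    rw [mem_Icc] at hL
    have h2L : 2 * L ≤ n := by omega
    obtain ⟨z, z', hz, hz1, hz', hz1', -, -, h⟩ := hcore L hL.1 h2L
    have hch : (0 : ℝ) < n.choose L := by exact_mod_cast Nat.choose_pos (by omega)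
    set a : ℝ := ((nearSets p ⌊ε * L⌋₊ L).card : ℝ) with ha
    set b : ℝ := ((nearSets q ⌊ε * L⌋₊ L).card : ℝ) with hb
    have h1 : (((nearSets p ⌊ε * L⌋₊ L ×ˢ nearSets q ⌊ε * L⌋₊ L).biUnion mapEvent).card : ℝ) *
        n.choose L ≤ a * b * Fintype.card (Perm α) := by
      have : ((nearSets p ⌊ε * L⌋₊ L ×ˢ nearSets q ⌊ε * L⌋₊ L).biUnion mapEvent).card *
          n.choose L ≤ ((nearSets p ⌊ε * L⌋₊ L).card * (nearSets q ⌊ε * L⌋₊ L).card) *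
            Fintype.card (Perm α) := by
        calc _ ≤ (∑ i ∈ nearSets p ⌊ε * L⌋₊ L ×ˢ nearSets q ⌊ε * L⌋₊ L, (mapEvent i).card) *
              n.choose L := by gcongr; exact card_biUnion_le
          _ = ∑ i ∈ nearSets p ⌊ε * L⌋₊ L ×ˢ nearSets q ⌊ε * L⌋₊ L, (mapEvent i).card *
              n.choose L := by rw [sum_mul]
          _ ≤ ∑ i ∈ nearSets p ⌊ε * L⌋₊ L ×ˢ nearSets q ⌊ε * L⌋₊ L, Fintype.card (Perm α) := by
              refine sum_le_sum fun i hi => ?_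
              have := card_mapEvent_mul_choose_le i
              rwa [(mem_nearSets.1 (mem_product.1 hi).2).1] at this
          _ = _ := by rw [sum_const, card_product, smul_eq_mul]
      rw [ha, hb]
      exact_mod_cast this
    have h2 : a * b * (z * z') ^ L ≤ ((n + 1 : ℕ) : ℝ) ^ (4 * ⌊ε * L⌋₊) *
        (A * Real.exp (-(c * L)) * n.choose L) * (z * z') ^ L := by
      have e1 := card_nearSets_le p hz hz1 ⌊ε * L⌋₊ L
      have e2 := card_nearSets_le q hz' hz1' ⌊ε * L⌋₊ L
      calc a * b * (z * z') ^ L = (a * z ^ L) * (b * z' ^ L) := by rw [mul_pow]; ring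
        _ ≤ (((n + 1 : ℕ) : ℝ) ^ (2 * ⌊ε * L⌋₊) * invGen p z) *
            (((n + 1 : ℕ) : ℝ) ^ (2 * ⌊ε * L⌋₊) * invGen q z') :=
            mul_le_mul e1 e2 (by positivity) (mul_nonneg (by positivity) (invGen_nonneg p hz.le))
        _ = ((n + 1 : ℕ) : ℝ) ^ (4 * ⌊ε * L⌋₊) * (invGen p z * invGen q z') := by ring
        _ ≤ ((n + 1 : ℕ) : ℝ) ^ (4 * ⌊ε * L⌋₊) *
            (A * Real.exp (-(c * L)) * n.choose L * (z * z') ^ L) := by gcongr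
        _ = _ := by ring
    have h3 := le_of_mul_le_mul_right h2 (by positivity)
    have h4 := succ_pow_le_exp (n := n) (L := L) hε hεc
    have h5 : a * b ≤ A * Real.exp (-(c / 2 * L)) * n.choose L := by
      calc a * b ≤ _ := h3
        _ ≤ Real.exp (c / 2 * L) * (A * Real.exp (-(c * L)) * n.choose L) := by gcongr
        _ = A * (Real.exp (c / 2 * L) * Real.exp (-(c * L))) * n.choose L := by ring
        _ = _ := by rw [← Real.exp_add]; congr 3; ring
    have h6 : Real.exp (-(c / 2 * L)) ≤ Real.exp (-(c / (4 * ε))) * Real.exp (-(c / 4 * L)) := by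
      rw [← Real.exp_add]
      apply Real.exp_le_exp.2
      have : c / (4 * ε) ≤ c / 4 * L := by
        rw [div_le_iff₀ (by positivity)]
        nlinarith
      linarith
    refine le_of_mul_le_mul_right (h1.trans ?_) hch
    calc a * b * Fintype.card (Perm α) ≤
        A * Real.exp (-(c / 2 * L)) * n.choose L * Fintype.card (Perm α) := by gcongr
      _ ≤ A * (Real.exp (-(c / (4 * ε))) * Real.exp (-(c / 4 * L))) * n.choose L *
          Fintype.card (Perm α) := by gcongr
      _ = _ := by ring
  calc _ ≤ ((Ls.biUnion fun L =>
        (nearSets p ⌊ε * L⌋₊ L ×ˢ nearSets q ⌊ε * L⌋₊ L).biUnion mapEvent).card : ℝ) := by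
        exact_mod_cast card_le_card hsub
    _ ≤ ∑ L ∈ Ls, (((nearSets p ⌊ε * L⌋₊ L ×ˢ nearSets q ⌊ε * L⌋₊ L).biUnion
        mapEvent).card : ℝ) := by exact_mod_cast card_biUnion_le
    _ ≤ ∑ L ∈ Ls, A * Real.exp (-(c / (4 * ε))) * Real.exp (-(c / 4 * L)) *
        Fintype.card (Perm α) := sum_le_sum hterm
    _ ≤ ∑ L ∈ Icc 1 (n / 2), A * Real.exp (-(c / (4 * ε))) * Real.exp (-(c / 4 * L)) *
        Fintype.card (Perm α) :=
        sum_le_sum_of_subset_of_nonneg (filter_subset _ _) fun _ _ _ => by positivity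
    _ = A * Real.exp (-(c / (4 * ε))) * (∑ L ∈ Icc 1 (n / 2), Real.exp (-(c / 4 * L))) *
        Fintype.card (Perm α) := by rw [mul_sum, sum_mul]
    _ ≤ A * Real.exp (-(c / (4 * ε))) * (1 / (c / 4)) * Fintype.card (Perm α) := by
        gcongr; exact sum_exp_neg_le (by positivity) _
    _ = _ := by field_simp

section Blocks
open MulAction
open scoped Pointwise

lemma isPretransitive_of_noSmallInvariant {ρ q : Perm α} (h : NoSmallInvariant ρ q) :
    IsPretransitive (Subgroup.closure {ρ, q}) α := by
  classical
  refine ⟨fun x y => ?_⟩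
  set G := Subgroup.closure {ρ, q} with hG
  set W : Finset α := univ.filter (fun z => z ∈ orbit G x) with hW
  have hinv : ∀ k ∈ G, ∀ z, z ∈ orbit G x → k z ∈ orbit G x := fun k hk z hz => by
    obtain ⟨g, rfl⟩ := hz
    exact ⟨⟨k, hk⟩ * g, mul_smul _ _ _⟩
  have hρ : ρ ∈ G := Subgroup.subset_closure (by simp)
  have hq : q ∈ G := Subgroup.subset_closure (by simp)
  have hcompl : ∀ k ∈ G, ∀ z, z ∉ orbit G x → k z ∉ orbit G x := fun k hk z hz hz' => by
    apply hz
    have := hinv k⁻¹ (G.inv_mem hk) _ hz'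
    simpa using this
  have h1 := h W ⟨x, by simp [hW]⟩
    (fun z hz => by simp only [hW, mem_filter, mem_univ, true_and] at hz ⊢; exact hinv ρ hρ z hz)
    (fun z hz => by simp only [hW, mem_filter, mem_univ, true_and] at hz ⊢; exact hinv q hq z hz)
  have hy : y ∈ orbit G x := by
    by_contra hy
    have h2 := h Wᶜ ⟨y, by simp [hW, hy]⟩
      (fun z hz => by
        simp only [hW, mem_compl, mem_filter, mem_univ, true_and] at hz ⊢; exact hcompl ρ hρ z hz)
      (fun z hz => by
        simp only [hW, mem_compl, mem_filter, mem_univ, true_and] at hz ⊢; exact hcompl q hq z hz)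
    rw [card_compl] at h2
    have := card_le_univ W
    omega
  exact hy

/-- A block system with at least two blocks of size `b`, presented as a colouring. -/
def HasBlocks (ρ q : Perm α) (m b : ℕ) : Prop :=
  ∃ f : α → Fin m, (∀ i, (univ.filter (fun a => f a = i)).card = b) ∧
    ∃ s t : Fin m → Fin m, f ∘ ρ = s ∘ f ∧ f ∘ q = t ∘ f

lemma prime_le_ncard_block {G : Subgroup (Perm α)} {B : Set α} (hB : IsBlock G B)
    (hBn : B.Nontrivial) {g : Perm α} (hg : g ∈ G) (hgc : g.IsCycle) {p : ℕ} (hp : p.Prime)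
    (hgp : g.support.card = p) {x : α} (hx : x ∈ B) (hxg : x ∈ g.support) : p ≤ B.ncard := by
  classical
  have hsm : ∀ k ∈ G, ∀ y ∈ B, k y ∈ B → k '' B = B := fun k hk y hy hky =>
    (isBlock_iff_smul_eq_of_mem.1 hB) (g := ⟨k, hk⟩) hy hky
  have hpow : ∀ (k : Perm α) (i : ℕ), k '' B = B → (k ^ i) '' B = B := by
    intro k i hk
    induction i with
    | zero => simp
    | succ i ih =>
      rw [pow_succ, Perm.coe_mul, Set.image_comp, hk, ih]
  have hgB : g '' B = B := by
    by_contra hne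
    have hsub : ∀ y ∈ B, y ∈ g.support := by
      intro y hy
      rw [mem_support]
      intro hgy
      exact hne (hsm g hg y hy (by rwa [hgy]))
    obtain ⟨y, hy, hyx⟩ := hBn.exists_ne x
    obtain ⟨i, hi⟩ := hgc.exists_pow_eq (mem_support.1 hxg) (mem_support.1 (hsub y hy))
    have hiB : (g ^ i) '' B = B := hsm _ (G.pow_mem hg i) x hx (hi ▸ hy)
    have hord : orderOf g = p := by rw [hgc.orderOf, hgp]
    have hcop : i.Coprime (orderOf g) := by
      rw [hord, Nat.coprime_comm, hp.coprime_iff_not_dvd]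
      intro hdvd
      rw [← hord, orderOf_dvd_iff_pow_eq_one] at hdvd
      rw [hdvd] at hi
      exact hyx hi.symm
    obtain ⟨j, hj⟩ := exists_pow_eq_self_of_coprime hcop
    exact hne (by rw [← hj]; exact hpow _ j hiB)
  rw [← hgp, ← Set.ncard_coe_finset]
  refine Set.ncard_le_ncard (fun y hy => ?_) (Set.toFinite _)
  obtain ⟨i, rfl⟩ := hgc.exists_pow_eq (mem_support.1 hxg) (mem_support.1 hy)
  rw [← hpow g i hgB]
  exact ⟨x, hx, rfl⟩

lemma exists_hasBlocks {ρ q : Perm α} [IsPretransitive (Subgroup.closure {ρ, q}) α] {B : Set α}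
    (hB : IsBlock (Subgroup.closure {ρ, q}) B) {x : α} (hx : x ∈ B) (hBu : B ≠ Set.univ) :
    ∃ m, 2 ≤ m ∧ m * B.ncard = Fintype.card α ∧ HasBlocks ρ q m B.ncard := by
  classical
  set G := Subgroup.closure {ρ, q} with hG
  choose h hh using fun a => IsPretransitive.exists_smul_eq (M := G) x a
  set F : α → Set α := fun a => h a • B with hF
  have hmem : ∀ a, a ∈ F a := fun a => ⟨x, hx, hh a⟩
  have heq : ∀ (k : G) (a : α), a ∈ k • B → F a = k • B := by
    intro k a ha
    by_contra hne
    exact Set.disjoint_left.1 (hB hne) (hmem a) ha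
  have hiff : ∀ a c, F c = F a ↔ c ∈ F a := by
    intro a c
    exact ⟨fun h => h ▸ hmem c, fun hc => heq _ _ hc⟩
  have hequiv : ∀ (k : G) (a : α), F (k • a) = k • F a := by
    intro k a
    simp only [hF]
    rw [← mul_smul]
    refine heq _ _ ?_
    rw [mul_smul]
    exact Set.smul_mem_smul_set (hmem a)
  set I := (univ : Finset α).image F with hI
  have hFI : ∀ a, F a ∈ I := fun a => mem_image_of_mem _ (mem_univ _)
  let e : I ≃ Fin I.card := I.equivFin
  let f : α → Fin I.card := fun a => e ⟨F a, hFI a⟩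
  have hf : ∀ a c, f a = f c ↔ F a = F c := by
    intro a c; simp [f]
  have hfs : Function.Surjective f := by
    intro i
    obtain ⟨a, -, ha⟩ := mem_image.1 (e.symm i).2
    refine ⟨a, ?_⟩
    simp only [f]
    rw [← e.apply_symm_apply i]
    congr 1
    exact Subtype.ext ha
  have hcard : ∀ i, (univ.filter (fun a => f a = i)).card = B.ncard := by
    intro i
    obtain ⟨a, rfl⟩ := hfs i
    have : ((univ.filter (fun c => f c = f a) : Finset α) : Set α) = F a := by
      ext c
      simp [hf, hiff]
    rw [← Set.ncard_coe_finset, this]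
    exact Set.ncard_image_of_injective _ (MulAction.injective (h a))
  have hmb : I.card * B.ncard = Fintype.card α := by
    rw [← card_univ, card_eq_sum_card_fiberwise (f := f) (t := univ) (by simp)]
    simp [hcard]
  have hact : ∀ k ∈ G, ∃ s : Fin I.card → Fin I.card, f ∘ k = s ∘ f := by
    intro k hk
    refine ⟨fun i => f (k (Function.surjInv hfs i)), funext fun a => ?_⟩
    simp only [Function.comp]
    rw [hf]
    have h1 : F (Function.surjInv hfs (f a)) = F a := (hf _ _).1 (Function.surjInv_eq hfs (f a))
    have h2 := hequiv ⟨k, hk⟩ a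
    have h3 := hequiv ⟨k, hk⟩ (Function.surjInv hfs (f a))
    rw [h1] at h3
    exact h2.trans h3.symm
  obtain ⟨s, hs⟩ := hact ρ (Subgroup.subset_closure (by simp))
  obtain ⟨t, ht⟩ := hact q (Subgroup.subset_closure (by simp))
  refine ⟨I.card, ?_, hmb, f, hcard, s, t, hs, ht⟩
  have hlt : B.ncard < Fintype.card α := by
    rw [← Nat.card_eq_fintype_card]
    exact Set.ncard_lt_card hBu
  by_contra! h2
  have : I.card * B.ncard ≤ 1 * B.ncard := Nat.mul_le_mul_right _ (by omega)
  omega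

theorem alternatingGroup_le_closure {ρ q g : Perm α} {p : ℕ} (hT : NoSmallInvariant ρ q)
    (hp : p.Prime) (hpn : 2 * p ≤ Fintype.card α) (hgc : g.IsCycle) (hgp : g.support.card = p)
    (hg : g ∈ Subgroup.closure {ρ, q})
    (hb : ∀ m b, 2 ≤ m → p ≤ b → m * b = Fintype.card α → ¬ HasBlocks ρ q m b) :
    alternatingGroup α ≤ Subgroup.closure {ρ, q} := by
  have := isPretransitive_of_noSmallInvariant hT
  refine alternatingGroup_le_of_prime_cycle ?_ hp hpn hgc hgp hg
  refine { isTrivialBlock_of_isBlock := fun {B} hB => ?_ }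
  by_contra hnt
  unfold IsTrivialBlock at hnt
  rw [not_or, Set.not_subsingleton_iff] at hnt
  obtain ⟨hBn, hBu⟩ := hnt
  obtain ⟨b, hbB⟩ := hBn.nonempty
  obtain ⟨x, hx⟩ := hgc.nonempty_support
  obtain ⟨k, hk⟩ := IsPretransitive.exists_smul_eq (M := Subgroup.closure {ρ, q}) b x
  have hxB : x ∈ k • B := ⟨b, hbB, hk⟩
  have hB' := hB.translate k
  have hBu' : k • B ≠ Set.univ := fun h => hBu (by
    rw [← Set.smul_set_univ (a := k)] at h
    exact smul_left_cancel k h)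
  obtain ⟨m, hm, hmb, hbl⟩ := exists_hasBlocks hB' hxB hBu'
  exact hb m _ hm (prime_le_ncard_block hB' (hBn.image (MulAction.injective k)) hg hgc hp hgp hxB hx)
    hmb hbl

end Blocks

lemma pow_mul_factorial_pow_le (m b : ℕ) :
    (m ^ b * b.factorial) ^ m ≤ (m * (b + 1)).factorial := by
  induction b with
  | zero => simpa using Nat.one_le_iff_ne_zero.2 (Nat.factorial_ne_zero m)
  | succ b ih =>
    calc (m ^ (b + 1) * (b + 1).factorial) ^ m
        = (m ^ b * b.factorial) ^ m * (m * (b + 1)) ^ m := by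
          rw [← mul_pow, Nat.factorial_succ]; ring
      _ ≤ (m * (b + 1)).factorial * (m * (b + 1) + 1) ^ m := by gcongr; omega
      _ ≤ (m * (b + 1) + m).factorial := Nat.factorial_mul_pow_le_factorial
      _ = _ := by congr 1

lemma factorial_pow_mul_pow_le {m b n : ℕ} (hn : m * b = n) (hn0 : 0 < n) :
    b.factorial ^ m * m ^ n ≤ n ^ m * n.factorial := by
  obtain ⟨b, rfl⟩ : ∃ c, b = c + 1 := Nat.exists_eq_succ_of_ne_zero (by rintro rfl; omega)
  subst hn
  calc (b + 1).factorial ^ m * m ^ (m * (b + 1))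
      = (m * (b + 1)) ^ m * (m ^ b * b.factorial) ^ m := by
        rw [mul_comm m (b + 1), pow_mul, ← mul_pow, ← mul_pow, Nat.factorial_succ]; ring
    _ ≤ _ := by gcongr; exact pow_mul_factorial_pow_le m b

lemma card_semiconj_le (q : Perm α) {m : ℕ} (t : Fin m → Fin m) :
    (univ.filter (fun f : α → Fin m => f ∘ q = t ∘ f)).card ≤ m ^ (orbs q).card := by
  have hrep : ∀ O : orbs q, ∃ x, orb q x = O.1 := fun O => by
    obtain ⟨x, -, hx⟩ := mem_image.1 O.2
    exact ⟨x, hx⟩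
  choose r hr using hrep
  have hit : ∀ f : α → Fin m, f ∘ q = t ∘ f → ∀ (i : ℕ) x, f ((q ^ i) x) = t^[i] (f x) := by
    intro f hf i
    induction i with
    | zero => intro x; rfl
    | succ i ih =>
      intro x
      rw [pow_succ, Perm.mul_apply, ih, Function.iterate_succ_apply]
      exact congrArg _ (congrFun hf x)
  calc _ ≤ (univ : Finset (orbs q → Fin m)).card := by
        refine card_le_card_of_injOn (fun f O => f (r O)) (fun _ _ => mem_coe.2 (mem_univ _)) ?_
        intro f hf g hg hfg
        rw [mem_coe, mem_filter] at hf hg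
        funext a
        set O : orbs q := ⟨orb q a, orb_mem_orbs q a⟩ with hO
        have ha : a ∈ orb q (r O) := by rw [hr O]; exact self_mem_orb q a
        obtain ⟨i, hi⟩ : ∃ i : ℕ, (q ^ i) (r O) = a := by
          obtain ⟨i, -, hi⟩ := exists_pow_of_mem_orb ha
          exact ⟨i, hi⟩
        rw [← hi, hit f hf.2, hit g hg.2]
        exact congrArg _ (congrFun hfg O)
    _ = _ := by simp

lemma card_comp_eq_le {m b : ℕ} (f f' : α → Fin m)
    (hf : ∀ i, (univ.filter (fun a => f a = i)).card = b) :
    (univ.filter (fun σ : Perm α => f ∘ σ = f')).card ≤ b.factorial ^ m := by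
  rcases (univ.filter (fun σ : Perm α => f ∘ σ = f')).eq_empty_or_nonempty with h | ⟨σ₀, h⟩
  · rw [h]; simp
  have hσ₀ := (mem_filter.1 h).2
  calc _ ≤ (univ.filter (fun σ : Perm α => f ∘ σ = f)).card := by
        refine card_le_card_of_injOn (fun σ => σ * σ₀⁻¹) ?_ (fun _ _ _ _ h => mul_right_cancel h)
        intro σ hσ
        rw [mem_coe, mem_filter] at hσ ⊢
        refine ⟨mem_univ _, funext fun a => ?_⟩
        have h1 := congrFun hσ.2 (σ₀⁻¹ a)
        have h2 := congrFun hσ₀ (σ₀⁻¹ a)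
        simp only [Function.comp] at h1 h2
        simp only [Function.comp, Perm.mul_apply]
        rw [h1, ← h2]
        simp
    _ = Fintype.card {g : Perm α // f ∘ g = f} := (Fintype.card_subtype _).symm
    _ = ∏ i, (Fintype.card {a // f a = i}).factorial := DomMulAct.stabilizer_card f
    _ = ∏ _i : Fin m, b.factorial := prod_congr rfl fun i _ => by rw [Fintype.card_subtype, hf]
    _ = _ := by simp

open Classical in
lemma card_hasBlocks_conj_le (p q : Perm α) (m b : ℕ) :
    (univ.filter (fun σ : Perm α => HasBlocks (σ * p * σ⁻¹) q m b)).card ≤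
      m ^ (2 * m + (orbs p).card + (orbs q).card) * b.factorial ^ m := by
  set S := fun r : Perm α => fun s : Fin m → Fin m =>
    univ.filter (fun f : α → Fin m => f ∘ r = s ∘ f) with hS
  set T := fun t : Fin m → Fin m =>
    (S q t).filter (fun f => ∀ i, (univ.filter (fun a => f a = i)).card = b) with hT
  have hsub : univ.filter (fun σ : Perm α => HasBlocks (σ * p * σ⁻¹) q m b) ⊆
      (univ : Finset ((Fin m → Fin m) × (Fin m → Fin m))).biUnion fun st =>
        (S p st.1 ×ˢ T st.2).biUnion fun g => univ.filter (fun σ : Perm α => g.2 ∘ σ = g.1) := by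
    intro σ hσ
    obtain ⟨-, f, hfb, s, t, hs, ht⟩ := mem_filter.1 hσ
    refine mem_biUnion.2 ⟨(s, t), mem_univ _, mem_biUnion.2 ⟨(f ∘ σ, f), mem_product.2
      ⟨mem_filter.2 ⟨mem_univ _, funext fun a => ?_⟩,
        mem_filter.2 ⟨mem_filter.2 ⟨mem_univ _, ht⟩, hfb⟩⟩, by simp⟩⟩
    have := congrFun hs (σ a)
    simpa using this
  refine (card_le_card hsub).trans (card_biUnion_le.trans ?_)
  calc _ ≤ ∑ _st : (Fin m → Fin m) × (Fin m → Fin m),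
        m ^ (orbs p).card * m ^ (orbs q).card * b.factorial ^ m := by
        refine sum_le_sum fun st _ => card_biUnion_le.trans ?_
        calc _ ≤ ∑ g ∈ S p st.1 ×ˢ T st.2, b.factorial ^ m := by
              refine sum_le_sum fun g hg => card_comp_eq_le _ _ ?_
              exact (mem_filter.1 (mem_product.1 hg).2).2
          _ = (S p st.1).card * (T st.2).card * b.factorial ^ m := by
              rw [sum_const, card_product, smul_eq_mul]
          _ ≤ _ := by
              gcongr
              · exact card_semiconj_le p st.1
              · exact (card_le_card (filter_subset _ _)).trans (card_semiconj_le q st.2)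
    _ = _ := by
      rw [sum_const, card_univ, Fintype.card_prod, Fintype.card_fun, Fintype.card_fin, smul_eq_mul]
      ring

open Classical in
lemma card_hasBlocks_le {p q : Perm α} {m b d : ℕ} (hm : 2 ≤ m) (hmb : m * b = Fintype.card α)
    (hn : 0 < Fintype.card α) (hd : (orbs p).card + (orbs q).card + d ≤ Fintype.card α) :
    (((cls p).filter (fun ρ => HasBlocks ρ q m b)).card : ℝ) ≤
      (Fintype.card α : ℝ) ^ (3 * m) / 2 ^ d * (cls p).card := by
  apply card_filter_cls_le
  set n := Fintype.card α with hnd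
  have h1 := card_hasBlocks_conj_le p q m b
  set N := (univ.filter (fun σ : Perm α => HasBlocks (σ * p * σ⁻¹) q m b)).card with hN
  have hmn : m ≤ n := by
    rw [← hmb]; exact Nat.le_mul_of_pos_right _ (Nat.pos_of_ne_zero (by rintro rfl; omega))
  have h2 : N * 2 ^ d ≤ n ^ (3 * m) * n.factorial := by
    have hm0 : 0 < m ^ ((orbs p).card + (orbs q).card) := by positivity
    refine Nat.le_of_mul_le_mul_right ?_ hm0
    calc N * 2 ^ d * m ^ ((orbs p).card + (orbs q).card)
        ≤ N * m ^ d * m ^ ((orbs p).card + (orbs q).card) := by gcongr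
      _ = N * m ^ ((orbs p).card + (orbs q).card + d) := by rw [pow_add]; ring
      _ ≤ N * m ^ n := by gcongr; omega
      _ ≤ m ^ (2 * m + (orbs p).card + (orbs q).card) * b.factorial ^ m * m ^ n := by gcongr
      _ = m ^ (2 * m + (orbs p).card + (orbs q).card) * (b.factorial ^ m * m ^ n) := by ring
      _ ≤ m ^ (2 * m + (orbs p).card + (orbs q).card) * (n ^ m * n.factorial) := by
          exact Nat.mul_le_mul_left _ (factorial_pow_mul_pow_le hmb hn)
      _ = m ^ (2 * m) * n ^ m * n.factorial * m ^ ((orbs p).card + (orbs q).card) := by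
          rw [add_assoc, pow_add m (2 * m)]; ring
      _ ≤ n ^ (2 * m) * n ^ m * n.factorial * m ^ ((orbs p).card + (orbs q).card) := by gcongr
      _ = _ := by rw [← pow_add]; congr 3; ring
  rw [Fintype.card_perm, ← hnd, div_mul_eq_mul_div, le_div_iff₀ (by positivity)]
  exact_mod_cast h2

open Classical in
/-- Few members of a class generate, together with `q`, a group with a block system with large
blocks. -/
theorem card_exists_hasBlocks_le {p q : Perm α} {P d : ℕ} (hP : 0 < P) (hn : 0 < Fintype.card α)
    (hd : (orbs p).card + (orbs q).card + d ≤ Fintype.card α) :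
    (((cls p).filter (fun ρ => ∃ m b, 2 ≤ m ∧ P ≤ b ∧ m * b = Fintype.card α ∧
      HasBlocks ρ q m b)).card : ℝ) ≤
      Fintype.card α * ((Fintype.card α : ℝ) ^ (3 * (Fintype.card α / P)) / 2 ^ d) *
        (cls p).card := by
  set n := Fintype.card α with hnd
  set Ms := (Icc 1 n).filter (fun m => 2 ≤ m ∧ m ≤ n / P ∧ m * (n / m) = n) with hMs
  have hsub : (cls p).filter (fun ρ => ∃ m b, 2 ≤ m ∧ P ≤ b ∧ m * b = n ∧ HasBlocks ρ q m b) ⊆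
      Ms.biUnion fun m => (cls p).filter (fun ρ => HasBlocks ρ q m (n / m)) := by
    intro ρ hρ
    obtain ⟨hc, m, b, hm, hb, hmb, h⟩ := mem_filter.1 hρ
    have hb' : n / m = b := by rw [← hmb, Nat.mul_div_cancel_left _ (by omega)]
    refine mem_biUnion.2 ⟨m, mem_filter.2 ⟨mem_Icc.2 ⟨by omega, ?_⟩, hm, ?_, by rw [hb', hmb]⟩,
      mem_filter.2 ⟨hc, hb'.symm ▸ h⟩⟩
    · rw [← hmb]; exact Nat.le_mul_of_pos_right _ (by omega)
    · rw [Nat.le_div_iff_mul_le hP, ← hmb]; gcongr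
  have hn1 : (1 : ℝ) ≤ n := by exact_mod_cast hn
  calc _ ≤ ((Ms.biUnion fun m => (cls p).filter (fun ρ => HasBlocks ρ q m (n / m))).card : ℝ) := by
        exact_mod_cast card_le_card hsub
    _ ≤ ∑ m ∈ Ms, (((cls p).filter (fun ρ => HasBlocks ρ q m (n / m))).card : ℝ) := by
        exact_mod_cast card_biUnion_le
    _ ≤ ∑ m ∈ Ms, (n : ℝ) ^ (3 * (n / P)) / 2 ^ d * (cls p).card := by
        refine sum_le_sum fun m hm => ?_
        obtain ⟨-, hm2, hmP, hmn⟩ := mem_filter.1 hm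
        refine (card_hasBlocks_le hm2 hmn hn hd).trans ?_
        gcongr
    _ = Ms.card * ((n : ℝ) ^ (3 * (n / P)) / 2 ^ d * (cls p).card) := by
        rw [sum_const, nsmul_eq_mul]
    _ ≤ n * ((n : ℝ) ^ (3 * (n / P)) / 2 ^ d * (cls p).card) := by
        gcongr
        calc Ms.card ≤ (Icc 1 n).card := card_le_card (filter_subset _ _)
          _ = n := by simp
    _ = _ := by ring

lemma card_fixed_conj (p σ : Perm α) :
    (univ.filter (fun x => (σ * p * σ⁻¹) x = x)).card = (univ.filter (fun x => p x = x)).card := by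
  refine card_bij (fun x _ => σ⁻¹ x) ?_ ?_ ?_
  · intro x hx
    exact (mem_filter.2 ⟨mem_univ _, (Perm.eq_inv_iff_eq).2 (mem_filter.1 hx).2⟩)
  · intro x _ y _ h
    exact σ⁻¹.injective h
  · intro y hy
    refine ⟨σ y, ?_, by simp⟩
    exact mem_filter.2 ⟨mem_univ _, by simpa using (mem_filter.1 hy).2⟩

/-- A pair with no small invariant set, no large blocks and a cycle of prime length `p`, with no
other cycle of length divisible by `p`, generates a group containing the alternating group. -/
lemma alternatingGroup_le_of_per {ρ q : Perm α} {p m : ℕ} {x : α} (hT : NoSmallInvariant ρ q)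
    (hp : p.Prime) (hmp : m ≤ p) (hpn : 2 * p ≤ Fintype.card α) (hx : per (ρ * q) x = p)
    (hout : ∀ y, y ∉ orb (ρ * q) x → ¬ p ∣ per (ρ * q) y)
    (hb : ∀ k b, 2 ≤ k → m ≤ b → k * b = Fintype.card α → ¬ HasBlocks ρ q k b) :
    alternatingGroup α ≤ Subgroup.closure {ρ, q} := by
  obtain ⟨k, hk, hs⟩ := exists_isCycle_pow hp hx hout
  refine alternatingGroup_le_closure hT hp hpn hk (by rw [hs]; exact hx)
    (Subgroup.pow_mem _ (Subgroup.mul_mem _ (Subgroup.subset_closure (by simp))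
      (Subgroup.subset_closure (by simp))) k) fun k b hk hpb => hb k b hk (hmp.trans hpb)

open Classical in
/-- A lower bound for the number of conjugates of `p` generating, together with `q`, a group
containing the alternating group. -/
theorem le_card_generating {p q : Perm α} {A c ε : ℝ} (hA : 0 < A) (hc : 0 < c) (hc1 : c ≤ 1)
    (hn : A ≤ (c ^ 3 / (128 * A)) ^ 3 * Fintype.card α) (hcore : CoreBound p q A c)
    (hε : 0 < ε) (hεc : 8 * ε * Real.log (Fintype.card α + 1) ≤ c) {M m K d f : ℕ}
    (hm : 0 < m) (hM : 3 * (M + 1) ≤ Fintype.card α) (hM' : 12 * M ≤ Fintype.card α)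
    (hMK : 4 * M ≤ K) (hK : 4 * K ≤ Fintype.card α) (hK0 : 0 < K)
    (hd : (orbs p).card + (orbs q).card + d ≤ Fintype.card α)
    (hf : (univ.filter (fun x => q x = x)).card + (univ.filter (fun x => p x = x)).card ≤ f)
    (P : Finset ℕ) (hP : ∀ r ∈ P, r.Prime ∧ m ≤ r ∧ r ≤ M) (hS : 0 < ∑ r ∈ P, (1 : ℝ) / r) :
    (Real.exp (-(4 * A / c)) - (4 * A / c * Real.exp (-(c / (4 * ε))) +
      Fintype.card α * ((Fintype.card α : ℝ) ^ (3 * (Fintype.card α / m)) / 2 ^ d) +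
      (4 / (∑ r ∈ P, (1 : ℝ) / r) +
        (3 * M / ε + (M + 1) * f + 6 * M ^ 2) / Fintype.card α) +
      36 * (∑ r ∈ P, (1 : ℝ) / r) * (1 + Real.log (Fintype.card α)) / (ε ^ 2 * m) +
      (80 * Fintype.card α * Nat.log 2 (2 * Fintype.card α) / (ε * m * K) +
        36 * K * (∑ r ∈ P, (1 : ℝ) / r) / (Fintype.card α * ε ^ 3)))) * (cls p).card ≤
    ((cls p).filter (fun ρ => alternatingGroup α ≤ Subgroup.closure {ρ, q})).card := by
  have hn0 : 0 < Fintype.card α := by omega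
  have hnR : (0 : ℝ) < Fintype.card α := by exact_mod_cast hn0
  have b0 := le_card_noSmallInvariant hA hc hc1 hn hcore
  have b1 := card_not_expanding_le hA hc hε hεc hcore
  have b2 := card_exists_hasBlocks_le hm hn0 hd
  have b3 := existence_bound (conjClosed_cls p) q hε hM P
    (fun r hr => ⟨hm.trans_le (hP r hr).2.1, (hP r hr).2.2⟩) (f := f) (by
      intro ρ hρ
      obtain ⟨σ, rfl⟩ := mem_cls.1 hρ
      rw [card_fixed_conj]; exact hf)
  have b4 := small_cycle_bound (conjClosed_cls p) q hε P hm (fun r hr => (hP r hr).2.1)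
  have b5 := large_cycle_bound (conjClosed_cls p) q hε P (fun r hr => (hP r hr).1) hm hK0 hK
    (fun r hr => ⟨(hP r hr).2.1, by have := (hP r hr).2.2; omega,
      by have := (hP r hr).2.2; omega⟩)
  have hsub : (cls p).filter (fun ρ => NoSmallInvariant ρ q) ⊆
      (cls p).filter (fun ρ => alternatingGroup α ≤ Subgroup.closure {ρ, q}) ∪
      ((cls p).filter (fun ρ => NoSmallInvariant ρ q ∧ ¬ Expanding ε ρ q) ∪
      ((cls p).filter (fun ρ => ∃ k b, 2 ≤ k ∧ m ≤ b ∧ k * b = Fintype.card α ∧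
        HasBlocks ρ q k b) ∪
      ((cls p).filter (fun ρ => Expanding ε ρ q ∧ ∀ y, per (ρ * q) y ∉ P) ∪
      ((cls p).filter (fun ρ => Expanding ε ρ q ∧ ∃ r ∈ P, ∃ x c, per (ρ * q) x = r ∧
        c ∉ orb (ρ * q) x ∧ r ∣ per (ρ * q) c ∧ 3 * (r + per (ρ * q) c) ≤ Fintype.card α) ∪
      (cls p).filter (fun ρ => Expanding ε ρ q ∧ ∃ r ∈ P, ∃ x c, per (ρ * q) x = r ∧
        c ∉ orb (ρ * q) x ∧ r ∣ per (ρ * q) c ∧ Fintype.card α ≤ 4 * per (ρ * q) c))))) := by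
    intro ρ hρ
    obtain ⟨hρC, hT⟩ := mem_filter.1 hρ
    simp only [mem_union, mem_filter, hρC, true_and]
    by_contra! hcon
    obtain ⟨g1, g2, g3, g4, g5, g6⟩ := hcon
    have hE := g2 hT
    obtain ⟨x, hx⟩ := g4 hE
    obtain ⟨hr, hmr, hrM⟩ := hP _ hx
    refine g1 (alternatingGroup_le_of_per hT hr hmr (by omega) rfl (fun y hy hdvd => ?_) g3)
    by_cases h3 : 3 * (per (ρ * q) x + per (ρ * q) y) ≤ Fintype.card α
    · exact absurd h3 (not_le.2 (g5 hE _ hx x y rfl hy hdvd))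
    · exact absurd (le_four_mul_of_lt (by omega) h3) (not_le.2 (g6 hE _ hx x y rfl hy hdvd))
  have hle := (card_le_card hsub).trans ((card_union_le _ _).trans (Nat.add_le_add_left
    ((card_union_le _ _).trans (Nat.add_le_add_left ((card_union_le _ _).trans
    (Nat.add_le_add_left ((card_union_le _ _).trans (Nat.add_le_add_left
    (card_union_le _ _) _)) _)) _)) _))
  have hle' := (Nat.cast_le (α := ℝ)).2 hle
  simp only [Nat.cast_add] at hle'
  set S := ∑ r ∈ P, (1 : ℝ) / r
  have b3' : (((cls p).filter (fun ρ => Expanding ε ρ q ∧ ∀ y, per (ρ * q) y ∉ P)).card : ℝ) ≤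
      (4 / S + (3 * M / ε + (M + 1) * f + 6 * M ^ 2) / Fintype.card α) * (cls p).card := by
    generalize (((cls p).filter (fun ρ => Expanding ε ρ q ∧ ∀ y, per (ρ * q) y ∉ P)).card : ℝ) = B
      at b3
    generalize (3 * (M : ℝ) / ε + (M + 1) * f + 6 * M ^ 2) = T at b3 ⊢
    have : (4 / S + T / Fintype.card α) * (cls p).card =
        (4 * Fintype.card α * (cls p).card + S * (T * (cls p).card)) / (S * Fintype.card α) := by
      field_simp
    rw [this, le_div_iff₀ (by positivity)]
    linarith
  have c1 : (((cls p).filter (fun ρ => NoSmallInvariant ρ q ∧ ¬ Expanding ε ρ q)).card : ℝ) ≤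
      4 * A / c * Real.exp (-(c / (4 * ε))) * (cls p).card := by convert b1
  have c2 : (((cls p).filter (fun ρ => ∃ k b, 2 ≤ k ∧ m ≤ b ∧ k * b = Fintype.card α ∧
        HasBlocks ρ q k b)).card : ℝ) ≤ Fintype.card α *
      ((Fintype.card α : ℝ) ^ (3 * (Fintype.card α / m)) / 2 ^ d) * (cls p).card := by convert b2
  have c4 : (((cls p).filter (fun ρ => Expanding ε ρ q ∧ ∃ r ∈ P, ∃ x c, per (ρ * q) x = r ∧
        c ∉ orb (ρ * q) x ∧ r ∣ per (ρ * q) c ∧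
        3 * (r + per (ρ * q) c) ≤ Fintype.card α)).card : ℝ) ≤
      36 * S * (1 + Real.log (Fintype.card α)) / (ε ^ 2 * m) * (cls p).card := by convert b4
  have c5 : (((cls p).filter (fun ρ => Expanding ε ρ q ∧ ∃ r ∈ P, ∃ x c, per (ρ * q) x = r ∧
        c ∉ orb (ρ * q) x ∧ r ∣ per (ρ * q) c ∧
        Fintype.card α ≤ 4 * per (ρ * q) c)).card : ℝ) ≤
      (80 * Fintype.card α * Nat.log 2 (2 * Fintype.card α) / (ε * m * K) +
        36 * K * S / (Fintype.card α * ε ^ 3)) * (cls p).card := by convert b5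
  have c0 : Real.exp (-(4 * A / c)) * (cls p).card ≤ (((cls p).filter (fun ρ => NoSmallInvariant ρ q)).card : ℝ) := by convert b0
  have key : ∀ {N k e1 e2 e3 e4 e5 g x0 x1 x2 x3 x4 x5 : ℝ}, k * N ≤ x0 → x1 ≤ e1 * N →
      x2 ≤ e2 * N → x3 ≤ e3 * N → x4 ≤ e4 * N → x5 ≤ e5 * N →
      x0 ≤ g + (x1 + (x2 + (x3 + (x4 + x5)))) → (k - (e1 + e2 + e3 + e4 + e5)) * N ≤ g := by
    intros; linarith
  refine key c0 c1 c2 b3' c4 c5 ?_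
  convert hle'

lemma eventually_theta_sub_ge :
    ∀ᶠ k : ℕ in atTop, 3 * Real.log 2 * 8 ^ k ≤
      Chebyshev.theta ((8 ^ (k + 1) : ℕ) : ℝ) - Chebyshev.theta ((8 ^ k : ℕ) : ℝ) := by
  have hlog := (isLittleO_log_rpow_atTop (r := 1 / 2) (by norm_num)).bound
    (show (0 : ℝ) < 1 / 20 by norm_num)
  have htend : Tendsto (fun k : ℕ => ((8 ^ (k + 1) : ℕ) : ℝ)) atTop atTop :=
    tendsto_natCast_atTop_atTop.comp
      ((tendsto_pow_atTop_atTop_of_one_lt (by norm_num)).comp (tendsto_add_atTop_nat 1))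
  filter_upwards [htend.eventually hlog, htend.eventually (eventually_ge_atTop (2 : ℝ))]
    with k hk hk2
  have h1 := Chebyshev.theta_ge (8 ^ (k + 1))
  have h2 := Chebyshev.theta_le_log4_mul_x (x := ((8 ^ k : ℕ) : ℝ)) (by positivity)
  set y : ℝ := ((8 ^ (k + 1) : ℕ) : ℝ) with hy
  have hy8 : y = 8 * 8 ^ k := by rw [hy]; push_cast; ring
  have hlog4 : Real.log 4 = 2 * Real.log 2 := by
    rw [show (4 : ℝ) = 2 ^ 2 by norm_num, Real.log_pow]; norm_num
  have hl : 0 ≤ Real.log y := Real.log_nonneg (by linarith)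
  rw [← Real.sqrt_eq_rpow, Real.norm_of_nonneg hl, Real.norm_of_nonneg (Real.sqrt_nonneg _)] at hk
  have hs : √y * √y = y := Real.mul_self_sqrt (by linarith)
  have hs1 : 1 ≤ √y := Real.one_le_sqrt.2 (by linarith)
  have hl2 : Real.log (y + 1) ≤ 2 * Real.log y := by
    have : Real.log (y + 1) ≤ Real.log (y ^ 2) := Real.log_le_log (by linarith) (by nlinarith)
    rwa [Real.log_pow, Nat.cast_ofNat] at this
  have h3 : 2 * √y * Real.log y ≤ y / 10 := by nlinarith
  have h4 : Real.log (y + 1) ≤ y / 10 := by nlinarith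
  rw [hlog4] at h2
  push_cast at h2 ⊢
  have h5 := Real.log_two_gt_d9
  have h6 : (0 : ℝ) < 8 ^ k := by positivity
  nlinarith

lemma theta_sub_le (k : ℕ) :
    Chebyshev.theta ((8 ^ (k + 1) : ℕ) : ℝ) - Chebyshev.theta ((8 ^ k : ℕ) : ℝ) ≤
      3 * Real.log 2 * (k + 1) * 8 ^ (k + 1) *
        ∑ p ∈ (Ioc (8 ^ k) (8 ^ (k + 1))).filter Nat.Prime, (1 : ℝ) / p := by
  have hle : 8 ^ k ≤ 8 ^ (k + 1) := Nat.pow_le_pow_right (by norm_num) (by omega)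
  have h : Chebyshev.theta ((8 ^ (k + 1) : ℕ) : ℝ) - Chebyshev.theta ((8 ^ k : ℕ) : ℝ) =
      ∑ p ∈ (Ioc (8 ^ k) (8 ^ (k + 1))).filter Nat.Prime, Real.log p := by
    rw [sub_eq_iff_eq_add', Chebyshev.theta, Chebyshev.theta, Nat.floor_natCast, Nat.floor_natCast,
      ← sum_union]
    · rw [← filter_union, Ioc_union_Ioc_eq_Ioc (by positivity) hle]
    · refine disjoint_filter_filter ?_
      rw [disjoint_left]
      intro x hx hx'
      rw [mem_Ioc] at hx hx'
      omega
  rw [h, mul_sum]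
  refine sum_le_sum fun p hp => ?_
  obtain ⟨hp1, hp⟩ := mem_filter.1 hp
  have hp0 : (0 : ℝ) < p := by exact_mod_cast hp.pos
  have hpl : (p : ℝ) ≤ 8 ^ (k + 1) := by exact_mod_cast (mem_Ioc.1 hp1).2
  have h1 : Real.log p ≤ 3 * Real.log 2 * (k + 1) := by
    refine (Real.log_le_log hp0 hpl).trans (le_of_eq ?_)
    rw [Real.log_pow, show (8 : ℝ) = 2 ^ 3 by norm_num, Real.log_pow]
    push_cast; ring
  have h2 : 1 ≤ (8 : ℝ) ^ (k + 1) * (1 / p) := by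
    rw [mul_one_div, le_div_iff₀ hp0]; linarith
  have h3 : 0 ≤ 3 * Real.log 2 * ((k : ℝ) + 1) := by
    have : 0 < Real.log 2 := Real.log_pos (by norm_num)
    positivity
  calc Real.log p ≤ 3 * Real.log 2 * (k + 1) * 1 := by linarith
    _ ≤ 3 * Real.log 2 * (k + 1) * ((8 : ℝ) ^ (k + 1) * (1 / p)) := by gcongr
    _ = _ := by ring

lemma eventually_sum_inv_prime_ge :
    ∀ᶠ k : ℕ in atTop, 1 / (8 * ((k : ℝ) + 1)) ≤
      ∑ p ∈ (Ioc (8 ^ k) (8 ^ (k + 1))).filter Nat.Prime, (1 : ℝ) / p := by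
  filter_upwards [eventually_theta_sub_ge] with k hk
  have h := hk.trans (theta_sub_le k)
  have hlog : 0 < Real.log 2 := Real.log_pos (by norm_num)
  have h8 : (0 : ℝ) < 8 ^ k := by positivity
  rw [div_le_iff₀ (by positivity)]
  set S := ∑ p ∈ (Ioc (8 ^ k) (8 ^ (k + 1))).filter Nat.Prime, (1 : ℝ) / p
  have h2 : 3 * Real.log 2 * 8 ^ k * 1 ≤ 3 * Real.log 2 * 8 ^ k * (S * (8 * ((k : ℝ) + 1))) := by
    rw [mul_one]; refine h.trans (le_of_eq ?_); ring
  exact le_of_mul_le_mul_left h2 (by positivity)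

/-- A lower bound for the sum of the reciprocals of the primes in an interval. -/
lemma exists_le_sum_inv_prime : ∃ k₀ : ℕ, ∀ a b : ℕ, k₀ ≤ a → a ≤ b →
    1 / 8 * (Real.log (b + 1) - Real.log (a + 1)) ≤
      ∑ p ∈ (Ioc (8 ^ a) (8 ^ b)).filter Nat.Prime, (1 : ℝ) / p := by
  obtain ⟨k₀, hk₀⟩ := eventually_atTop.1 eventually_sum_inv_prime_ge
  refine ⟨k₀, fun a b ha hab => ?_⟩
  induction b, hab using Nat.le_induction with
  | base => simp
  | succ b hab ih =>
    have h1 := hk₀ b (ha.trans hab)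
    have hle : 8 ^ a ≤ 8 ^ b := Nat.pow_le_pow_right (by norm_num) hab
    have hle' : 8 ^ b ≤ 8 ^ (b + 1) := Nat.pow_le_pow_right (by norm_num) (by omega)
    have h2 : ∑ p ∈ (Ioc (8 ^ a) (8 ^ (b + 1))).filter Nat.Prime, (1 : ℝ) / p =
        ∑ p ∈ (Ioc (8 ^ a) (8 ^ b)).filter Nat.Prime, (1 : ℝ) / p +
        ∑ p ∈ (Ioc (8 ^ b) (8 ^ (b + 1))).filter Nat.Prime, (1 : ℝ) / p := by
      rw [← sum_union]
      · rw [← filter_union, Ioc_union_Ioc_eq_Ioc hle hle']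
      · refine disjoint_filter_filter ?_
        rw [disjoint_left]
        intro x hx hx'
        rw [mem_Ioc] at hx hx'
        omega
    have hb : (0 : ℝ) < b + 1 := by positivity
    have h3 : Real.log ((b : ℝ) + 1 + 1) - Real.log (b + 1) ≤ 1 / (b + 1) := by
      rw [← Real.log_div (by positivity) (by positivity)]
      refine (Real.log_le_sub_one_of_pos (by positivity)).trans (le_of_eq ?_)
      field_simp; ring
    have h4 : 1 / (8 * ((b : ℝ) + 1)) = 1 / 8 * (1 / (b + 1)) := by field_simp
    rw [h2]
    push_cast
    linarith

lemma sum_inv_prime_le (m M n : ℕ) (hMn : M ≤ n) :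
    ∑ p ∈ (Ioc m M).filter Nat.Prime, (1 : ℝ) / p ≤ 1 + Real.log n := by
  have h := harmonic_le_one_add_log n
  rw [harmonic_eq_sum_Icc] at h
  push_cast at h
  refine le_trans ?_ h
  simp only [one_div]
  refine sum_le_sum_of_subset_of_nonneg (fun p hp => ?_) fun i _ _ => by positivity
  rw [mem_filter, mem_Ioc] at hp
  exact mem_Icc.2 ⟨hp.2.pos, hp.1.2.trans hMn⟩

/-- With `a = ⌊√t⌋` and `b = ⌊t/4⌋`, the sum of the reciprocals of the primes in
`(8 ^ a, 8 ^ b]` tends to infinity with `t`. -/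
lemma tendsto_sum_inv_prime :
    Tendsto (fun t : ℕ => ∑ p ∈ (Ioc (8 ^ Nat.sqrt t) (8 ^ (t / 4))).filter Nat.Prime,
      (1 : ℝ) / p) atTop atTop := by
  obtain ⟨k₀, hk₀⟩ := exists_le_sum_inv_prime
  have hlog : Tendsto (fun t : ℕ => 1 / 8 * (1 / 2 * Real.log t - Real.log 8)) atTop atTop := by
    refine Tendsto.const_mul_atTop (by norm_num) ?_
    exact tendsto_atTop_add_const_right _ _ (Tendsto.const_mul_atTop (by norm_num)
      (Real.tendsto_log_atTop.comp tendsto_natCast_atTop_atTop))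
  refine tendsto_atTop_mono' _ ?_ hlog
  filter_upwards [eventually_ge_atTop (k₀ * k₀), eventually_ge_atTop 64] with t ht ht64
  have hs8 : 8 ≤ Nat.sqrt t := Nat.le_sqrt.2 ht64
  have hs2 : Nat.sqrt t * Nat.sqrt t ≤ t := Nat.sqrt_le t
  have hab : Nat.sqrt t ≤ t / 4 := by
    rw [Nat.le_div_iff_mul_le (by norm_num)]; nlinarith
  refine le_trans ?_ (hk₀ _ _ (Nat.le_sqrt.2 ht) hab)
  have htR : (0 : ℝ) < t := Nat.cast_pos.2 (by omega)
  have h1 : Real.log ((t : ℝ) / 4) ≤ Real.log (((t / 4 : ℕ) : ℝ) + 1) := by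
    refine Real.log_le_log (by positivity) ?_
    have : t ≤ 4 * (t / 4 + 1) := by omega
    have : (t : ℝ) ≤ 4 * (((t / 4 : ℕ) : ℝ) + 1) := by exact_mod_cast this
    linarith
  have h2 : Real.log ((Nat.sqrt t : ℝ) + 1) ≤ Real.log 2 + 1 / 2 * Real.log t := by
    have h3 : (Nat.sqrt t : ℝ) + 1 ≤ 2 * √t := by
      have := Real.nat_sqrt_le_real_sqrt (a := t)
      have h8 : (8 : ℝ) ≤ Nat.sqrt t := by exact_mod_cast hs8
      linarith
    refine (Real.log_le_log (by positivity) h3).trans (le_of_eq ?_)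
    rw [Real.log_mul (by norm_num) (by positivity), Real.log_sqrt htR.le]; ring
  rw [Real.log_div (by positivity) (by norm_num)] at h1
  have h8 : Real.log 8 = Real.log 4 + Real.log 2 := by
    rw [← Real.log_mul (by norm_num) (by norm_num)]; norm_num
  linarith

section Errors
variable {n m M K d f T : ℕ} {c ε δ S : ℝ}

lemma blocks_error_le (hT : 1 ≤ T) (hδ : 0 < δ) (hTδ : 72 / δ ≤ T) (hTm : T ^ 8 ≤ m) (hmn : m ≤ n)
    (hn : n ≤ 2 ^ (3 * T)) (hd : δ / 4 * n ≤ d + 1) :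
    (n : ℝ) * ((n : ℝ) ^ (3 * (n / m)) / 2 ^ d) ≤ 1 / T := by
  have hT1 : (1 : ℝ) ≤ T := by exact_mod_cast hT
  have hTmR : (T : ℝ) ^ 8 ≤ m := by exact_mod_cast hTm
  have hmnR : (m : ℝ) ≤ n := by exact_mod_cast hmn
  have hm0 : (0 : ℝ) < m := lt_of_lt_of_le (by positivity) hTmR
  have hT2 : (T : ℝ) * T ≤ m :=
    le_trans (by nlinarith [pow_le_pow_right₀ hT1 (show 2 ≤ 8 by norm_num)]) hTmR
  have hTδ' : 72 ≤ δ * T := by rwa [div_le_iff₀' hδ] at hTδ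
  have h1 : 4 * T + 9 * T * (n / m) ≤ d := by
    have hq : ((n / m : ℕ) : ℝ) ≤ n / m := Nat.cast_div_le
    have hq' : (9 : ℝ) * T * (n / m) ≤ δ / 8 * n := by
      rw [mul_div_assoc', div_le_iff₀ hm0]
      have : (72 : ℝ) * T ≤ δ * m := by nlinarith
      have hn0 : (0 : ℝ) ≤ n := Nat.cast_nonneg n
      nlinarith
    have h5 : (5 : ℝ) * T ≤ δ / 8 * n := by nlinarith
    have : (4 * T + 9 * T * ((n / m : ℕ) : ℝ)) ≤ d := by
      have : 9 * T * ((n / m : ℕ) : ℝ) ≤ 9 * T * (n / m) := by gcongr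
      linarith
    exact_mod_cast this
  have h2 : n * n ^ (3 * (n / m)) * T ≤ 2 ^ d := by
    calc n * n ^ (3 * (n / m)) * T ≤ 2 ^ (3 * T) * (2 ^ (3 * T)) ^ (3 * (n / m)) * 2 ^ T := by
          gcongr; exact Nat.lt_two_pow_self.le
      _ = 2 ^ (4 * T + 9 * T * (n / m)) := by
          rw [← pow_mul, ← pow_add, ← pow_add]; congr 1; ring
      _ ≤ 2 ^ d := Nat.pow_le_pow_right (by norm_num) h1
  have h3 : (n : ℝ) * (n : ℝ) ^ (3 * (n / m)) * T ≤ 2 ^ d := by exact_mod_cast h2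
  rw [le_div_iff₀ (by linarith), mul_div_assoc', div_mul_eq_mul_div, div_le_one (by positivity)]
  exact h3

lemma existence_error_le (hT : 1 ≤ T) (hTM : T ^ 8 ≤ M) (hM : M ^ 4 ≤ n) (hc : 0 < c)
    (hε : c / (24 * T) ≤ ε) (hf : f ^ 3 ≤ 8 * n ^ 2) :
    (3 * M / ε + (M + 1) * f + 6 * M ^ 2 : ℝ) / n ≤ (72 / c + 10) / T := by
  have hT1 : (1 : ℝ) ≤ T := by exact_mod_cast hT
  have hTMR : (T : ℝ) ^ 8 ≤ M := by exact_mod_cast hTM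
  have hMR : (M : ℝ) ^ 4 ≤ n := by exact_mod_cast hM
  have hfR : (f : ℝ) ^ 3 ≤ 8 * n ^ 2 := by exact_mod_cast hf
  have hTM1 : (T : ℝ) ≤ M := (le_self_pow₀ hT1 (by norm_num)).trans hTMR
  have hM1 : (1 : ℝ) ≤ M := hT1.trans hTM1
  have hT3 : (T : ℝ) ^ 3 ≤ M := (pow_le_pow_right₀ hT1 (by norm_num)).trans hTMR
  have hn0 : (0 : ℝ) < n := lt_of_lt_of_le (by positivity) hMR
  have hε0 : 0 < ε := lt_of_lt_of_le (by positivity) hε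
  have hM34 : (M : ℝ) ^ 2 * T ≤ n := by
    refine le_trans ?_ hMR
    calc (M : ℝ) ^ 2 * T ≤ (M : ℝ) ^ 2 * (M : ℝ) ^ 2 := by gcongr; nlinarith
      _ = _ := by ring
  have e1 : 3 * M / ε * T ≤ 72 / c * n := by
    have : 3 * M / ε ≤ 3 * M / (c / (24 * T)) := by gcongr
    calc 3 * M / ε * T ≤ 3 * M / (c / (24 * T)) * T := by gcongr
      _ = 72 / c * (M * T ^ 2) := by field_simp; ring
      _ ≤ 72 / c * n := by
        gcongr
        refine le_trans ?_ hMR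
        have h1 : (M : ℝ) * T ^ 2 ≤ M * M ^ 2 := by gcongr
        refine h1.trans (le_trans (le_mul_of_one_le_right (by positivity) hM1) (le_of_eq ?_))
        ring
  have e2 : (M + 1) * f * T ≤ 4 * (n : ℝ) := by
    have h : ((2 * M) * f * T : ℝ) ^ 3 ≤ (4 * n) ^ 3 := by
      have a1 : ((2 * M) * f * T : ℝ) ^ 3 = 8 * M ^ 3 * T ^ 3 * f ^ 3 := by ring
      have a2 : 8 * (M : ℝ) ^ 3 * T ^ 3 * f ^ 3 ≤ 8 * M ^ 3 * M * (8 * n ^ 2) := by gcongr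
      have a3 : 64 * ((M : ℝ) ^ 4 * n ^ 2) ≤ 64 * (n * n ^ 2) := by gcongr
      nlinarith
    have h' := le_of_pow_le_pow_left₀ (by norm_num) (by positivity) h
    refine le_trans ?_ h'
    gcongr; linarith
  have e3 : 6 * (M : ℝ) ^ 2 * T ≤ 6 * n := by linarith
  rw [div_le_div_iff₀ hn0 (by linarith)]
  linarith

lemma small_cycle_error_le (hT : 1 ≤ T) (hTm : T ^ 8 ≤ m) (hc : 0 < c)
    (hε : c / (24 * T) ≤ ε) (hS : S ≤ 4 * T) (hl : 1 + Real.log n ≤ 4 * T) :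
    36 * S * (1 + Real.log n) / (ε ^ 2 * m) ≤ 36 * 16 * 24 ^ 2 / c ^ 2 / T := by
  have hT1 : (1 : ℝ) ≤ T := by exact_mod_cast hT
  have hTmR : (T : ℝ) ^ 8 ≤ m := by exact_mod_cast hTm
  have hl0 : 0 ≤ Real.log n := Real.log_natCast_nonneg n
  have hε0 : 0 < ε := lt_of_lt_of_le (by positivity) hε
  calc 36 * S * (1 + Real.log n) / (ε ^ 2 * m) ≤
        36 * (4 * T) * (4 * T) / ((c / (24 * T)) ^ 2 * T ^ 8) := by gcongr
    _ = 36 * 16 * 24 ^ 2 / c ^ 2 * (T ^ 4 / T ^ 8) := by field_simp; norm_num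
    _ ≤ 36 * 16 * 24 ^ 2 / c ^ 2 * (1 / T) := by
        refine mul_le_mul_of_nonneg_left ?_ (by positivity)
        rw [div_le_div_iff₀ (by positivity) (by positivity)]
        rw [← pow_succ, one_mul]
        exact pow_le_pow_right₀ hT1 (by norm_num)
    _ = _ := by ring

lemma large_cycle_error_le (hT : 1 ≤ T) (hTm : T ^ 8 ≤ m) (hn : 0 < n) (hc : 0 < c)
    (hε : c / (24 * T) ≤ ε) (hS0 : 0 ≤ S) (hS : S ≤ 4 * T) (hl : Nat.log 2 (2 * n) ≤ 4 * T)
    (hK : n ≤ 2 * T ^ 5 * K) (hK' : K * T ^ 5 ≤ n) :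
    80 * n * Nat.log 2 (2 * n) / (ε * m * K) + 36 * K * S / (n * ε ^ 3) ≤
      (80 * 8 * 24 / c + 36 * 4 * 24 ^ 3 / c ^ 3) / T := by
  have hT1 : (1 : ℝ) ≤ T := by exact_mod_cast hT
  have hTmR : (T : ℝ) ^ 8 ≤ m := by exact_mod_cast hTm
  have hlR : (Nat.log 2 (2 * n) : ℝ) ≤ 4 * T := by exact_mod_cast hl
  have hKR : (n : ℝ) ≤ 2 * T ^ 5 * K := by exact_mod_cast hK
  have hKR' : (K : ℝ) * T ^ 5 ≤ n := by exact_mod_cast hK'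
  have hn0 : (0 : ℝ) < n := by exact_mod_cast hn
  have hKlow : (n : ℝ) / (2 * T ^ 5) ≤ K := by rwa [div_le_iff₀' (by positivity)]
  have hKup : (K : ℝ) ≤ n / T ^ 5 := by rwa [le_div_iff₀ (by positivity)]
  have hε0 : 0 < ε := lt_of_lt_of_le (by positivity) hε
  have e1 : 80 * n * Nat.log 2 (2 * n) / (ε * m * K) ≤ 80 * 8 * 24 / c / T := by
    calc 80 * n * Nat.log 2 (2 * n) / (ε * m * K) ≤
          80 * n * (4 * T) / (c / (24 * T) * T ^ 8 * (n / (2 * T ^ 5))) := by gcongr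
      _ = 80 * 8 * 24 / c / T := by field_simp; ring
  have e2 : 36 * K * S / (n * ε ^ 3) ≤ 36 * 4 * 24 ^ 3 / c ^ 3 / T := by
    calc 36 * K * S / (n * ε ^ 3) ≤ 36 * (n / T ^ 5) * (4 * T) / (n * (c / (24 * T)) ^ 3) := by
          gcongr
      _ = _ := by field_simp
  rw [add_div]
  exact add_le_add e1 e2

lemma expanding_error_le {A : ℝ} (hA : 0 < A) (hT : 1 ≤ T) (hTn : T ≤ n) (hc : 0 < c)
    (hε : ε = c / (8 * Real.log (n + 1))) :
    4 * A / c * Real.exp (-(c / (4 * ε))) ≤ 4 * A / c / T := by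
  have hT1 : (1 : ℝ) ≤ T := by exact_mod_cast hT
  have hTnR : (T : ℝ) ≤ n := by exact_mod_cast hTn
  have hl : 0 < Real.log ((n : ℝ) + 1) := Real.log_pos (by linarith)
  have h1 : c / (4 * ε) = 2 * Real.log (n + 1) := by rw [hε]; field_simp; ring
  have h2 : Real.exp (-(2 * Real.log ((n : ℝ) + 1))) ≤ 1 / T := by
    calc Real.exp (-(2 * Real.log ((n : ℝ) + 1))) ≤ Real.exp (-Real.log ((n : ℝ) + 1)) :=
          Real.exp_le_exp.2 (by linarith)
      _ = 1 / (n + 1) := by rw [Real.exp_neg, Real.exp_log (by linarith), one_div]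
      _ ≤ 1 / T := by gcongr; linarith
  rw [h1, div_eq_mul_one_div _ (T : ℝ)]
  gcongr

end Errors

lemma orb_eq_singleton {q : Perm α} {x : α} (h : q x = x) : orb q x = {x} := by
  ext y
  rw [mem_orb, mem_singleton]
  constructor
  · intro hs
    exact ((SameCycle.eq_of_left hs h)).symm
  · rintro rfl; exact SameCycle.refl _ _

lemma numOrb_one (q : Perm α) : numOrb q 1 = (univ.filter (fun x => q x = x)).card := by
  rw [numOrb]
  symm
  refine card_bij (fun x _ => orb q x) ?_ ?_ ?_
  · intro x hx
    refine mem_filter.2 ⟨orb_mem_orbs q x, ?_⟩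
    rw [orb_eq_singleton (mem_filter.1 hx).2, card_singleton]
  · intro x hx y hy h
    rw [orb_eq_singleton (mem_filter.1 hx).2, orb_eq_singleton (mem_filter.1 hy).2] at h
    exact singleton_injective h
  · intro O hO
    obtain ⟨hO, hc⟩ := mem_filter.1 hO
    obtain ⟨x, -, rfl⟩ := mem_image.1 hO
    refine ⟨x, mem_filter.2 ⟨mem_univ _, ?_⟩, rfl⟩
    exact (card_le_one.1 hc.le) _ (apply_mem_orb.2 (self_mem_orb q x)) _ (self_mem_orb q x)

lemma support_cycleOf_eq_orb {q : Perm α} {x : α} (h : q x ≠ x) :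
    (q.cycleOf x).support = orb q x := by
  ext y
  rw [mem_orb, mem_support_cycleOf_iff' h]

/-- Nontrivial orbits correspond to cycle factors. -/
lemma numOrb_eq_count (q : Perm α) {k : ℕ} (hk : 2 ≤ k) : numOrb q k = q.cycleType.count k := by
  rw [cycleType_def, Multiset.count_map, numOrb]
  symm
  change (q.cycleFactorsFinset.filter (fun c => k = c.support.card)).card = _
  refine card_bij (fun c _ => c.support) ?_ ?_ ?_
  · intro c hc
    obtain ⟨hc, hk'⟩ := mem_filter.1 hc
    obtain ⟨x, hx⟩ := (mem_cycleFactorsFinset_iff.1 hc).1.nonempty_support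
    have hqx : q x ≠ x := mem_support.1 (mem_cycleFactorsFinset_support_le hc hx)
    rw [cycle_is_cycleOf hx hc, support_cycleOf_eq_orb hqx]
    refine mem_filter.2 ⟨orb_mem_orbs q x, ?_⟩
    rw [← support_cycleOf_eq_orb hqx, ← cycle_is_cycleOf hx hc, ← hk']
  · intro c hc d hd h
    obtain ⟨hc, -⟩ := mem_filter.1 hc
    obtain ⟨hd, -⟩ := mem_filter.1 hd
    obtain ⟨x, hx⟩ := (mem_cycleFactorsFinset_iff.1 hc).1.nonempty_support
    rw [cycle_is_cycleOf hx hc, cycle_is_cycleOf (h ▸ hx) hd]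
  · intro O hO
    obtain ⟨hO, hc⟩ := mem_filter.1 hO
    obtain ⟨x, -, rfl⟩ := mem_image.1 hO
    have hqx : q x ≠ x := by
      intro h
      rw [orb_eq_singleton h, card_singleton] at hc
      omega
    refine ⟨q.cycleOf x, mem_filter.2 ⟨?_, ?_⟩, support_cycleOf_eq_orb hqx⟩
    · rwa [cycleOf_mem_cycleFactorsFinset_iff, mem_support]
    · rw [support_cycleOf_eq_orb hqx, hc]

lemma tendsto_log_eight : Tendsto (Nat.log 8) atTop atTop :=
  tendsto_atTop_atTop_of_monotone Nat.log_monotone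
    fun b => ⟨8 ^ b, (Nat.log_pow (by norm_num) b).ge⟩

lemma eventually_pow_le_eight_pow_sqrt : ∀ᶠ t : ℕ in atTop, (t + 1) ^ 8 ≤ 8 ^ Nat.sqrt t := by
  have h1 : ∀ᶠ s : ℕ in atTop, (s + 1) ^ 16 ≤ 8 ^ s := by
    have h := tendsto_pow_const_div_const_pow_of_one_lt 16 (show (1 : ℝ) < 8 by norm_num)
    have h' := (h.comp (tendsto_add_atTop_nat 1)).eventually (gt_mem_nhds (show (0 : ℝ) < 1 / 8 by
      norm_num))
    filter_upwards [h'] with s hs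
    simp only [Function.comp] at hs
    rw [div_lt_div_iff₀ (by positivity) (by positivity), pow_succ (8 : ℝ)] at hs
    have : ((s : ℝ) + 1) ^ 16 ≤ 8 ^ s := by push_cast at hs; linarith
    exact_mod_cast this
  have h2 : Tendsto Nat.sqrt atTop atTop :=
    tendsto_atTop_atTop_of_monotone (fun a b h => Nat.sqrt_le_sqrt h)
      fun b => ⟨b * b, (Nat.sqrt_eq b).ge⟩
  filter_upwards [h2.eventually h1] with t ht
  refine le_trans ?_ ht
  rw [show 16 = 2 * 8 by norm_num, pow_mul]
  gcongr
  have := Nat.lt_succ_sqrt t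
  rw [Nat.succ_eq_add_one] at this
  nlinarith

lemma card_orbs_add_le {p q : Perm α} {δ : ℝ} {d : ℕ} (hd : (d : ℝ) ≤ δ / 4 * Fintype.card α)
    (h2 : (numOrb p 2 + numOrb q 2 : ℝ) ≤ (1 - δ) * Fintype.card α)
    (hf : 2 * (numOrb p 1 + numOrb q 1 : ℝ) ≤ δ / 4 * Fintype.card α) :
    (orbs p).card + (orbs q).card + d ≤ Fintype.card α := by
  have a1 : (numOrb p 1 + 2 * numOrb p 2 + 3 * numBig p : ℝ) ≤ Fintype.card α := by
    exact_mod_cast numOrb_add_le p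
  have a2 : (numOrb q 1 + 2 * numOrb q 2 + 3 * numBig q : ℝ) ≤ Fintype.card α := by
    exact_mod_cast numOrb_add_le q
  have d0 : (0 : ℝ) ≤ d := Nat.cast_nonneg d
  rw [card_orbs, card_orbs]
  have : ((numOrb p 1 + (numOrb p 2 + numBig p)) + (numOrb q 1 + (numOrb q 2 + numBig q)) + d : ℝ) ≤
      Fintype.card α := by linarith
  exact_mod_cast this

lemma add_pow_three_le {a b n : ℕ} (ha : a ^ 3 ≤ n ^ 2) (hb : b ^ 3 ≤ n ^ 2) :
    (a + b) ^ 3 ≤ 8 * n ^ 2 := by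
  wlog h : a ≤ b generalizing a b
  · rw [add_comm]; exact this hb ha (by omega)
  calc (a + b) ^ 3 ≤ (b + b) ^ 3 := by gcongr
    _ = 8 * b ^ 3 := by ring
    _ ≤ _ := by gcongr

lemma parameter_bounds {n T M K : ℕ} (hT2 : 2 ≤ T) (hTM : T ^ 8 ≤ M) (hM4 : M ^ 4 ≤ n)
    (hK : K = n / T ^ 5) :
    M ≤ n ∧ 12 * M ≤ n ∧ 3 * (M + 1) ≤ n ∧ 4 * M ≤ K ∧ 4 * K ≤ n ∧ 0 < K ∧ K * T ^ 5 ≤ n ∧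
      n ≤ 2 * T ^ 5 * K := by
  have hT5M : T ^ 5 ≤ M := (Nat.pow_le_pow_right (by omega) (by norm_num)).trans hTM
  have hT5 : 32 ≤ T ^ 5 := le_trans (by norm_num) (Nat.pow_le_pow_left hT2 5)
  have hT0 : 0 < T ^ 5 := by omega
  have hKT : K * T ^ 5 ≤ n := hK ▸ Nat.div_mul_le_self n _
  have hlt : n < T ^ 5 * (K + 1) := hK ▸ Nat.lt_mul_div_succ n hT0
  have hM32 : 32 ≤ M := hT5.trans hT5M
  have hMM : 32 * (M * M) ≤ n := by
    refine le_trans ?_ hM4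
    rw [show M ^ 4 = (M * M) * (M * M) by ring]
    exact Nat.mul_le_mul_right _ (by nlinarith)
  have h32M : 32 * (32 * M) ≤ n := le_trans (by nlinarith) hMM
  have hMK : 4 * M ≤ K := by
    rw [hK, Nat.le_div_iff_mul_le hT0]
    calc 4 * M * T ^ 5 ≤ 4 * M * M := Nat.mul_le_mul_left _ hT5M
      _ ≤ n := by nlinarith
  generalize T ^ 5 = R at *
  refine ⟨by omega, by omega, by omega, hMK, by nlinarith, by omega, hKT, by nlinarith⟩

open Classical in
/-- For large `n`, a core bound and the expected restrictions on short cycles imply that a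
positive proportion of the conjugates of `p` generate, together with `q`, a group containing the
alternating group. -/
theorem eventually_le_card_generating {A c δ η : ℝ} (hA : 0 < A) (hc : 0 < c) (hc1 : c ≤ 1)
    (hδ : 0 < δ) (hη : 0 < η) : ∀ᶠ n : ℕ in atTop, ∀ p q : Perm (Fin n), CoreBound p q A c →
      numOrb p 1 ^ 3 ≤ n ^ 2 → numOrb q 1 ^ 3 ≤ n ^ 2 →
      (numOrb p 2 + numOrb q 2 : ℝ) ≤ (1 - δ) * n →
      (Real.exp (-(4 * A / c)) - η) * (cls p).card ≤
        ((cls p).filter (fun ρ => alternatingGroup (Fin n) ≤ Subgroup.closure {ρ, q})).card := by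
  set B : ℝ := 4 * A / c + 1 + (72 / c + 10) + 36 * 16 * 24 ^ 2 / c ^ 2 +
    (80 * 8 * 24 / c + 36 * 4 * 24 ^ 3 / c ^ 3) with hB
  have hB0 : 0 < B := by positivity
  have hTt : Tendsto (fun t : ℕ => ((t + 1 : ℕ) : ℝ)) atTop atTop :=
    tendsto_natCast_atTop_atTop.comp (tendsto_add_atTop_nat 1)
  have hsqrt : ∀ᶠ t : ℕ in atTop, Nat.sqrt t ≤ t / 4 := by
    filter_upwards [eventually_ge_atTop 16] with t ht
    have h1 : 4 ≤ Nat.sqrt t := Nat.le_sqrt.2 ht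
    have h2 := Nat.sqrt_le t
    rw [Nat.le_div_iff_mul_le (by norm_num)]
    nlinarith
  have hnR : Tendsto (fun n : ℕ => (n : ℝ)) atTop atTop := tendsto_natCast_atTop_atTop
  filter_upwards [tendsto_log_eight.eventually eventually_pow_le_eight_pow_sqrt,
    tendsto_log_eight.eventually hsqrt,
    tendsto_log_eight.eventually (eventually_ge_atTop 1),
    (hTt.comp tendsto_log_eight).eventually (eventually_ge_atTop (72 / δ)),
    (hTt.comp tendsto_log_eight).eventually (eventually_ge_atTop (2 * B / η)),
    (tendsto_sum_inv_prime.comp tendsto_log_eight).eventually (eventually_ge_atTop (8 / η)),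
    (hnR.const_mul_atTop (show 0 < (c ^ 3 / (128 * A)) ^ 3 by positivity)).eventually
      (eventually_ge_atTop A),
    hnR.eventually (eventually_ge_atTop (4096 / δ ^ 3)),
    eventually_gt_atTop 0] with n t1 t2 t3 t4 t5 t6 t7 t8 hn0 p q hcore hp1 hq1 h2
  simp only [Function.comp] at t4 t5 t6
  set t := Nat.log 8 n with ht
  set T := t + 1 with hT
  set m := 8 ^ Nat.sqrt t with hm
  set M := 8 ^ (t / 4) with hM
  set K := n / T ^ 5 with hK
  set P := (Ioc m M).filter Nat.Prime with hP
  set S := ∑ r ∈ P, (1 : ℝ) / r with hS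
  set d := ⌊δ / 4 * n⌋₊ with hd
  set f := numOrb p 1 + numOrb q 1 with hf
  set ε := c / (8 * Real.log ((n : ℝ) + 1)) with hε
  have hn1 : (1 : ℝ) ≤ n := by exact_mod_cast hn0
  have hT1 : 1 ≤ T := by omega
  have hT2 : 2 ≤ T := by omega
  have hT1R : (1 : ℝ) ≤ T := by exact_mod_cast hT1
  have hm0 : 0 < m := by positivity
  have hmM : m ≤ M := Nat.pow_le_pow_right (by norm_num) t2
  have hM4 : M ^ 4 ≤ n := by
    rw [hM, ← pow_mul]
    exact (Nat.pow_le_pow_right (by norm_num) (Nat.div_mul_le_self t 4)).trans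
      (Nat.pow_log_le_self 8 hn0.ne')
  have hn8 : n < 8 ^ T := Nat.lt_pow_succ_log_self (by norm_num) n
  have hn2 : n < 2 ^ (3 * T) := by rw [pow_mul]; exact hn8
  have hTM : T ^ 8 ≤ M := t1.trans hmM
  obtain ⟨hMn, hM12, hM3, hMK, hK4, hK0, hKT, hnK⟩ := parameter_bounds hT2 hTM hM4 hK
  have hmn : m ≤ n := hmM.trans hMn
  have hTn : T ≤ n := ((Nat.le_self_pow (by norm_num) T).trans hTM).trans hMn
  have hlog2 : Real.log 2 ≤ 1 := by linarith [Real.log_two_lt_d9]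
  have hl : 0 < Real.log ((n : ℝ) + 1) := Real.log_pos (by linarith)
  have hlT : Real.log ((n : ℝ) + 1) ≤ 3 * T := by
    have h1 : (n : ℝ) + 1 ≤ 2 ^ (3 * T) := by exact_mod_cast hn2
    have h2 := Real.log_le_log (by linarith) h1
    rw [Real.log_pow] at h2
    push_cast at h2
    refine h2.trans ?_
    nlinarith
  have hlT' : 1 + Real.log (n : ℝ) ≤ 4 * T := by
    have := Real.log_le_log (by linarith) (show (n : ℝ) ≤ n + 1 by linarith)
    linarith
  have hε0 : 0 < ε := by positivity
  have hεT : c / (24 * T) ≤ ε := by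
    rw [hε]
    exact div_le_div_of_nonneg_left hc.le (by linarith) (by linarith)
  have hL2 : Nat.log 2 (2 * n) ≤ 4 * T := by
    have : Nat.log 2 (2 * n) < 3 * T + 1 := by
      refine Nat.log_lt_of_lt_pow (by omega) ?_
      rw [pow_succ]; omega
    omega
  have hS8 : 8 / η ≤ S := t6
  have hS0 : 0 < S := lt_of_lt_of_le (by positivity) hS8
  have hS4 : S ≤ 4 * T := (sum_inv_prime_le m M n hMn).trans hlT'
  have hf3 : f ^ 3 ≤ 8 * n ^ 2 := add_pow_three_le hp1 hq1
  have hd1 : (d : ℝ) ≤ δ / 4 * n := Nat.floor_le (by positivity)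
  have hd2 : δ / 4 * n ≤ d + 1 := (Nat.lt_floor_add_one _).le
  have hfn : 2 * (numOrb p 1 + numOrb q 1 : ℝ) ≤ δ / 4 * n := by
    have h3 : (f : ℝ) ^ 3 ≤ 8 * n ^ 2 := by exact_mod_cast hf3
    have : (2 * (f : ℝ)) ^ 3 ≤ (δ / 4 * n) ^ 3 := by
      rw [div_le_iff₀ (by positivity)] at t8
      calc (2 * (f : ℝ)) ^ 3 = 8 * (f : ℝ) ^ 3 := by ring
        _ ≤ 8 * (8 * (n : ℝ) ^ 2) := by gcongr
        _ = 4096 * (n : ℝ) ^ 2 / 64 := by ring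
        _ ≤ n * δ ^ 3 * (n : ℝ) ^ 2 / 64 := by gcongr
        _ = _ := by ring
    have h := le_of_pow_le_pow_left₀ (by norm_num) (by positivity) this
    rw [hf] at h
    push_cast at h
    exact h
  have key := le_card_generating (p := p) (q := q) (A := A) (c := c) (ε := ε) hA hc hc1
    (M := M) (m := m) (K := K) (d := d) (f := f)
    (by rw [Fintype.card_fin]; exact t7) hcore hε0
    (by rw [Fintype.card_fin, hε]; field_simp; exact le_rfl)
    hm0 (by rw [Fintype.card_fin]; exact hM3) (by rw [Fintype.card_fin]; exact hM12) hMK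
    (by rw [Fintype.card_fin]; exact hK4) hK0
    (card_orbs_add_le (δ := δ) (by rwa [Fintype.card_fin]) (by rwa [Fintype.card_fin])
      (by rwa [Fintype.card_fin]))
    (by rw [← numOrb_one, ← numOrb_one, hf, add_comm]) P
    (fun r hr => by
      rw [hP, mem_filter, mem_Ioc] at hr
      exact ⟨hr.2, hr.1.1.le, hr.1.2⟩) hS0
  rw [Fintype.card_fin] at key
  refine le_trans ?_ key
  refine mul_le_mul_of_nonneg_right (sub_le_sub_left ?_ _) (Nat.cast_nonneg _)
  have g1 := expanding_error_le (ε := ε) hA hT1 hTn hc hε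
  have g2 := blocks_error_le hT1 hδ t4 t1 hmn hn2.le hd2
  have g3 := existence_error_le hT1 hTM hM4 hc hεT hf3
  have g4 := small_cycle_error_le hT1 t1 hc hεT hS4 hlT'
  have g5 := large_cycle_error_le hT1 t1 hn0 hc hεT hS0.le hS4 hL2 hnK hKT
  have g6 : 4 / S ≤ η / 2 := by
    rw [div_le_div_iff₀ hS0 (by norm_num)]
    rw [div_le_iff₀ hη] at hS8
    linarith
  have g7 : B / T ≤ η / 2 := by
    rw [div_le_div_iff₀ (by linarith) (by norm_num)]
    rw [div_le_iff₀ hη] at t5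
    linarith
  have g8 : B / T = 4 * A / c / T + 1 / T + (72 / c + 10) / T + 36 * 16 * 24 ^ 2 / c ^ 2 / T +
    (80 * 8 * 24 / c + 36 * 4 * 24 ^ 3 / c ^ 3) / T := by rw [hB]; ring
  linarith

lemma cycleCount_one {n : ℕ} (q : Perm (Fin n)) : cycleCount q 1 = numOrb q 1 := by
  rw [cycleCount, if_pos rfl, numOrb_one, Nat.card_eq_fintype_card, Fintype.card_subtype]
  rfl

lemma cycleCount_two {n : ℕ} (q : Perm (Fin n)) : cycleCount q 2 = numOrb q 2 := by
  rw [cycleCount, if_neg (by norm_num), numOrb_eq_count q le_rfl]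

lemma mem_cls_iff_isConj {α : Type*} [Fintype α] [DecidableEq α] {p ρ : Perm α} :
    ρ ∈ cls p ↔ IsConj p ρ := by rw [mem_cls, isConj_iff]

lemma numOrb_one_of_mem_cls {α : Type*} [Fintype α] [DecidableEq α] {p ρ : Perm α}
    (h : ρ ∈ cls p) : numOrb ρ 1 = numOrb p 1 := by
  obtain ⟨σ, rfl⟩ := mem_cls.1 h
  rw [numOrb_one, numOrb_one, card_fixed_conj]

lemma numOrb_two_of_mem_cls {α : Type*} [Fintype α] [DecidableEq α] {p ρ : Perm α}
    (h : ρ ∈ cls p) : numOrb ρ 2 = numOrb p 2 := by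
  obtain ⟨σ, rfl⟩ := mem_cls.1 h
  rw [numOrb_eq_count _ le_rfl, numOrb_eq_count _ le_rfl, cycleType_conj]

lemma natCard_isConj {n : ℕ} (p : Perm (Fin n)) :
    Nat.card {σ : Perm (Fin n) // IsConj p σ} = (cls p).card := by
  classical
  rw [Nat.card_eq_fintype_card, Fintype.card_subtype]
  congr 1
  ext σ
  rw [mem_filter, mem_cls_iff_isConj]
  simp

open Classical in
lemma natCard_generating {n : ℕ} (p p' : Perm (Fin n)) :
    Nat.card {x : Perm (Fin n) × Perm (Fin n) // IsConj p x.1 ∧ IsConj p' x.2 ∧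
      alternatingGroup (Fin n) ≤ Subgroup.closure {x.1, x.2}} =
    ∑ q ∈ cls p', ((cls p).filter
      (fun ρ => alternatingGroup (Fin n) ≤ Subgroup.closure {ρ, q})).card := by
  rw [Nat.card_eq_fintype_card, Fintype.card_subtype, ← card_sigma]
  refine card_bij (fun x _ => ⟨x.2, x.1⟩) ?_ ?_ ?_
  · intro x hx
    obtain ⟨-, h1, h2, h3⟩ := mem_filter.1 hx
    exact mem_sigma.2 ⟨mem_cls_iff_isConj.2 h2, mem_filter.2 ⟨mem_cls_iff_isConj.2 h1, h3⟩⟩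
  · rintro ⟨x, y⟩ _ ⟨z, w⟩ _ h
    simp only [Sigma.mk.injEq, heq_eq_eq] at h
    exact Prod.ext h.2 h.1
  · rintro ⟨q, ρ⟩ hx
    obtain ⟨h1, h2⟩ := mem_sigma.1 hx
    obtain ⟨h2, h3⟩ := mem_filter.1 h2
    exact ⟨(ρ, q), mem_filter.2 ⟨mem_univ _, mem_cls_iff_isConj.1 h2, mem_cls_iff_isConj.1 h1, h3⟩,
      rfl⟩

lemma card_cls_pos {α : Type*} [Fintype α] [DecidableEq α] (p : Perm α) : 0 < (cls p).card :=
  card_pos.2 ⟨p, mem_cls.2 ⟨1, by simp⟩⟩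

lemma genProb_le_one {n : ℕ} (p p' : Perm (Fin n)) : genProb n p p' ≤ 1 := by
  classical
  rw [genProb, natCard_generating, natCard_isConj, natCard_isConj]
  refine div_le_one_of_le₀ ?_ (by positivity)
  rw [mul_comm]
  push_cast
  rw [← nsmul_eq_mul]
  exact sum_le_card_nsmul _ _ _ fun q _ => Nat.cast_le.2 (card_filter_le _ _)

open Classical in
lemma le_genProb {n : ℕ} {p p' : Perm (Fin n)} {κ : ℝ}
    (h : ∀ q ∈ cls p', κ * (cls p).card ≤ ((cls p).filter
      (fun ρ => alternatingGroup (Fin n) ≤ Subgroup.closure {ρ, q})).card) :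
    κ ≤ genProb n p p' := by
  have h1 : (0 : ℝ) < (cls p).card := by exact_mod_cast card_cls_pos p
  have h2 : (0 : ℝ) < (cls p').card := by exact_mod_cast card_cls_pos p'
  rw [genProb, natCard_generating, natCard_isConj, natCard_isConj, le_div_iff₀ (by positivity)]
  have := card_nsmul_le_sum (cls p') (fun q => (((cls p).filter
    (fun ρ => alternatingGroup (Fin n) ≤ Subgroup.closure {ρ, q})).card : ℝ)) _ h
  rw [nsmul_eq_mul] at this
  push_cast
  linarith

lemma pow_three_le_sq {a n : ℕ} (h : (a : ℝ) ≤ (n : ℝ) ^ ((2 : ℝ) / 3)) : a ^ 3 ≤ n ^ 2 := by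
  have h1 : (a : ℝ) ^ 3 ≤ ((n : ℝ) ^ ((2 : ℝ) / 3)) ^ 3 := by gcongr
  rw [← Real.rpow_natCast, ← Real.rpow_natCast, ← Real.rpow_mul (Nat.cast_nonneg n)] at h1
  norm_num at h1
  exact_mod_cast h1

lemma eventually_pow_three_le_sq {u : ℕ → ℕ}
    (h : (fun n => (u n : ℝ)) =o[atTop] fun n => (n : ℝ) ^ ((2 : ℝ) / 3)) :
    ∀ᶠ n in atTop, u n ^ 3 ≤ n ^ 2 := by
  filter_upwards [h.bound one_pos] with n hn
  apply pow_three_le_sq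
  rwa [one_mul, Real.norm_of_nonneg (Nat.cast_nonneg _),
    Real.norm_of_nonneg (by positivity)] at hn

/-- If the numbers of `2`-cycles satisfy the density condition, they are at most `(1 - δ) n`. -/
lemma exists_eventually_le_of_limsup_lt {b b' : ℕ → ℕ} (hb : ∀ n, b n ≤ n) (hb' : ∀ n, b' n ≤ n)
    (h : limsup (fun n => ((b n : ℝ) + b' n) / n) atTop < 1) :
    ∃ δ : ℝ, 0 < δ ∧ δ ≤ 1 ∧ ∀ᶠ n : ℕ in atTop, (b n + b' n : ℝ) ≤ (1 - δ) * n := by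
  obtain ⟨r, hr1, hr2⟩ := exists_between (max_lt h one_pos)
  have hr0 : 0 < r := (le_max_right _ _).trans_lt hr1
  refine ⟨1 - r, by linarith, by linarith, ?_⟩
  have hbd : IsBoundedUnder (· ≤ ·) atTop (fun n => ((b n : ℝ) + b' n) / n) := by
    refine isBoundedUnder_of ⟨2, fun n => div_le_of_le_mul₀ (Nat.cast_nonneg _) (by norm_num) ?_⟩
    have h1 : (b n : ℝ) ≤ n := by exact_mod_cast hb n
    have h2 : (b' n : ℝ) ≤ n := by exact_mod_cast hb' n
    linarith
  filter_upwards [eventually_lt_of_limsup_lt ((le_max_left _ _).trans_lt hr1) hbd,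
    eventually_gt_atTop 0] with n hn hn0
  have : (0 : ℝ) < n := by exact_mod_cast hn0
  rw [div_lt_iff₀ this] at hn
  linarith

lemma mul_bounds_of_mul_le {a b a' b' X : ℝ} (ha : 0 ≤ a) (hb : 0 ≤ b) (ha' : 0 ≤ a')
    (hb' : 0 ≤ b') (h : (a + √b) * (a' + √b') ≤ X) :
    a * a' ≤ X ∧ a ^ 2 * b' ≤ X ^ 2 ∧ a' ^ 2 * b ≤ X ^ 2 := by
  have s1 := Real.sqrt_nonneg b
  have s2 := Real.sqrt_nonneg b'
  have p1 := mul_nonneg ha ha'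
  have p2 := mul_nonneg ha s2
  have p3 := mul_nonneg s1 ha'
  have p4 := mul_nonneg s1 s2
  refine ⟨by nlinarith, ?_, ?_⟩
  · have : a * √b' ≤ X := by nlinarith
    calc a ^ 2 * b' = (a * √b') ^ 2 := by rw [mul_pow, Real.sq_sqrt hb']
      _ ≤ X ^ 2 := by gcongr
  · have : √b * a' ≤ X := by nlinarith
    calc a' ^ 2 * b = (√b * a') ^ 2 := by rw [mul_pow, Real.sq_sqrt hb, mul_comm]
      _ ≤ X ^ 2 := by gcongr

lemma numOrb_two_le {n : ℕ} (q : Perm (Fin n)) : numOrb q 2 ≤ n := by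
  have := numOrb_add_le q
  rw [Fintype.card_fin] at this
  omega

/-- The generation probability is eventually bounded below by a positive constant. -/
theorem exists_eventually_le_genProb (π π' : (n : ℕ) → Perm (Fin n))
    (h1 : (fun n => (numOrb (π n) 1 : ℝ)) =o[atTop] fun n => (n : ℝ) ^ ((2 : ℝ) / 3))
    (h1' : (fun n => (numOrb (π' n) 1 : ℝ)) =o[atTop] fun n => (n : ℝ) ^ ((2 : ℝ) / 3))
    (h2 : (fun n => ((numOrb (π n) 1 : ℝ) + √(numOrb (π n) 2)) *
        ((numOrb (π' n) 1 : ℝ) + √(numOrb (π' n) 2))) =O[atTop] fun n => (n : ℝ))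
    (h3 : limsup (fun n => ((numOrb (π n) 2 : ℝ) + (numOrb (π' n) 2 : ℝ)) / n) atTop < 1) :
    ∃ κ : ℝ, 0 < κ ∧ ∀ᶠ n in atTop, κ ≤ genProb n (π n) (π' n) := by
  classical
  obtain ⟨δ, hδ, hδ1, hδn⟩ := exists_eventually_le_of_limsup_lt
    (fun n => numOrb_two_le (π n)) (fun n => numOrb_two_le (π' n)) h3
  obtain ⟨K, hKn⟩ := h2.bound
  have hA := coreConst_pos hδ K
  set A := coreConst δ K with hAdef
  set κ := Real.exp (-(4 * A / (δ / 24))) with hκ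
  have hκ0 : 0 < κ := Real.exp_pos _
  refine ⟨κ / 2, by positivity, ?_⟩
  have hmain := eventually_le_card_generating (A := A) (c := δ / 24) (δ := δ) (η := κ / 2) hA
    (by positivity) (by linarith) hδ (by positivity)
  have hlarge := (tendsto_natCast_atTop_atTop (R := ℝ)).eventually
    (eventually_ge_atTop ((8 * (24 / δ)) ^ 3))
  filter_upwards [hmain, hlarge, hKn, hδn, eventually_pow_three_le_sq h1,
    eventually_pow_three_le_sq h1'] with n hn hnl hKb hδb hc1 hc1'
  rw [Real.norm_of_nonneg (by positivity), Real.norm_of_nonneg (Nat.cast_nonneg _)] at hKb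
  obtain ⟨b1, b2, b3⟩ := mul_bounds_of_mul_le (Nat.cast_nonneg _) (Nat.cast_nonneg _)
    (Nat.cast_nonneg _) (Nat.cast_nonneg _) hKb
  rw [mul_pow] at b2 b3
  refine le_genProb fun q hq => ?_
  have e1 := numOrb_one_of_mem_cls hq
  have e2 := numOrb_two_of_mem_cls hq
  have hcore : CoreBound (π n) q A (δ / 24) := by
    refine coreBound_of hδ hδ1 ?_ ?_ ?_ ?_ ?_ ?_ ?_ <;>
      simp only [Fintype.card_fin, e1, e2]
    · exact hnl
    · exact hδb
    · exact b1
    · exact b2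
    · exact b3
    · exact_mod_cast hc1
    · exact_mod_cast hc1'
  have := hn (π n) q hcore hc1 (by rw [e1]; exact hc1') (by rw [e2]; exact hδb)
  convert this using 2
  ring

end RandGen

/-- If `c₁(n), c'₁(n) = o(n^{2/3})`, `(c₁ + c₂^{1/2})(c'₁ + c'₂^{1/2}) = O(n)` and
`limsup (c₂ + c'₂)/n < 1`, then two independent uniformly random elements of the classes of
`π n` and `π' n` generate a subgroup containing `A_n` with probability bounded away from `0`. -/
theorem random_generation_positive_probability
    (π π' : (n : ℕ) → Equiv.Perm (Fin n))
    (h1 : (fun n => (cycleCount (π n) 1 : ℝ)) =o[atTop] fun n => (n : ℝ) ^ ((2 : ℝ) / 3))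
    (h1' : (fun n => (cycleCount (π' n) 1 : ℝ)) =o[atTop] fun n => (n : ℝ) ^ ((2 : ℝ) / 3))
    (h2 : (fun n => ((cycleCount (π n) 1 : ℝ) + Real.sqrt (cycleCount (π n) 2)) *
        ((cycleCount (π' n) 1 : ℝ) + Real.sqrt (cycleCount (π' n) 2))) =O[atTop]
        fun n => (n : ℝ))
    (h3 : limsup (fun n => ((cycleCount (π n) 2 : ℝ) + (cycleCount (π' n) 2 : ℝ)) / n) atTop
        < 1) :
    0 < liminf (fun n => genProb n (π n) (π' n)) atTop := by
  simp only [RandGen.cycleCount_one, RandGen.cycleCount_two] at h1 h1' h2 h3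
  obtain ⟨κ, hκ, h⟩ := RandGen.exists_eventually_le_genProb π π' h1 h1' h2 h3
  refine hκ.trans_le (le_liminf_of_le ?_ h)
  exact IsBoundedUnder.isCoboundedUnder_ge
    (isBoundedUnder_of ⟨1, fun n => RandGen.genProb_le_one _ _⟩)
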